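/- Let A = kQ/I be a toupie algebra that is not hereditary and not simply connected, and such that no branch of Q lies in the ideal I (i.e., w_i ∉ I for all i ∈ {1, …, t}). Then A is not a laura algebra (and hence is neither tilted, quasitilted, nor weakly shod). -/

import Mathlib

/-!
Formalization preamble for "Toupie algebras".

We realize the bound quiver algebra `A = kQ/I` of a toupie quiver `Q` concretely:
the path algebra `kQ` is realized, via its (faithful) left regular representation,
as the subalgebra of `Module.End k (paths → k)` generated by the operators of left
multiplication by the trivial paths `e_v` and by the arrows of `Q`.  Paths are
composed from left to right (`p * q` = "first `p`, then `q`"), as in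
Assem–Simson–Skowroński, so that paths from the source `0` to the sink `∞` span
`e₀ (kQ) e∞`, and (right) `A`-modules are identified with representations of `(Q, I)`.
Right `A`-modules are formalized as (left) modules over `Aᵐᵒᵖ`.
-/

set_option synthInstance.maxHeartbeats 400000
set_option maxHeartbeats 800000

noncomputable section
open scoped Classical
open MulOpposite

universe u

namespace Toupie

/-- Vertices of a toupie quiver with `t` branches, branch `i` having length `ℓ i ≥ 1`:
the unique source `src`, the unique sink `snk`, and for each branch `i` its interior
vertices `mid i a` (the `(a+1)`-st vertex on branch `i`, for `a : Fin (ℓ i - 1)`). -/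
inductive Vtx (t : ℕ) (ℓ : Fin t → ℕ) : Type
  | src : Vtx t ℓ
  | snk : Vtx t ℓ
  | mid (i : Fin t) (a : Fin (ℓ i - 1)) : Vtx t ℓ

/-- The `a`-th vertex on branch `i`, for `0 ≤ a ≤ ℓ i`
(`a = 0` is the source, `a = ℓ i` is the sink). -/
def vtx (t : ℕ) (ℓ : Fin t → ℕ) (i : Fin t) (a : ℕ) : Vtx t ℓ :=
  if a = 0 then .src else if h : a - 1 < ℓ i - 1 then .mid i ⟨a - 1, h⟩ else .snk

/-- The paths of a toupie quiver: trivial paths at the vertices, and for each branch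
`i` and `a < b ≤ ℓ i` the path `sub i a b` along branch `i` from its `a`-th vertex to
its `b`-th vertex.  (`sub i 0 (ℓ i)` is the `i`-th branch `w i`.) -/
inductive PIdx (t : ℕ) (ℓ : Fin t → ℕ) : Type
  | vert (v : Vtx t ℓ) : PIdx t ℓ
  | sub (i : Fin t) (a b : ℕ) (hab : a < b) (hb : b ≤ ℓ i) : PIdx t ℓ

variable (k : Type u) [Field k] (t : ℕ) (ℓ : Fin t → ℕ)

/-- The vector space with basis the set of paths of the toupie quiver. -/
abbrev PSp : Type u := PIdx t ℓ → k

variable {t ℓ}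

/-- The starting vertex of a path. -/
def startIdx : PIdx t ℓ → Vtx t ℓ
  | .vert v => v
  | .sub i a _ _ _ => vtx t ℓ i a

/-- Left multiplication by the trivial path (primitive idempotent) `e_v`. -/
def Ev (v : Vtx t ℓ) : Module.End k (PSp k t ℓ) where
  toFun f := fun p => if startIdx p = v then f p else 0
  map_add' f g := by funext p; by_cases h : startIdx p = v <;> simp [h]
  map_smul' c f := by funext p; by_cases h : startIdx p = v <;> simp [h]

/-- Strip the `j`-th arrow of branch `i` (the arrow `vtx i j ⟶ vtx i (j+1)`) from the
front of a path, if possible. -/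
def strip (i : Fin t) (j : ℕ) : PIdx t ℓ → Option (PIdx t ℓ)
  | .vert _ => none
  | .sub i' a b _ hb =>
      if h : i' = i ∧ a = j then
        if hb2 : j + 1 < b then some (.sub i (j + 1) b hb2 (h.1 ▸ hb))
        else some (.vert (vtx t ℓ i b))
      else none

/-- Left multiplication by the `j`-th arrow of branch `i`
(the arrow from `vtx i j` to `vtx i (j+1)`, for `j < ℓ i`; the zero operator for junk `j`). -/
def Ar (i : Fin t) (j : ℕ) : Module.End k (PSp k t ℓ) where
  toFun f := fun p => (strip i j p).elim 0 f
  map_add' f g := by funext p; rcases h : strip i j p with _ | q <;> simp [h]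
  map_smul' c f := by funext p; rcases h : strip i j p with _ | q <;> simp [h]

variable (t ℓ)

/-- The generators of the path algebra: the trivial paths and the arrows. -/
def gens : Set (Module.End k (PSp k t ℓ)) :=
  Set.range (Ev k) ∪ {x | ∃ i j, x = Ar k i j}

/-- The path algebra `kQ` of the toupie quiver, realized as the subalgebra of
`Module.End k (PSp k t ℓ)` generated by left multiplication by trivial paths and arrows. -/
def PathAlg : Subalgebra k (Module.End k (PSp k t ℓ)) :=
  Algebra.adjoin k (gens k t ℓ)

variable {k t ℓ}

/-- The trivial path `e_v` as an element of the path algebra. -/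
def eV (v : Vtx t ℓ) : PathAlg k t ℓ :=
  ⟨Ev k v, Algebra.subset_adjoin (Or.inl ⟨v, rfl⟩)⟩

/-- The `j`-th arrow of branch `i` as an element of the path algebra. -/
def arE (i : Fin t) (j : ℕ) : PathAlg k t ℓ :=
  ⟨Ar k i j, Algebra.subset_adjoin (Or.inr ⟨i, j, rfl⟩)⟩

/-- The path along branch `i` from its `a`-th vertex to its `b`-th vertex, as an element
of the path algebra: the product (composed from left to right) of the arrows
`a → a+1 → ⋯ → b`.  (For `b ≤ a` this is the empty product `1`.) -/
def subE (i : Fin t) (a b : ℕ) : PathAlg k t ℓ :=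
  (((List.range (b - a)).map fun s => arE i (a + s)).prod)

/-- The `i`-th branch `w i` (the path from the source to the sink along branch `i`)
as an element of the path algebra. -/
def wE (i : Fin t) : PathAlg k t ℓ := subE i 0 (ℓ i)

variable {k : Type u} [Field k]

/-- A toupie algebra `A = kQ/I`: a toupie quiver `Q` (a non-linear quiver with a unique
source, a unique sink, and all other vertices having exactly one incoming and one
outgoing arrow, i.e. `t ≥ 2` branches of lengths `ℓ i ≥ 1`), together with an admissible
ideal `I` of the path algebra `kQ`.  Since `Q` is finite and acyclic, the arrow ideal is
nilpotent, so admissibility amounts to `I ⊆ R_Q²`, i.e. every element of `I` is a linear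
combination of paths of length `≥ 2`. -/
structure ToupieAlg (k : Type u) [Field k] : Type u where
  t : ℕ
  ht : 2 ≤ t
  ℓ : Fin t → ℕ
  hℓ : ∀ i, 1 ≤ ℓ i
  I : TwoSidedIdeal (PathAlg k t ℓ)
  adm : ∀ x ∈ I, x ∈ Submodule.span k
    {y : PathAlg k t ℓ | ∃ i a b, a + 2 ≤ b ∧ b ≤ ℓ i ∧ y = subE i a b}

variable (T : ToupieAlg k)

/-- The underlying algebra `A = kQ/I` of a toupie algebra. -/
def Alg : Type u := T.I.ringCon.Quotient

instance : Ring (Alg T) := inferInstanceAs (Ring T.I.ringCon.Quotient)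

/-- The quotient map `kQ → A = kQ/I`. -/
def mkA : PathAlg k T.t T.ℓ →+* Alg T := T.I.ringCon.mk'

lemma mkA_surjective : Function.Surjective (mkA T) := Quotient.mk''_surjective

instance : Algebra k (Alg T) :=
  RingHom.toAlgebra' ((mkA T).comp (algebraMap k (PathAlg k T.t T.ℓ)))
    (by
      intro c x
      obtain ⟨y, rfl⟩ := mkA_surjective T x
      simp only [RingHom.coe_comp, Function.comp_apply, ← map_mul]
      rw [Algebra.commutes])

/-- The idempotent `e₀` (at the source) in `A`. -/
def e0 : Alg T := mkA T (eV Vtx.src)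

/-- The idempotent `e∞` (at the sink) in `A`. -/
def einf : Alg T := mkA T (eV Vtx.snk)

/-- The `k`-linear map `A → A`, `x ↦ e₀ * x * e∞`, whose range is `e₀ A e∞`. -/
def lrMap : Alg T →ₗ[k] Alg T where
  toFun x := e0 T * x * einf T
  map_add' x y := by simp [mul_add, add_mul]
  map_smul' c x := by
    simp only [RingHom.id_apply]
    rw [mul_smul_comm, smul_mul_assoc]

/-- `m = dim_k e₀ A e∞`, the dimension of the span of the (residues of the) paths from
the source to the sink. -/
def mDim : ℕ := Module.finrank k ↥(LinearMap.range (lrMap T))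

/-- The branch `w i` lies in the ideal `I`. -/
def branchInI (i : Fin T.t) : Prop := wE i ∈ T.I

/-- A minimal relation: `∑_{i ∈ J} λ i • w i ∈ I` with `|J| ≥ 2`, all `λ i ≠ 0`, and no
nonempty proper subsum in `I`. -/
def MinRel (J : Finset (Fin T.t)) (lam : Fin T.t → k) : Prop :=
  2 ≤ J.card ∧ (∀ i ∈ J, lam i ≠ 0) ∧ (∑ i ∈ J, lam i • wE i) ∈ T.I ∧
    ∀ J' ⊂ J, J'.Nonempty → (∑ i ∈ J', lam i • wE i) ∉ T.I

/-- A toupie algebra is simply connected if any two distinct branches are involved in a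
common minimal relation. -/
def SimplyConnected : Prop :=
  ∀ i j : Fin T.t, i ≠ j → ∃ J lam, MinRel T J lam ∧ i ∈ J ∧ j ∈ J

/-- A (minimal) zero-relation on branch `i`: the subpath of branch `i` from its `a`-th
to its `b`-th vertex lies in `I`, but no proper subpath of it does. -/
def ZeroRel (i : Fin T.t) (a b : ℕ) : Prop :=
  a < b ∧ b ≤ T.ℓ i ∧ subE i a b ∈ T.I ∧
    ∀ a' b', a ≤ a' → b' ≤ b → a' < b' → (a', b') ≠ (a, b) → subE i a' b' ∉ T.I

/-- There is exactly one relation on branch `i`. -/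
def ExactlyOneRel (i : Fin T.t) : Prop := ∃! p : ℕ × ℕ, ZeroRel T i p.1 p.2

/-- Branch `i` carries more than one relation. -/
def MoreThanOneRel (i : Fin T.t) : Prop :=
  ∃ p q : ℕ × ℕ, p ≠ q ∧ ZeroRel T i p.1 p.2 ∧ ZeroRel T i q.1 q.2

/-- At most one branch of `Q` has length at least three. -/
def AtMostOneLongBranch : Prop := ∀ i j : Fin T.t, 3 ≤ T.ℓ i → 3 ≤ T.ℓ j → i = j

/-- The two-sided ideal `I` is generated by the set `S`. -/
def IsGenBy {R : Type u} [Ring R] (I : TwoSidedIdeal R) (S : Set R) : Prop :=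
  S ⊆ (I : Set R) ∧ ∀ J : TwoSidedIdeal R, S ⊆ (J : Set R) → (I : Set R) ⊆ (J : Set R)

/-- A toupie algebra is canonical if (after choosing two distinguished branches `i₁, i₂`)
its ideal is generated by `{w i₁ + λ j • w i₂ - w j}` over the remaining branches `j`,
with the `λ j` pairwise distinct and nonzero. -/
def IsCanonical : Prop :=
  ∃ (i₁ i₂ : Fin T.t) (lam : Fin T.t → k), i₁ ≠ i₂ ∧
    (∀ j, j ≠ i₁ → j ≠ i₂ → lam j ≠ 0) ∧
    (∀ j j', j ≠ i₁ → j ≠ i₂ → j' ≠ i₁ → j' ≠ i₂ → j ≠ j' → lam j ≠ lam j') ∧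
    IsGenBy T.I {x | ∃ j, j ≠ i₁ ∧ j ≠ i₂ ∧ x = wE i₁ + lam j • wE i₂ - wE j}

end Toupie
namespace Toupie

/-! ### Module-theoretic notions over an arbitrary ring

Following the paper, all modules are finite-dimensional *right* modules; a right
`A`-module is formalized as a (left) module over `Aᵐᵒᵖ`.  The definitions below are
stated for modules over an arbitrary ring `R` and are applied with `R := Aᵐᵒᵖ`. -/

variable (R : Type u) [Ring R]

/-- A module is indecomposable if it is nonzero and its only idempotent endomorphisms
are `0` and the identity. -/
def Indec (M : ModuleCat.{u} R) : Prop :=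
  Nontrivial M ∧ ∀ f : M →ₗ[R] M, f.comp f = f → f = 0 ∨ f = LinearMap.id

/-- Finiteness ("finite dimensionality") of a module. -/
def FdMod (M : ModuleCat.{u} R) : Prop := Module.Finite R M

/-- `M` has projective dimension at most one: it is the quotient of a projective module
by a projective submodule. -/
def PdLeOne (M : ModuleCat.{u} R) : Prop :=
  ∃ (P : ModuleCat.{u} R) (f : P →ₗ[R] M), Function.Surjective f ∧
    Module.Projective R P ∧ Module.Projective R ↥(LinearMap.ker f)

/-- `M` has injective dimension at most one: it embeds in an injective module with
injective cokernel. -/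
def IdLeOne (M : ModuleCat.{u} R) : Prop :=
  ∃ (E : ModuleCat.{u} R) (f : M →ₗ[R] E), Function.Injective f ∧
    Module.Injective R E ∧ Module.Injective R (E ⧸ LinearMap.range f)

/-- One step of a path in `ind R`: a nonzero non-isomorphism between (finite-dimensional)
indecomposable modules. -/
def Step (M N : ModuleCat.{u} R) : Prop :=
  Indec R M ∧ FdMod R M ∧ Indec R N ∧ FdMod R N ∧
    ∃ f : M →ₗ[R] N, f ≠ 0 ∧ ¬ Function.Bijective f

/-- A path in `ind R` from `M` to `N` (possibly trivial): a chain
`M = M₀ → M₁ → ⋯ → Mₙ = N` of nonzero non-isomorphisms between indecomposables. -/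
def IndPath (M N : ModuleCat.{u} R) : Prop := Relation.ReflTransGen (Step R) M N

/-- The left part `L_R`: the indecomposable (finite-dimensional) modules `M` such that
every indecomposable `X` with a path `X ⇝ M` in `ind R` has projective dimension `≤ 1`. -/
def InLeftPart (M : ModuleCat.{u} R) : Prop :=
  Indec R M ∧ FdMod R M ∧
    ∀ X : ModuleCat.{u} R, Indec R X → FdMod R X → IndPath R X M → PdLeOne R X

/-- The right part `R_R`: the indecomposable (finite-dimensional) modules `M` such that
every indecomposable `X` with a path `M ⇝ X` in `ind R` has injective dimension `≤ 1`. -/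
def InRightPart (M : ModuleCat.{u} R) : Prop :=
  Indec R M ∧ FdMod R M ∧
    ∀ X : ModuleCat.{u} R, Indec R X → FdMod R X → IndPath R M X → IdLeOne R X

/-- Hereditary: global dimension at most one, i.e. every module has projective dimension
at most one. -/
def Hereditary : Prop := ∀ M : ModuleCat.{u} R, PdLeOne R M

/-- Quasitilted: every indecomposable projective module lies in the left part. -/
def Quasitilted : Prop :=
  ∀ P : ModuleCat.{u} R, Indec R P → FdMod R P → Module.Projective R P → InLeftPart R P

/-- A module is directed if it lies on no cycle of nonzero non-isomorphisms between
indecomposables in `ind R`. -/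
def Directed (M : ModuleCat.{u} R) : Prop := ¬ Relation.TransGen (Step R) M M

/-- Weakly shod: every indecomposable (finite-dimensional) module not lying in
`L_R ∪ R_R` is directed. -/
def WeaklyShod : Prop :=
  ∀ M : ModuleCat.{u} R, Indec R M → FdMod R M →
    ¬ InLeftPart R M → ¬ InRightPart R M → Directed R M

/-- Laura: all but finitely many isomorphism classes of indecomposable
(finite-dimensional) modules lie in `L_R ∪ R_R`. -/
def Laura : Prop :=
  ∃ S : Set (ModuleCat.{u} R), S.Finite ∧
    ∀ M : ModuleCat.{u} R, Indec R M → FdMod R M →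
      ¬ InLeftPart R M → ¬ InRightPart R M → ∃ N ∈ S, Nonempty (M ≃ₗ[R] N)

/-- There are exactly `n` isomorphism classes of modules satisfying `P`. -/
def NumClasses (P : ModuleCat.{u} R → Prop) (n : ℕ) : Prop :=
  ∃ f : Fin n → ModuleCat.{u} R, (∀ i, P (f i)) ∧
    (∀ i j, Nonempty ((f i : Type u) ≃ₗ[R] (f j : Type u)) → i = j) ∧
    ∀ M : ModuleCat.{u} R, P M → ∃ i, Nonempty ((M : Type u) ≃ₗ[R] (f i : Type u))

/-- `M` is (isomorphic to) a direct summand of `T`. -/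
def IsSummandOf (T : Type u) [AddCommGroup T] [Module R T] (M : ModuleCat.{u} R) : Prop :=
  ∃ N N' : Submodule R T, IsCompl N N' ∧ Nonempty ((M : Type u) ≃ₗ[R] N)

/-- `Ext¹_R(T, T) = 0`: every self-extension `0 → T → E → T → 0` splits. -/
def SelfExtVanish (T : Type u) [AddCommGroup T] [Module R T] : Prop :=
  ∀ (E : Type u) [AddCommGroup E] [Module R E] (ι : T →ₗ[R] E) (π : E →ₗ[R] T),
    Function.Injective ι → Function.Surjective π → LinearMap.range ι = LinearMap.ker π →
      ∃ s : T →ₗ[R] E, π.comp s = LinearMap.id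

/-- A tilting module over a hereditary algebra: a finite module with `Ext¹(T,T) = 0`
having as many pairwise non-isomorphic indecomposable direct summands as there are
simple modules. -/
def IsTiltingMod (T : Type u) [AddCommGroup T] [Module R T] : Prop :=
  Module.Finite R T ∧ SelfExtVanish R T ∧
    ∃ n : ℕ, NumClasses R (fun M => Indec R M ∧ IsSummandOf R T M) n ∧
      NumClasses R (fun M => IsSimpleModule R M) n

variable (k : Type u) [Field k]

/-- A `k`-algebra `A` is tilted if it is the endomorphism algebra of a tilting (right)
module over a hereditary finite-dimensional `k`-algebra `H`.  (Right `H`-modules are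
modules over `Hᵐᵒᵖ`; the isomorphism `A ≅ End_H T` is a `k`-linear ring isomorphism.) -/
def IsTilted (A : Type u) [Ring A] [Algebra k A] : Prop :=
  ∃ (H : Type u) (_ : Ring H) (_ : Algebra k H),
    FiniteDimensional k H ∧ Hereditary Hᵐᵒᵖ ∧
      ∃ (T : Type u) (_ : AddCommGroup T) (_ : Module Hᵐᵒᵖ T),
        IsTiltingMod Hᵐᵒᵖ T ∧
          ∃ (_ : Module k T) (_ : SMulCommClass Hᵐᵒᵖ k T) (_ : IsScalarTower k Hᵐᵒᵖ T)
            (φ : A ≃+* Module.End Hᵐᵒᵖ T), ∀ (c : k) (x : A), φ (c • x) = c • φ x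

end Toupie
namespace Toupie

variable {k : Type u} [Field k] (T : ToupieAlg k)

/-! ### Right `A`-modules as representations of `(Q, I)`

For a right `A`-module `M` (a module over `Aᵐᵒᵖ`) and a vertex `v`, the space of the
corresponding representation at `v` is `M_v = M • e_v`. -/

/-- The action of the idempotent `e_v ∈ A` on a right `A`-module (= `Aᵐᵒᵖ`-module). -/
def actV (v : Vtx T.t T.ℓ) : (Alg T)ᵐᵒᵖ := op (mkA T (eV v))

/-- The space `M_v = M • e_v` of the representation `M` at the vertex `v` is zero. -/
def VanishAt (M : ModuleCat.{u} (Alg T)ᵐᵒᵖ) (v : Vtx T.t T.ℓ) : Prop :=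
  ∀ m : M, actV T v • m = 0

/-- Every simple summand of `top M = M / rad M` is one of the simple modules `S_v`,
`v ∈ vs`: for every maximal submodule `N` the simple quotient `M/N` is supported at some
vertex of `vs` (for an admissible quotient of a path algebra, the simple module `S_v` is
the unique simple on which `e_v` acts nontrivially). -/
def TopIn (M : ModuleCat.{u} (Alg T)ᵐᵒᵖ) (vs : Set (Vtx T.t T.ℓ)) : Prop :=
  ∀ N : Submodule (Alg T)ᵐᵒᵖ M, IsCoatom N → ∃ v ∈ vs, ∃ m : M, actV T v • m ∉ N

/-- Every simple summand of the socle of `M` is one of the simple modules `S_v`,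
`v ∈ vs`: every simple submodule `N ≤ M` is supported at some vertex of `vs`. -/
def SocIn (M : ModuleCat.{u} (Alg T)ᵐᵒᵖ) (vs : Set (Vtx T.t T.ℓ)) : Prop :=
  ∀ N : Submodule (Alg T)ᵐᵒᵖ M, IsAtom N → ∃ v ∈ vs, ∃ m ∈ N, actV T v • m ≠ 0

/-- The module `D x y` (for two positions `0 ≤ x, y ≤ ℓ i₀` on the unique branch `i₀`
lying in `I`, and an auxiliary branch `i₂ ≠ i₀`): the right `A`-module with generators
`g = e₀` (at the source) and `h = e_y` (at the `y`-th vertex of branch `i₀`), subject to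
the relations `g ⬝ (subpath of w i₀ from 0 to x+1) = 0` and
`g ⬝ w i₂ = h ⬝ (subpath of w i₀ from y to ℓ i₀)`.  It is presented as the quotient of
the right regular module `A ⊕ A` by the right submodule generated by
`(1 - e₀, 0)`, `(0, 1 - e_y)`, `(subE i₀ 0 (min (x+1) (ℓ i₀)), 0)` and
`(w i₂, - subE i₀ y (ℓ i₀))`. -/
abbrev Dmod (i₀ i₂ : Fin T.t) (x y : ℕ) : Type u :=
  (Alg T × Alg T) ⧸ Submodule.span (Alg T)ᵐᵒᵖ
    ({((mkA T (1 - eV Vtx.src) : Alg T), (0 : Alg T)),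
      ((0 : Alg T), (mkA T (1 - eV (vtx T.t T.ℓ i₀ y)) : Alg T)),
      ((mkA T (subE i₀ 0 (min (x + 1) (T.ℓ i₀))) : Alg T), (0 : Alg T)),
      ((mkA T (wE i₂) : Alg T), (- mkA T (subE i₀ y (T.ℓ i₀)) : Alg T))} :
        Set (Alg T × Alg T))

end Toupie

namespace Toupie

section Paths

variable {k : Type u} [Field k] {t : ℕ} {ℓ : Fin t → ℕ}

lemma vtx_zero (i : Fin t) : vtx t ℓ i 0 = .src := by simp [vtx]

lemma vtx_mid (i : Fin t) (a : ℕ) (h : a < ℓ i - 1) : vtx t ℓ i (a + 1) = .mid i ⟨a, h⟩ := by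
  simp [vtx, h]

lemma vtx_top (i : Fin t) (b : ℕ) (h : 1 ≤ b) (hb : ℓ i ≤ b) : vtx t ℓ i b = .snk := by
  have h1 : b ≠ 0 := by omega
  have h2 : ¬ b - 1 < ℓ i - 1 := by omega
  simp [vtx, h1, h2]

/-- Two positions on branches give the same vertex only in the obvious cases. -/
lemma vtx_inj {i i' : Fin t} {a b : ℕ} (ha : a ≤ ℓ i) (hb : b ≤ ℓ i')
    (h : vtx t ℓ i a = vtx t ℓ i' b) :
    (a = 0 ∧ b = 0) ∨ (a = ℓ i ∧ b = ℓ i') ∨ (i = i' ∧ a = b) := by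
  unfold vtx at h
  split_ifs at h with h1 h2 h3 h4 h5 h6
  · exact Or.inl ⟨h1, h2⟩
  · injection h with h7 h8
    subst h7
    simp only [heq_eq_eq, Fin.mk.injEq] at h8
    exact Or.inr (Or.inr ⟨rfl, by omega⟩)
  · exact Or.inr (Or.inl ⟨by omega, by omega⟩)

/-- Every vertex lies on some branch. -/
lemma exists_eq_vtx (ht : 0 < t) (hℓ : ∀ i, 1 ≤ ℓ i) (v : Vtx t ℓ) :
    ∃ i a, a ≤ ℓ i ∧ v = vtx t ℓ i a := by
  rcases v with _ | _ | ⟨i, a⟩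
  · exact ⟨⟨0, ht⟩, 0, Nat.zero_le _, (vtx_zero _).symm⟩
  · exact ⟨⟨0, ht⟩, _, le_rfl, (vtx_top _ _ (hℓ _) le_rfl).symm⟩
  · exact ⟨i, a + 1, by omega, (vtx_mid i a a.2).symm⟩

instance : Finite (Vtx t ℓ) := by
  refine Finite.of_injective (β := Option (Option (Σ i, Fin (ℓ i - 1))))
    (fun v => match v with
      | .src => none
      | .snk => some none
      | .mid i a => some (some ⟨i, a⟩)) ?_
  rintro (_ | _ | ⟨i, a⟩) (_ | _ | ⟨i', a'⟩) h <;> simp_all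

instance : Fintype (Vtx t ℓ) := Fintype.ofFinite _

instance : Finite (PIdx t ℓ) := by
  refine Finite.of_injective
    (β := Vtx t ℓ ⊕ (Σ i, Fin (ℓ i + 1) × Fin (ℓ i + 1)))
    (fun p => match p with
      | .vert v => Sum.inl v
      | .sub i a b hab hb => Sum.inr ⟨i, ⟨a, by omega⟩, ⟨b, by omega⟩⟩) ?_
  rintro (v | ⟨i, a, b, hab, hb⟩) (v' | ⟨i', a', b', hab', hb'⟩) h
  · simp_all
  · simp at h
  · simp at h
  · simp only [Sum.inr.injEq, Sigma.mk.injEq] at h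
    obtain ⟨rfl, h⟩ := h
    simp_all

/-- The final vertex of a path. -/
def endIdx : PIdx t ℓ → Vtx t ℓ
  | .vert v => v
  | .sub i _ b _ _ => vtx t ℓ i b

/-- Prepend the `j`-th arrow of branch `i` to a path, if possible. -/
def pre (i : Fin t) (j : ℕ) : PIdx t ℓ → Option (PIdx t ℓ)
  | .vert v => if h : j < ℓ i ∧ v = vtx t ℓ i (j + 1) then
      some (.sub i j (j + 1) (Nat.lt_succ_self j) h.1) else none
  | .sub i' a b hab hb => if h : i' = i ∧ a = j + 1 then
      some (.sub i j b (by omega) (h.1 ▸ hb)) else none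

lemma strip_eq_some_iff (i : Fin t) (j : ℕ) (p q : PIdx t ℓ) :
    strip i j p = some q ↔ pre i j q = some p := by
  rcases p with v | ⟨i₁, a, b, hab, hb⟩
  · rcases q with w | ⟨i₂, c, d, hcd, hd⟩
    · simp [strip, pre]
    · simp [strip, pre]
  · rcases q with w | ⟨i₂, c, d, hcd, hd⟩
    · simp only [strip, pre]
      constructor
      · intro h
        split_ifs at h with h1 h2
        · simp at h
        obtain ⟨rfl, rfl⟩ := h1
        have hb' : b = a + 1 := by omega
        subst hb'
        simp only [Option.some.injEq, PIdx.vert.injEq] at h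
        rw [dif_pos ⟨by omega, h.symm⟩]
      · intro h
        split_ifs at h with h1
        simp only [Option.some.injEq, PIdx.sub.injEq] at h
        obtain ⟨rfl, rfl, rfl⟩ := h
        simp [h1.2]
    · simp only [strip, pre]
      constructor
      · intro h
        split_ifs at h with h1 h2
        · obtain ⟨rfl, rfl⟩ := h1
          simp only [Option.some.injEq, PIdx.sub.injEq] at h
          obtain ⟨rfl, rfl, rfl⟩ := h
          simp
        · simp at h
      · intro h
        split_ifs at h with h1
        obtain ⟨rfl, rfl⟩ := h1
        simp only [Option.some.injEq, PIdx.sub.injEq] at h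
        obtain ⟨rfl, rfl, rfl⟩ := h
        simp [hcd]

/-- Elements of an algebra satisfying the defining relations of the path algebra. -/
structure PathRel {B : Type*} [Ring B] [Algebra k B] (e : Vtx t ℓ → B)
    (α : Fin t → ℕ → B) : Prop where
  orth : ∀ v w, e v * e w = if v = w then e v else 0
  sum : ∑ v, e v = 1
  left : ∀ i j, e (vtx t ℓ i j) * α i j = α i j
  right : ∀ i j, α i j * e (vtx t ℓ i (j + 1)) = α i j
  out : ∀ i j, ℓ i ≤ j → α i j = 0

/-- The product along a path. -/
def pval {B : Type*} [Ring B] (e : Vtx t ℓ → B) (α : Fin t → ℕ → B) : PIdx t ℓ → B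
  | .vert v => e v
  | .sub i a b _ _ => ((List.range (b - a)).map fun s => α i (a + s)).prod

section

variable {B : Type*} [Ring B] [Algebra k B] {e : Vtx t ℓ → B} {α : Fin t → ℕ → B}

lemma list_prod_cons (α : Fin t → ℕ → B) (i : Fin t) (a b : ℕ) (h : a < b) :
    ((List.range (b - a)).map fun s => α i (a + s)).prod =
      α i a * ((List.range (b - (a + 1))).map fun s => α i (a + 1 + s)).prod := by
  obtain ⟨c, rfl⟩ : ∃ c, b = a + 1 + c := ⟨b - (a + 1), by omega⟩
  have h1 : a + 1 + c - a = c + 1 := by omega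
  have h2 : a + 1 + c - (a + 1) = c := by omega
  rw [h1, h2, List.range_succ_eq_map, List.map_cons, List.prod_cons, List.map_map]
  congr 2
  refine List.map_congr_left fun s _ => ?_
  simp only [Function.comp_apply, Nat.succ_eq_add_one]
  congr 1
  omega

lemma list_prod_snoc (α : Fin t → ℕ → B) (i : Fin t) (a b : ℕ) (h : a ≤ b) :
    ((List.range (b + 1 - a)).map fun s => α i (a + s)).prod =
      ((List.range (b - a)).map fun s => α i (a + s)).prod * α i b := by
  have h1 : b + 1 - a = (b - a) + 1 := by omega
  rw [h1, List.range_succ, List.map_append, List.prod_append]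
  have h2 : a + (b - a) = b := by omega
  simp [h2]

lemma PathRel.e_mul_pval (H : PathRel (k := k) e α) (v : Vtx t ℓ) (p : PIdx t ℓ) :
    e v * pval e α p = if startIdx p = v then pval e α p else 0 := by
  have key : e (startIdx p) * pval e α p = pval e α p := by
    rcases p with w | ⟨i, a, b, hab, hb⟩
    · exact (H.orth w w).trans (if_pos rfl)
    · simp only [pval, startIdx]
      rw [list_prod_cons _ _ _ _ hab, ← mul_assoc, H.left]
  rw [← key, ← mul_assoc, H.orth]
  by_cases h : v = startIdx p
  · subst h
    rw [if_pos rfl, if_pos rfl]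
  · rw [if_neg h, if_neg (Ne.symm h), zero_mul]

lemma PathRel.pval_mul_e (H : PathRel (k := k) e α) (v : Vtx t ℓ) (p : PIdx t ℓ) :
    pval e α p * e v = if endIdx p = v then pval e α p else 0 := by
  have key : pval e α p * e (endIdx p) = pval e α p := by
    rcases p with w | ⟨i, a, b, hab, hb⟩
    · exact (H.orth w w).trans (if_pos rfl)
    · simp only [pval, endIdx]
      obtain ⟨c, rfl⟩ : ∃ c, b = c + 1 := ⟨b - 1, by omega⟩
      rw [list_prod_snoc _ _ _ _ (by omega), mul_assoc, H.right]
  rw [← key, mul_assoc, H.orth]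
  by_cases h : endIdx p = v
  · rw [if_pos h, if_pos h]
  · rw [if_neg h, if_neg h, mul_zero]

lemma PathRel.arr_mul_pval (H : PathRel (k := k) e α) (i : Fin t) (j : ℕ) (q : PIdx t ℓ) :
    α i j * pval e α q = (pre i j q).elim 0 (pval e α) := by
  rcases lt_or_ge j (ℓ i) with hj | hj
  · have key : ∀ w, vtx t ℓ i (j + 1) ≠ startIdx q → startIdx q = w →
        α i j * pval e α q = 0 := by
      rintro w hw -
      have := H.e_mul_pval (startIdx q) q
      rw [if_pos rfl] at this
      rw [← this, ← H.right, mul_assoc, ← mul_assoc (e _), H.orth, if_neg hw]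
      simp
    rcases q with v | ⟨i', a, b, hab, hb⟩
    · simp only [pre]
      split_ifs with h
      · obtain ⟨_, rfl⟩ := h
        simp [pval, H.right]
      · exact key _ (fun h' => h ⟨hj, h'.symm⟩) rfl
    · simp only [pre]
      split_ifs with h
      · obtain ⟨rfl, rfl⟩ := h
        simp only [pval, Option.elim]
        rw [list_prod_cons _ _ j b (by omega)]
      · refine key _ (fun h' => h ?_) rfl
        simp only [startIdx] at h'
        rcases vtx_inj (by omega) (by omega) h' with h1 | h1 | h1
        · omega
        · omega
        · exact ⟨h1.1.symm, h1.2.symm⟩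
  · rw [H.out i j hj, zero_mul]
    rcases q with v | ⟨i', a, b, hab, hb⟩
    · simp [pre, not_lt.2 hj]
    · simp only [pre]
      rw [dif_neg]
      · rfl
      · rintro ⟨rfl, rfl⟩
        omega

end

lemma strip_out (i : Fin t) (j : ℕ) (h : ℓ i ≤ j) (p : PIdx t ℓ) : strip i j p = none := by
  rcases p with v | ⟨i₁, a, b, hab, hb⟩
  · rfl
  · simp only [strip]
    rw [dif_neg]
    rintro ⟨rfl, rfl⟩
    omega

lemma startIdx_of_strip {i : Fin t} {j : ℕ} {p q : PIdx t ℓ} (h : strip i j p = some q) :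
    startIdx p = vtx t ℓ i j ∧ startIdx q = vtx t ℓ i (j + 1) := by
  rcases p with v | ⟨i₁, a, b, hab, hb⟩
  · simp [strip] at h
  · simp only [strip] at h
    split_ifs at h with h1 h2
    · obtain ⟨rfl, rfl⟩ := h1
      simp only [Option.some.injEq] at h
      subst h
      exact ⟨rfl, rfl⟩
    · obtain ⟨rfl, rfl⟩ := h1
      simp only [Option.some.injEq] at h
      subst h
      have : b = a + 1 := by omega
      exact ⟨rfl, by simp [startIdx, this]⟩

variable (k t ℓ) in
lemma pathRel_gens : PathRel (k := k) (eV (k := k) (t := t) (ℓ := ℓ)) arE where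
  orth v w := by
    apply Subtype.ext
    refine LinearMap.ext fun f => funext fun p => ?_
    by_cases h : v = w
    · subst h
      simp only [eV, Ev, MulMemClass.mk_mul_mk, Module.End.mul_apply, LinearMap.coe_mk,
        AddHom.coe_mk, if_true]
      by_cases h1 : startIdx p = v
      · rw [if_pos h1]
      · rw [if_neg h1]
        exact (if_neg h1).symm
    · simp only [eV, Ev, MulMemClass.mk_mul_mk, Module.End.mul_apply, LinearMap.coe_mk,
        AddHom.coe_mk, if_neg h]
      by_cases h1 : startIdx p = v
      · rw [if_pos h1, if_neg (h1.trans_ne h)]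
        rfl
      · rw [if_neg h1]
        rfl
  sum := by
    apply Subtype.ext
    refine LinearMap.ext fun f => funext fun p => ?_
    simp [eV, Ev, LinearMap.sum_apply, Finset.sum_apply]
  left i j := by
    apply Subtype.ext
    refine LinearMap.ext fun f => funext fun p => ?_
    simp only [eV, arE, Ev, Ar, MulMemClass.mk_mul_mk, Module.End.mul_apply, LinearMap.coe_mk,
      AddHom.coe_mk]
    rcases h : strip i j p with _ | q
    · simp
    · simp [(startIdx_of_strip h).1]
  right i j := by
    apply Subtype.ext
    refine LinearMap.ext fun f => funext fun p => ?_
    simp only [eV, arE, Ev, Ar, MulMemClass.mk_mul_mk, Module.End.mul_apply, LinearMap.coe_mk,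
      AddHom.coe_mk]
    rcases h : strip i j p with _ | q
    · simp
    · simp [(startIdx_of_strip h).2]
  out i j h := by
    apply Subtype.ext
    refine LinearMap.ext fun f => funext fun p => ?_
    simp [arE, Ar, strip_out i j h]

/-- The element of the path algebra given by a path. -/
def path (p : PIdx t ℓ) : PathAlg k t ℓ := pval eV arE p

lemma path_vert (v : Vtx t ℓ) : (path (.vert v) : PathAlg k t ℓ) = eV v := rfl

/-- The cyclic vector of the left regular representation. -/
def cyc : PSp k t ℓ := fun p => match p with
  | .vert _ => 1
  | .sub _ _ _ _ _ => 0

/-- The coefficients of an element of the path algebra. -/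
def coefs : PathAlg k t ℓ →ₗ[k] PSp k t ℓ :=
  (LinearMap.applyₗ (cyc : PSp k t ℓ)).comp (PathAlg k t ℓ).val.toLinearMap

lemma coefs_e_mul (v : Vtx t ℓ) (x : PathAlg k t ℓ) (p : PIdx t ℓ) :
    coefs (eV v * x) p = if startIdx p = v then coefs x p else 0 := rfl

lemma coefs_arr_mul (i : Fin t) (j : ℕ) (x : PathAlg k t ℓ) (p : PIdx t ℓ) :
    coefs (arE i j * x) p = (strip i j p).elim 0 (coefs x) := rfl

lemma coefs_vert (v : Vtx t ℓ) : coefs (eV v : PathAlg k t ℓ) = Pi.single (.vert v) 1 := by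
  funext p
  have := coefs_e_mul (k := k) v 1 p
  rw [mul_one] at this
  rw [this]
  rcases p with w | ⟨i, a, b, hab, hb⟩
  · simp only [startIdx, coefs]
    simp [cyc, Pi.single_apply]
  · simp [coefs, cyc]

lemma coefs_arr_mul_single (i : Fin t) (j : ℕ) (x : PathAlg k t ℓ) (p q : PIdx t ℓ)
    (hq : coefs x = Pi.single q 1) (hp : pre i j q = some p) :
    coefs (arE i j * x) = Pi.single p 1 := by
  funext p'
  rw [coefs_arr_mul, hq, Pi.single_apply]
  rcases h : strip i j p' with _ | q'
  · have : p' ≠ p := by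
      rintro rfl
      rw [← strip_eq_some_iff, h] at hp
      cases hp
    simp [this]
  · rw [strip_eq_some_iff] at h
    have : p' = p ↔ q' = q := by
      constructor
      · rintro rfl
        rw [← strip_eq_some_iff] at h hp
        rw [h] at hp
        exact Option.some_injective _ hp
      · rintro rfl
        rw [h] at hp
        exact Option.some_injective _ hp
    simp [Pi.single_apply, this]

lemma coefs_path (p : PIdx t ℓ) : coefs (path p : PathAlg k t ℓ) = Pi.single p 1 := by
  rcases p with v | ⟨i, a, b, hab, hb⟩
  · exact coefs_vert v
  · obtain ⟨n, hn⟩ : ∃ n, b = a + 1 + n := ⟨b - (a + 1), by omega⟩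
    induction n generalizing a with
    | zero =>
      have hb' : b = a + 1 := by omega
      subst hb'
      have hp : pre i a (.vert (vtx t ℓ i (a + 1))) =
          some (.sub i a (a + 1) hab hb) := by
        exact dif_pos ⟨hb, rfl⟩
      have := (pathRel_gens k t ℓ).arr_mul_pval i a (.vert (vtx t ℓ i (a + 1)))
      rw [hp] at this
      have e : path (.sub i a (a + 1) hab hb) =
          arE (k := k) i a * path (.vert (vtx t ℓ i (a + 1))) := this.symm
      rw [e]
      exact coefs_arr_mul_single i a _ _ _ (coefs_vert _) hp
    | succ n ih =>
      have h1 := ih (a + 1) (by omega) (by omega)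
      have hp : pre i a (.sub i (a + 1) b (by omega) hb) =
          some (.sub i a b hab hb) := by
        simp [pre]
      have := (pathRel_gens k t ℓ).arr_mul_pval i a (.sub i (a + 1) b (by omega) hb)
      rw [hp] at this
      have e : path (.sub i a b hab hb) =
          arE (k := k) i a * path (.sub i (a + 1) b (by omega) hb) := this.symm
      rw [e]
      exact coefs_arr_mul_single i a _ _ _ h1 hp

lemma linearIndependent_path :
    LinearIndependent k (path : PIdx t ℓ → PathAlg k t ℓ) := by
  refine LinearIndependent.of_comp coefs ?_
  have : (coefs : PathAlg k t ℓ →ₗ[k] PSp k t ℓ) ∘ path = fun p => Pi.single p 1 :=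
    funext coefs_path
  rw [this]
  exact Pi.linearIndependent_single_one _ _

lemma span_path : Submodule.span k (Set.range (path : PIdx t ℓ → PathAlg k t ℓ)) = ⊤ := by
  have H := pathRel_gens k t ℓ
  set S := Submodule.span k (Set.range (path : PIdx t ℓ → PathAlg k t ℓ)) with hS
  have hmem : ∀ p, path p ∈ S := fun p => Submodule.subset_span ⟨p, rfl⟩
  have hgen : ∀ g : PathAlg k t ℓ, (∀ p, g * path p ∈ S) → ∀ y ∈ S, g * y ∈ S := by
    intro g hg y hy
    induction hy using Submodule.span_induction with
    | mem y hy => obtain ⟨p, rfl⟩ := hy; exact hg p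
    | zero => simp
    | add y z _ _ hy hz => rw [mul_add]; exact S.add_mem hy hz
    | smul c y _ hy => rw [mul_smul_comm]; exact S.smul_mem c hy
  have key : ∀ x (hx : x ∈ Algebra.adjoin k (gens k t ℓ)), ∀ y ∈ S,
      (⟨x, hx⟩ : PathAlg k t ℓ) * y ∈ S := by
    intro x hx
    induction hx using Algebra.adjoin_induction with
    | mem x hx =>
      apply hgen
      intro p
      rcases hx with ⟨v, rfl⟩ | ⟨i, j, rfl⟩
      · change eV v * pval eV arE p ∈ S
        rw [H.e_mul_pval]
        split_ifs
        · exact hmem p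
        · exact S.zero_mem
      · change arE i j * pval eV arE p ∈ S
        rw [H.arr_mul_pval]
        rcases pre i j p with _ | q
        · exact S.zero_mem
        · exact hmem q
    | algebraMap c =>
      intro y hy
      have : (⟨algebraMap k _ c, Subalgebra.algebraMap_mem _ c⟩ : PathAlg k t ℓ) * y = c • y := by
        rw [Algebra.smul_def]
        rfl
      rw [this]
      exact S.smul_mem c hy
    | add x y hx hy h1 h2 =>
      intro z hz
      have := S.add_mem (h1 z hz) (h2 z hz)
      rw [← add_mul] at this
      exact this
    | mul x y hx hy h1 h2 =>
      intro z hz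
      have := h1 _ (h2 z hz)
      rw [← mul_assoc] at this
      exact this
  rw [eq_top_iff]
  rintro x -
  have h1 : (1 : PathAlg k t ℓ) ∈ S := by
    rw [← H.sum]
    exact S.sum_mem fun v _ => hmem (.vert v)
  have := key x.1 x.2 1 h1
  rwa [mul_one] at this

variable (k t ℓ) in
/-- The basis of the path algebra given by the paths. -/
def pathBasis : Module.Basis (PIdx t ℓ) k (PathAlg k t ℓ) :=
  Module.Basis.mk linearIndependent_path span_path.ge

lemma pathBasis_apply (p : PIdx t ℓ) : pathBasis k t ℓ p = path p := by
  simp [pathBasis]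

instance : Module.Finite k (PathAlg k t ℓ) := Module.Finite.of_basis (pathBasis k t ℓ)

lemma coefs_injective : Function.Injective (coefs : PathAlg k t ℓ →ₗ[k] PSp k t ℓ) := by
  have h : (coefs : PathAlg k t ℓ →ₗ[k] PSp k t ℓ) =
      (Finsupp.lcoeFun).comp (pathBasis k t ℓ).repr.toLinearMap := by
    refine (pathBasis k t ℓ).ext fun p => ?_
    rw [pathBasis_apply, coefs_path, LinearMap.comp_apply, LinearEquiv.coe_coe,
      ← pathBasis_apply, Module.Basis.repr_self]
    funext q
    simp [Finsupp.single_apply, Pi.single_apply, eq_comm]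
  rw [h]
  exact DFunLike.coe_injective.comp (pathBasis k t ℓ).repr.injective

/-- The universal property of the path algebra. -/
lemma PathRel.exists_algHom {B : Type*} [Ring B] [Algebra k B] {e : Vtx t ℓ → B}
    {α : Fin t → ℕ → B} (H : PathRel (k := k) e α) :
    ∃ φ : PathAlg k t ℓ →ₐ[k] B, (∀ v, φ (eV v) = e v) ∧ ∀ i j, φ (arE i j) = α i j := by
  have G := pathRel_gens k t ℓ
  let Φ : PathAlg k t ℓ →ₗ[k] B := (pathBasis k t ℓ).constr k (pval e α)
  have hΦ : ∀ p, Φ (path p) = pval e α p := fun p => by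
    rw [← pathBasis_apply, Module.Basis.constr_basis]
  have hext : ∀ (g : PathAlg k t ℓ) (b : B), (∀ p, Φ (g * path p) = b * Φ (path p)) →
      ∀ y, Φ (g * y) = b * Φ y := by
    intro g b h y
    have : Φ.comp (LinearMap.mulLeft k g) = (LinearMap.mulLeft k b).comp Φ := by
      refine (pathBasis k t ℓ).ext fun p => ?_
      simpa [pathBasis_apply] using h p
    exact LinearMap.congr_fun this y
  have hone : Φ 1 = 1 := by
    rw [← G.sum, map_sum, ← H.sum]
    exact Finset.sum_congr rfl fun v _ => hΦ (.vert v)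
  have he : ∀ v y, Φ (eV v * y) = e v * Φ y := by
    intro v
    refine hext _ _ fun p => ?_
    rw [hΦ, H.e_mul_pval]
    change Φ (eV v * pval eV arE p) = _
    rw [G.e_mul_pval]
    split_ifs
    · exact hΦ p
    · simp
  have ha : ∀ i j y, Φ (arE i j * y) = α i j * Φ y := by
    intro i j
    refine hext _ _ fun p => ?_
    rw [hΦ, H.arr_mul_pval]
    change Φ (arE i j * pval eV arE p) = _
    rw [G.arr_mul_pval]
    rcases pre i j p with _ | q
    · simp
    · exact hΦ q
  have he' : ∀ v, Φ (eV v) = e v := fun v => by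
    have := he v 1
    rwa [mul_one, hone, mul_one] at this
  have ha' : ∀ i j, Φ (arE i j) = α i j := fun i j => by
    have := ha i j 1
    rwa [mul_one, hone, mul_one] at this
  have hmul : ∀ x (hx : x ∈ Algebra.adjoin k (gens k t ℓ)), ∀ y,
      Φ ((⟨x, hx⟩ : PathAlg k t ℓ) * y) = Φ ⟨x, hx⟩ * Φ y := by
    intro x hx
    induction hx using Algebra.adjoin_induction with
    | mem x hx =>
      intro y
      rcases hx with ⟨v, rfl⟩ | ⟨i, j, rfl⟩
      · exact (he v y).trans (by rw [← he' v]; rfl)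
      · exact (ha i j y).trans (by rw [← ha' i j]; rfl)
    | algebraMap c =>
      intro y
      have : (⟨algebraMap k _ c, Subalgebra.algebraMap_mem _ c⟩ : PathAlg k t ℓ) =
          c • (1 : PathAlg k t ℓ) := by
        rw [Algebra.smul_def, mul_one]
        rfl
      rw [this, smul_mul_assoc, one_mul, map_smul, map_smul, hone, smul_mul_assoc, one_mul]
    | add x y hx hy h1 h2 =>
      intro z
      have h3 : (⟨x + y, add_mem hx hy⟩ : PathAlg k t ℓ) = ⟨x, hx⟩ + ⟨y, hy⟩ := rfl
      rw [h3, add_mul, map_add, map_add, h1, h2, add_mul]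
    | mul x y hx hy h1 h2 =>
      intro z
      have h3 : (⟨x * y, mul_mem hx hy⟩ : PathAlg k t ℓ) = ⟨x, hx⟩ * ⟨y, hy⟩ := rfl
      rw [h3, mul_assoc, h1, h2, h1, mul_assoc]
  exact ⟨AlgHom.ofLinearMap Φ hone fun x y => hmul x.1 x.2 y, he', ha'⟩

end Paths

end Toupie

namespace Toupie

section PathCoefs

variable {k : Type u} [Field k] {t : ℕ} {ℓ : Fin t → ℕ}

lemma coefs_mul_e (v : Vtx t ℓ) (x : PathAlg k t ℓ) (p : PIdx t ℓ) :
    coefs (x * eV v) p = if endIdx p = v then coefs x p else 0 := by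
  have h : ((LinearMap.proj p).comp coefs).comp (LinearMap.mulRight k (eV v)) =
      (if endIdx p = v then (1 : k) else 0) • (LinearMap.proj p).comp
        (coefs : PathAlg k t ℓ →ₗ[k] PSp k t ℓ) := by
    refine (pathBasis k t ℓ).ext fun q => ?_
    have := (pathRel_gens k t ℓ).pval_mul_e v q
    change path q * eV v = ite _ (path q) 0 at this
    simp only [LinearMap.comp_apply, LinearMap.mulRight_apply, pathBasis_apply, this,
      LinearMap.smul_apply, LinearMap.proj_apply]
    by_cases h1 : endIdx q = v
    · rw [if_pos h1, coefs_path]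
      by_cases h2 : p = q
      · subst h2
        simp [h1]
      · simp [h2]
    · rw [if_neg h1, coefs_path]
      by_cases h2 : p = q
      · subst h2
        simp [h1]
      · simp [h2]
  refine (LinearMap.congr_fun h x).trans ?_
  by_cases h1 : endIdx p = v <;> simp [h1]

lemma eq_sum_coefs (x : PathAlg k t ℓ) :
    letI := Fintype.ofFinite (PIdx t ℓ)
    x = ∑ p, coefs x p • path p := by
  apply coefs_injective
  funext q
  simp [map_sum, coefs_path, Finset.sum_apply, Pi.single_apply]

/-- Apart from the branches, a path is determined by its end points. -/
lemma eq_of_endpoints {p q : PIdx t ℓ} (hp : ∀ i h, p ≠ .sub i 0 (ℓ i) h le_rfl)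
    (h1 : startIdx q = startIdx p) (h2 : endIdx q = endIdx p) : q = p := by
  have aux : ∀ (i : Fin t) (a b : ℕ) (hab : a < b) (hb : b ≤ ℓ i) (v : Vtx t ℓ),
      vtx t ℓ i a = v → vtx t ℓ i b = v → False := by
    intro i a b hab hb v h1 h2
    rcases vtx_inj (by omega) hb (h1.trans h2.symm) with h | h | h <;> omega
  rcases p with v | ⟨i, a, b, hab, hb⟩
  · rcases q with w | ⟨i', a', b', hab', hb'⟩
    · exact congrArg _ h1
    · exact (aux i' a' b' hab' hb' v h1 h2).elim
  · rcases q with w | ⟨i', a', b', hab', hb'⟩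
    · exact (aux i a b hab hb w h1.symm h2.symm).elim
    · rcases vtx_inj (by omega) (by omega) h1 with h3 | h3 | h3
      · obtain ⟨rfl, rfl⟩ := h3
        rcases vtx_inj (by omega) (by omega) h2 with h4 | h4 | h4
        · omega
        · obtain ⟨rfl, rfl⟩ := h4
          exact (hp i hab rfl).elim
        · obtain ⟨rfl, rfl⟩ := h4
          rfl
      · omega
      · obtain ⟨rfl, rfl⟩ := h3
        rcases vtx_inj (by omega) (by omega) h2 with h4 | h4 | h4
        · omega
        · obtain ⟨rfl, rfl⟩ := h4
          rfl
        · obtain ⟨_, rfl⟩ := h4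
          rfl

lemma e_mul_mul_e (x : PathAlg k t ℓ) {p : PIdx t ℓ}
    (hp : ∀ i h, p ≠ .sub i 0 (ℓ i) h le_rfl) :
    eV (startIdx p) * (x * eV (endIdx p)) = coefs x p • path p := by
  apply coefs_injective
  funext q
  rw [coefs_e_mul, coefs_mul_e, map_smul, coefs_path]
  by_cases h : q = p
  · subst h
    simp
  · by_cases h1 : startIdx q = startIdx p
    · by_cases h2 : endIdx q = endIdx p
      · exact (h (eq_of_endpoints hp h1 h2)).elim
      · simp [h2, h]
    · simp [h1, h]

lemma mul_e_src (x : PathAlg k t ℓ) :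
    x * eV .src = coefs x (.vert .src) • eV .src := by
  apply coefs_injective
  funext q
  rw [coefs_mul_e, map_smul, coefs_vert]
  rcases q with v | ⟨i, a, b, hab, hb⟩
  · by_cases h : v = .src
    · subst h
      simp [endIdx]
    · simp [endIdx, h]
  · have : vtx t ℓ i b ≠ .src := by
      unfold vtx
      split_ifs <;> first | omega | simp
    simp [endIdx, this]

lemma e_snk_mul (x : PathAlg k t ℓ) :
    eV .snk * x = coefs x (.vert .snk) • eV .snk := by
  apply coefs_injective
  funext q
  rw [coefs_e_mul, map_smul, coefs_vert]
  rcases q with v | ⟨i, a, b, hab, hb⟩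
  · by_cases h : v = .snk
    · subst h
      simp [startIdx]
    · simp [startIdx, h]
  · have : vtx t ℓ i a ≠ .snk := by
      unfold vtx
      split_ifs <;> first | omega | simp
    simp [startIdx, this]

lemma e_mul_sub (i : Fin t) (a b : ℕ) (hab : a < b) (hb : b ≤ ℓ i) :
    (eV (vtx t ℓ i a) * subE i a b : PathAlg k t ℓ) = subE i a b :=
  ((pathRel_gens k t ℓ).e_mul_pval _ (.sub i a b hab hb)).trans (if_pos rfl)

lemma sub_mul_e (i : Fin t) (a b : ℕ) (hab : a < b) (hb : b ≤ ℓ i) :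
    (subE i a b * eV (vtx t ℓ i b) : PathAlg k t ℓ) = subE i a b :=
  ((pathRel_gens k t ℓ).pval_mul_e _ (.sub i a b hab hb)).trans (if_pos rfl)

lemma subE_self (i : Fin t) (a : ℕ) : (subE i a a : PathAlg k t ℓ) = 1 := by
  simp [subE]

lemma subE_cons (i : Fin t) (a b : ℕ) (h : a < b) :
    (subE i a b : PathAlg k t ℓ) = arE i a * subE i (a + 1) b :=
  list_prod_cons (B := PathAlg k t ℓ) arE i a b h

lemma subE_snoc (i : Fin t) (a b : ℕ) (h : a ≤ b) :
    (subE i a (b + 1) : PathAlg k t ℓ) = subE i a b * arE i b :=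
  list_prod_snoc (B := PathAlg k t ℓ) arE i a b h

lemma subE_mul_subE (i : Fin t) (a b c : ℕ) (h : a ≤ b) (h' : b ≤ c) :
    (subE i a b * subE i b c : PathAlg k t ℓ) = subE i a c := by
  induction c, h' using Nat.le_induction with
  | base => rw [subE_self, mul_one]
  | succ c hc ih => rw [subE_snoc _ _ _ hc, ← mul_assoc, ih, subE_snoc _ _ _ (h.trans hc)]

lemma coefs_subE (i : Fin t) (a b : ℕ) (hab : a < b) (hb : b ≤ ℓ i) :
    coefs (subE i a b : PathAlg k t ℓ) = Pi.single (.sub i a b hab hb) 1 :=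
  coefs_path (.sub i a b hab hb)

/-- Elements of the path algebra ending at an interior vertex. -/
lemma exists_coefs_of_mul_e (i : Fin t) (j : ℕ) (h1 : 1 ≤ j) (h2 : j < ℓ i)
    (Q : PathAlg k t ℓ) (hQ : Q * eV (vtx t ℓ i j) = Q) :
    ∃ d : Fin (j + 1) → k, Q = (∑ a, d a • subE i a j) * eV (vtx t ℓ i j) := by
  set S := Submodule.span k (Set.range fun a : Fin (j + 1) =>
    (subE i a j * eV (vtx t ℓ i j) : PathAlg k t ℓ)) with hS
  have key : ∀ p : PIdx t ℓ, path p * eV (vtx t ℓ i j) ∈ S := by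
    intro p
    have := (pathRel_gens k t ℓ).pval_mul_e (vtx t ℓ i j) p
    change path p * eV (vtx t ℓ i j) = ite _ (path p) 0 at this
    by_cases h : endIdx p = vtx t ℓ i j
    · rcases p with v | ⟨i', a, b, hab, hb⟩
      · change v = _ at h
        subst h
        refine Submodule.subset_span ⟨⟨j, by omega⟩, ?_⟩
        simp only [subE_self, one_mul, path_vert]
        exact ((pathRel_gens k t ℓ).orth _ _).trans (if_pos rfl) |>.symm
      · rcases vtx_inj hb h2.le h with h3 | h3 | h3
        · omega
        · omega
        · obtain ⟨rfl, rfl⟩ := h3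
          exact Submodule.subset_span ⟨⟨a, by omega⟩, rfl⟩
    · rw [this, if_neg h]
      exact S.zero_mem
  have h3 : Q * eV (vtx t ℓ i j) ∈ S := by
    rw [eq_sum_coefs Q, Finset.sum_mul]
    refine S.sum_mem fun p _ => ?_
    rw [smul_mul_assoc]
    exact S.smul_mem _ (key p)
  rw [hQ, hS, Submodule.mem_span_range_iff_exists_fun] at h3
  obtain ⟨d, hd⟩ := h3
  refine ⟨d, ?_⟩
  rw [← hd, Finset.sum_mul]
  simp only [smul_mul_assoc]

end PathCoefs

section Ideal

variable {k : Type u} [Field k] (T : ToupieAlg k)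

lemma mkA_eq_zero {x : PathAlg k T.t T.ℓ} : mkA T x = 0 ↔ x ∈ T.I := by
  rw [TwoSidedIdeal.mem_iff, ← RingCon.eq, ← map_zero (mkA T)]
  rfl

lemma mkA_smul (c : k) (x : PathAlg k T.t T.ℓ) : mkA T (c • x) = c • mkA T x := by
  rw [Algebra.smul_def, Algebra.smul_def, map_mul]
  rfl

/-- The quotient map as an algebra homomorphism. -/
def mkAlg : PathAlg k T.t T.ℓ →ₐ[k] Alg T :=
  { mkA T with commutes' := fun _ => rfl }

instance : Module.Finite k (Alg T) :=
  Module.Finite.of_surjective (mkAlg T).toLinearMap (mkA_surjective T)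

/-- The space of linear relations between the branches. -/
def relSp : Submodule k (Fin T.t → k) :=
  LinearMap.ker (Fintype.linearCombination k fun i => mkA T (wE i))

lemma mem_relSp {c : Fin T.t → k} : c ∈ relSp T ↔ ∑ i, c i • mkA T (wE i) = 0 := by
  rw [relSp, LinearMap.mem_ker, Fintype.linearCombination_apply]

lemma mem_relSp' {c : Fin T.t → k} : c ∈ relSp T ↔ ∑ i, c i • wE i ∈ T.I := by
  rw [mem_relSp, ← mkA_eq_zero, map_sum]
  simp only [mkA_smul]

/-- The branch as a path. -/
def full (i : Fin T.t) : PIdx T.t T.ℓ := .sub i 0 (T.ℓ i) (T.hℓ i) le_rfl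

lemma full_injective : Function.Injective (full T) := by
  intro i j h
  simp only [full, PIdx.sub.injEq] at h
  exact h.1

lemma coefs_wE (i : Fin T.t) : coefs (wE i : PathAlg k T.t T.ℓ) = Pi.single (full T i) 1 :=
  coefs_path (full T i)

lemma coefs_full_sum (c : Fin T.t → k) (i : Fin T.t) :
    coefs (∑ i, c i • wE i : PathAlg k T.t T.ℓ) (full T i) = c i := by
  simp [map_sum, coefs_wE, Finset.sum_apply, Pi.single_apply, (full_injective T).eq_iff]

/-- No path lies in the ideal. -/
lemma path_notMem (hnb : ∀ i, ¬ branchInI T i) (p : PIdx T.t T.ℓ) : path p ∉ T.I := by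
  have key : ∀ i a b, a ≤ b → b ≤ T.ℓ i →
      (subE i a b * eV (vtx T.t T.ℓ i b) : PathAlg k T.t T.ℓ) ∉ T.I := by
    intro i a b hab hb hI
    apply hnb i
    rcases Nat.eq_or_lt_of_le hb with h | h
    · subst h
      have : (wE i : PathAlg k T.t T.ℓ) =
          subE i 0 a * (subE i a (T.ℓ i) * eV (vtx T.t T.ℓ i (T.ℓ i))) := by
        rw [← mul_assoc, subE_mul_subE _ _ _ _ (Nat.zero_le _) hab,
          sub_mul_e _ _ _ (T.hℓ i) le_rfl]
        rfl
      unfold branchInI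
      rw [this]
      exact T.I.mul_mem_left _ _ hI
    · have : (wE i : PathAlg k T.t T.ℓ) =
          subE i 0 a * (subE i a b * eV (vtx T.t T.ℓ i b)) * subE i b (T.ℓ i) := by
        rw [mul_assoc, mul_assoc, e_mul_sub _ _ _ h le_rfl,
          subE_mul_subE _ _ _ _ hab hb, subE_mul_subE _ _ _ _ (Nat.zero_le _) (by omega)]
        rfl
      unfold branchInI
      rw [this]
      exact T.I.mul_mem_right _ _ (T.I.mul_mem_left _ _ hI)
  rcases p with v | ⟨i, a, b, hab, hb⟩
  · obtain ⟨i, a, ha, rfl⟩ := exists_eq_vtx (by have := T.ht; omega) T.hℓ v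
    have := key i a a le_rfl ha
    rwa [subE_self, one_mul] at this
  · have := key i a b hab.le hb
    rwa [sub_mul_e _ _ _ hab hb] at this

lemma mkA_path_ne_zero (hnb : ∀ i, ¬ branchInI T i) (p : PIdx T.t T.ℓ) : mkA T (path p) ≠ 0 := by
  rw [Ne, mkA_eq_zero]
  exact path_notMem T hnb p

lemma coefs_eq_zero_of_mem (hnb : ∀ i, ¬ branchInI T i) {z : PathAlg k T.t T.ℓ} (hz : z ∈ T.I) {p : PIdx T.t T.ℓ}
    (hp : ∀ i, p ≠ full T i) : coefs z p = 0 := by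
  by_contra h
  apply path_notMem T hnb p
  have h1 : coefs z p • path p ∈ T.I := by
    rw [← e_mul_mul_e z fun i _ => hp i]
    exact T.I.mul_mem_left _ _ (T.I.mul_mem_right _ _ hz)
  have h2 : (path p : PathAlg k T.t T.ℓ) = algebraMap k _ (coefs z p)⁻¹ * (coefs z p • path p) := by
    rw [← Algebra.smul_def, smul_smul, inv_mul_cancel₀ h, one_smul]
  rw [h2]
  exact T.I.mul_mem_left _ _ h1

lemma eq_sum_of_mem (hnb : ∀ i, ¬ branchInI T i) {z : PathAlg k T.t T.ℓ} (hz : z ∈ T.I) :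
    z = ∑ i, coefs z (full T i) • wE i := by
  apply coefs_injective
  funext p
  by_cases hp : ∃ i, p = full T i
  · obtain ⟨i, rfl⟩ := hp
    exact (coefs_full_sum T (fun i => coefs z (full T i)) i).symm
  · push Not at hp
    rw [coefs_eq_zero_of_mem T hnb hz hp]
    simp [map_sum, coefs_wE, Finset.sum_apply, hp]

lemma coefs_mem_relSp (hnb : ∀ i, ¬ branchInI T i) {z : PathAlg k T.t T.ℓ} (hz : z ∈ T.I) :
    (fun i => coefs z (full T i)) ∈ relSp T := by
  rw [mem_relSp', ← eq_sum_of_mem T hnb hz]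
  exact hz

lemma single_notMem_relSp (hnb : ∀ i, ¬ branchInI T i) (i : Fin T.t) : Pi.single i 1 ∉ relSp T := by
  rw [mem_relSp']
  have h : ∑ j, (Pi.single i 1 : Fin T.t → k) j • (wE j : PathAlg k T.t T.ℓ) = wE i := by
    simp [Pi.single_apply]
  rw [h]
  exact hnb i

lemma relSp_ne_bot (hnb : ∀ i, ¬ branchInI T i) (hI : T.I ≠ ⊥) : relSp T ≠ ⊥ := by
  intro h
  apply hI
  rw [eq_bot_iff]
  intro z hz
  have h1 := coefs_mem_relSp T hnb hz
  rw [h, Submodule.mem_bot] at h1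
  rw [TwoSidedIdeal.mem_bot, eq_sum_of_mem T hnb hz]
  exact Finset.sum_eq_zero fun i _ => by rw [congrFun h1 i]; simp

lemma two_le_of_mem_relSp {c : Fin T.t → k} (hc : c ∈ relSp T) {i : Fin T.t} (hi : c i ≠ 0) :
    2 ≤ T.ℓ i := by
  by_contra h
  have h1 : T.ℓ i = 1 := by have := T.hℓ i; omega
  apply hi
  have h2 := T.adm _ ((mem_relSp' T).1 hc)
  have h3 : ∀ x ∈ Submodule.span k
      {y : PathAlg k T.t T.ℓ | ∃ i a b, a + 2 ≤ b ∧ b ≤ T.ℓ i ∧ y = subE i a b},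
      coefs x (full T i) = 0 := by
    intro x hx
    induction hx using Submodule.span_induction with
    | mem y hy =>
      obtain ⟨i', a, b, hab, hb, rfl⟩ := hy
      rw [coefs_subE _ _ _ (by omega) hb, Pi.single_apply, if_neg]
      intro h4
      simp only [full, PIdx.sub.injEq] at h4
      omega
    | zero => simp
    | add y z _ _ hy hz => rw [map_add, Pi.add_apply, hy, hz, add_zero]
    | smul c y _ hy => rw [map_smul, Pi.smul_apply, hy, smul_zero]
  rw [← coefs_full_sum T c i]
  exact h3 _ h2

lemma exists_smul_e0 (a : Alg T) : ∃ c : k, a * e0 T = c • e0 T := by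
  obtain ⟨x, rfl⟩ := mkA_surjective T a
  exact ⟨_, by rw [e0, ← map_mul, mul_e_src, mkA_smul]⟩

lemma exists_smul_einf (a : Alg T) : ∃ c : k, einf T * a = c • einf T := by
  obtain ⟨x, rfl⟩ := mkA_surjective T a
  exact ⟨_, by rw [einf, ← map_mul, e_snk_mul, mkA_smul]⟩

/-- A vector of minimal support, in the form in which it is used: every vector of `K` with
smaller support is proportional to it. -/
def IsCircuit {ι : Type*} (K : Submodule k (ι → k)) (r : ι → k) : Prop :=
  r ∈ K ∧ r ≠ 0 ∧ ∀ x ∈ K, (∀ i, r i = 0 → x i = 0) → ∃ c : k, x = c • r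

lemma eq_zero_of_mul_sub_left (hnb : ∀ i, ¬ branchInI T i) (i : Fin T.t) (hi : 2 ≤ T.ℓ i) (a : Alg T)
    (h0 : a * e0 T = a) (h : a * mkA T (subE i 0 (T.ℓ i - 1)) = 0) : a = 0 := by
  obtain ⟨c, hc⟩ := exists_smul_e0 T a
  rw [h0] at hc
  have h1 : e0 T * mkA T (subE i 0 (T.ℓ i - 1)) = mkA T (subE i 0 (T.ℓ i - 1)) := by
    rw [e0, ← map_mul, ← vtx_zero i, e_mul_sub _ _ _ (by omega) (by omega)]
  rw [hc, smul_mul_assoc, h1, smul_eq_zero] at h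
  rcases h with h | h
  · rw [hc, h, zero_smul]
  · exact (mkA_path_ne_zero T hnb (.sub i 0 (T.ℓ i - 1) (by omega) (by omega)) h).elim

lemma einf_mul_eq_zero (hnb : ∀ i, ¬ branchInI T i) (i : Fin T.t) (hi : 2 ≤ T.ℓ i) (a : Alg T)
    (h : mkA T (subE i 1 (T.ℓ i)) * a = 0) : einf T * a = 0 := by
  obtain ⟨c, hc⟩ := exists_smul_einf T a
  have h1 : mkA T (subE i 1 (T.ℓ i)) * einf T = mkA T (subE i 1 (T.ℓ i)) := by
    rw [einf, ← map_mul, ← vtx_top i (T.ℓ i) (by omega) le_rfl,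
      sub_mul_e _ _ _ (by omega) (by omega)]
  rw [← h1, mul_assoc, hc, mul_smul_comm, h1, smul_eq_zero] at h
  rcases h with h | h
  · rw [hc, h, zero_smul]
  · exact (mkA_path_ne_zero T hnb (.sub i 1 (T.ℓ i) (by omega) le_rfl) h).elim

/-- Solutions of `∑ r i • q i * α i = 0`, where the `α i` are the last arrows. -/
lemma exists_smul_of_sum_mul_arr (hnb : ∀ i, ¬ branchInI T i) {r : Fin T.t → k} (hr : IsCircuit (relSp T) r)
    (q : Fin T.t → Alg T)
    (hq : ∀ i, q i * mkA T (eV (vtx T.t T.ℓ i (T.ℓ i - 1))) = q i)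
    (hs : ∑ i, r i • (q i * mkA T (arE i (T.ℓ i - 1))) = 0) :
    ∃ c : k, ∀ i, r i ≠ 0 → q i = c • mkA T (subE i 0 (T.ℓ i - 1)) := by
  have hidem : ∀ v, (eV v * eV v : PathAlg k T.t T.ℓ) = eV v := fun v =>
    ((pathRel_gens k T.t T.ℓ).orth v v).trans (if_pos rfl)
  have h1 : ∀ i, ∃ Q : PathAlg k T.t T.ℓ, mkA T Q = q i ∧
      Q * eV (vtx T.t T.ℓ i (T.ℓ i - 1)) = Q := by
    intro i
    obtain ⟨Q, hQ⟩ := mkA_surjective T (q i)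
    exact ⟨Q * eV (vtx T.t T.ℓ i (T.ℓ i - 1)), by rw [map_mul, hQ, hq],
      by rw [mul_assoc, hidem]⟩
  choose Q hQ1 hQ2 using h1
  have hl : ∀ i, r i ≠ 0 → 2 ≤ T.ℓ i := fun i hi => two_le_of_mem_relSp T hr.1 hi
  have h2 : ∀ i, ∃ d : Fin (T.ℓ i - 1 + 1) → k, r i ≠ 0 → Q i =
      (∑ a, d a • subE i a (T.ℓ i - 1)) * eV (vtx T.t T.ℓ i (T.ℓ i - 1)) := by
    intro i
    by_cases hi : r i = 0
    · exact ⟨0, fun h => (h hi).elim⟩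
    · have := hl i hi
      obtain ⟨d, hd⟩ := exists_coefs_of_mul_e i (T.ℓ i - 1) (by omega) (by omega) (Q i) (hQ2 i)
      exact ⟨d, fun _ => hd⟩
  choose d hd using h2
  have hprod : ∀ i, r i ≠ 0 → Q i * arE i (T.ℓ i - 1) = ∑ a, d i a • subE i a (T.ℓ i) := by
    intro i hi
    have h3 := hl i hi
    rw [hd i hi, mul_assoc, (pathRel_gens k T.t T.ℓ).left, Finset.sum_mul]
    refine Finset.sum_congr rfl fun a _ => ?_
    rw [smul_mul_assoc, ← subE_snoc _ _ _ (by omega)]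
    exact congrArg (fun n => d i a • subE i (a : ℕ) n) (by omega)
  set Z : PathAlg k T.t T.ℓ := ∑ i, r i • (Q i * arE i (T.ℓ i - 1)) with hZ
  have hZI : Z ∈ T.I := by
    rw [← mkA_eq_zero, hZ, map_sum, ← hs]
    exact Finset.sum_congr rfl fun i _ => by rw [mkA_smul, map_mul, hQ1]
  have hcoef : ∀ (i : Fin T.t) (a : Fin (T.ℓ i - 1 + 1)) (h : (a : ℕ) < T.ℓ i),
      coefs Z (.sub i a (T.ℓ i) h le_rfl) = r i * d i a := by
    intro i a h
    rw [hZ, map_sum, Finset.sum_apply, Finset.sum_eq_single i]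
    · by_cases hi : r i = 0
      · simp [hi]
      · rw [hprod i hi, map_smul, Pi.smul_apply, map_sum, Finset.sum_apply, smul_eq_mul,
          Finset.sum_eq_single a]
        · rw [map_smul, coefs_subE _ _ _ h le_rfl]
          simp
        · intro b _ hb
          have := T.hℓ i
          rw [map_smul, coefs_subE _ _ _ (by omega) le_rfl, Pi.smul_apply, Pi.single_apply,
            if_neg, smul_zero]
          intro h4
          simp only [PIdx.sub.injEq] at h4
          exact hb (Fin.ext h4.2.1.symm)
        · simp
    · intro i' _ hi'
      by_cases hi : r i' = 0
      · simp [hi]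
      · rw [hprod i' hi, map_smul, Pi.smul_apply, map_sum, Finset.sum_apply,
          Finset.sum_eq_zero, smul_zero]
        intro b _
        have := T.hℓ i'
        rw [map_smul, coefs_subE _ _ _ (by omega) le_rfl, Pi.smul_apply, Pi.single_apply,
          if_neg, smul_zero]
        intro h4
        simp only [PIdx.sub.injEq] at h4
        exact hi' h4.1.symm
    · simp
  obtain ⟨c, hc⟩ := hr.2.2 _ (coefs_mem_relSp T hnb hZI) (by
    intro i hi
    have := hcoef i 0 (T.hℓ i)
    rw [hi, zero_mul] at this
    exact this)
  refine ⟨c, fun i hi => ?_⟩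
  have h3 := hl i hi
  have hd0 : d i 0 = c := by
    have h4 := hcoef i 0 (T.hℓ i)
    have h5 := congrFun hc i
    change coefs Z (.sub i 0 (T.ℓ i) (T.hℓ i) le_rfl) = c * r i at h5
    have h6 := h4.symm.trans h5
    rw [mul_comm c] at h6
    exact mul_left_cancel₀ hi h6
  have hda : ∀ a, a ≠ 0 → d i a = 0 := by
    intro a ha
    have h4 := hcoef i a (by omega)
    rw [coefs_eq_zero_of_mem T hnb hZI] at h4
    · exact (mul_eq_zero.1 h4.symm).resolve_left hi
    · intro i' h5
      simp only [full, PIdx.sub.injEq] at h5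
      exact ha (Fin.ext h5.2.1)
  rw [← hQ1, hd i hi, Finset.sum_eq_single 0]
  · rw [hd0, smul_mul_assoc, mkA_smul]
    congr 2
    exact sub_mul_e i 0 (T.ℓ i - 1) (by omega) (by omega)
  · intro a _ ha
    rw [hda a ha, zero_smul]
  · simp

/-- Solutions of `∑ β i * a i = 0`, where the `β i` are the first arrows. -/
lemma exists_smul_of_sum_arr_mul (hnb : ∀ i, ¬ branchInI T i) (i : Fin T.t) (hi : 2 ≤ T.ℓ i) (a : Fin T.t → Alg T)
    (hs : ∑ i, mkA T (arE i 0) * a i = 0) :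
    ∃ c : k, mkA T (eV (vtx T.t T.ℓ i 1)) * a i = c • mkA T (subE i 1 (T.ℓ i)) := by
  choose Q hQ using fun i => mkA_surjective T (a i)
  set Z : PathAlg k T.t T.ℓ := ∑ i, arE i 0 * Q i with hZ
  have hZI : Z ∈ T.I := by
    rw [← mkA_eq_zero, hZ, map_sum, ← hs]
    exact Finset.sum_congr rfl fun i _ => by rw [map_mul, hQ]
  have hcoef : ∀ (b : ℕ) (h : 0 < b) (hb : b < T.ℓ i),
      ((strip i 0 (.sub i 0 b h hb.le)).elim 0 (coefs (Q i)) : k) = 0 := by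
    intro b h hb
    refine Eq.trans ?_ (coefs_eq_zero_of_mem T hnb hZI (p := .sub i 0 b h hb.le) ?_)
    · rw [hZ, map_sum, Finset.sum_apply, Finset.sum_eq_single i]
      · rw [coefs_arr_mul]
      · intro i' _ hi'
        rw [coefs_arr_mul]
        simp [strip, Ne.symm hi']
      · simp
    · intro i' h5
      simp only [full, PIdx.sub.injEq] at h5
      obtain ⟨rfl, -, h5⟩ := h5
      omega
  refine ⟨coefs (Q i) (.sub i 1 (T.ℓ i) (by omega) le_rfl), ?_⟩
  rw [← hQ, ← map_mul, ← mkA_smul]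
  congr 1
  apply coefs_injective
  funext p
  rw [coefs_e_mul, map_smul, coefs_subE _ _ _ (by omega : 1 < T.ℓ i) le_rfl]
  by_cases hp : startIdx p = vtx T.t T.ℓ i 1
  · rw [if_pos hp]
    rcases p with v | ⟨i', a', b, hab, hb⟩
    · change v = _ at hp
      subst hp
      have := hcoef 1 one_pos (by omega)
      simp only [strip] at this
      simpa using this
    · rcases vtx_inj (by omega) (by omega) hp with h3 | h3 | h3
      · omega
      · omega
      · obtain ⟨rfl, rfl⟩ := h3
        rcases Nat.eq_or_lt_of_le hb with h | h
        · subst h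
          simp
        · have := hcoef b (by omega) h
          simp only [strip] at this
          have hne : b ≠ T.ℓ i' := h.ne
          simpa [hab, hne] using this
  · rw [if_neg hp, Pi.smul_apply, Pi.single_apply, if_neg, smul_zero]
    rintro rfl
    exact hp rfl

end Ideal

end Toupie

namespace Toupie

section Circuits

variable {k : Type u} [Field k] {ι : Type*} (K : Submodule k (ι → k))

lemma IsCircuit.of_smul {K : Submodule k (ι → k)} {u y : ι → k} (hu : IsCircuit K u) (hy : y ∈ K)
    (h : ∀ a, u a = 0 → y a = 0) {f : ι} (hyf : y f = 0) (huf : u f ≠ 0) : y = 0 := by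
  obtain ⟨c, rfl⟩ := hu.2.2 y hy h
  have : c = 0 := (mul_eq_zero.1 hyf).resolve_right huf
  rw [this, zero_smul]

variable [Fintype ι]

/-- The support of a vector. -/
def supp (x : ι → k) : Finset ι := Finset.univ.filter fun i => x i ≠ 0

/-- Every vector contains circuits in its support. -/
lemma exists_circuit (n : ℕ) : ∀ x ∈ K, (supp x).card ≤ n → ∀ e, x e ≠ 0 →
    ∃ y, IsCircuit K y ∧ y e ≠ 0 ∧ ∀ a, x a = 0 → y a = 0 := by
  induction n with
  | zero =>
    intro x _ hn e he
    have : e ∈ supp x := by simp [supp, he]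
    have := Finset.card_pos.2 ⟨e, this⟩
    omega
  | succ n ih =>
    intro x hx hn e he
    by_cases hc : IsCircuit K x
    · exact ⟨x, hc, he, fun _ h => h⟩
    · have hx0 : x ≠ 0 := fun h => he (by rw [h]; rfl)
      have : ∃ z ∈ K, (∀ i, x i = 0 → z i = 0) ∧ ∀ c : k, z ≠ c • x := by
        by_contra! h
        exact hc ⟨hx, hx0, h⟩
      obtain ⟨z, hz, hzx, hzc⟩ := this
      set w := z - (z e / x e) • x with hw
      have hw0 : w ≠ 0 := fun h => hzc _ (sub_eq_zero.1 h)
      have hwe : w e = 0 := by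
        simp [hw, he]
      have hwK : w ∈ K := K.sub_mem hz (K.smul_mem _ hx)
      have hwx : ∀ i, x i = 0 → w i = 0 := fun i hi => by simp [hw, hi, hzx i hi]
      obtain ⟨a, ha⟩ : ∃ a, w a ≠ 0 := by
        by_contra! h
        exact hw0 (funext h)
      have hxa : x a ≠ 0 := fun h => ha (hwx a h)
      set x' := x - (x a / w a) • w with hx'
      have hxx' : ∀ i, x i = 0 → x' i = 0 := fun i hi => by simp [hx', hi, hwx i hi]
      have hlt : (supp x').card < (supp x).card := by
        apply Finset.card_lt_card
        refine Finset.ssubset_iff_of_subset ?_ |>.2 ⟨a, by simp [supp, hxa], ?_⟩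
        · intro i hi
          simp only [supp, Finset.mem_filter, Finset.mem_univ, true_and] at hi ⊢
          exact fun h => hi (hxx' i h)
        · simp [supp, hx', ha]
      obtain ⟨y, hy, hye, hyx⟩ := ih x' (K.sub_mem hx (K.smul_mem _ hwK)) (by omega) e
        (by simpa [hx', hwe] using he)
      exact ⟨y, hy, hye, fun a h => hyx a (hxx' a h)⟩

/-- Two circuits which meet can be joined. -/
lemma exists_circuit_of_meet (n : ℕ) : ∀ u v, IsCircuit K u → IsCircuit K v →
    (supp u ∪ supp v).card ≤ n → (∃ f, u f ≠ 0 ∧ v f ≠ 0) → ∀ e g, u e ≠ 0 → v g ≠ 0 →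
    ∃ y, IsCircuit K y ∧ y e ≠ 0 ∧ y g ≠ 0 := by
  induction n with
  | zero =>
    intro u v _ _ hn _ e g he _
    have : e ∈ supp u ∪ supp v := by simp [supp, he]
    have := Finset.card_pos.2 ⟨e, this⟩
    omega
  | succ n ih =>
    rintro u v hu hv hn ⟨f, huf, hvf⟩ e g he hg
    by_cases hug : u g = 0
    swap
    · exact ⟨u, hu, he, hug⟩
    by_cases hve : v e = 0
    swap
    · exact ⟨v, hv, hve, hg⟩
    set x := u - (u f / v f) • v with hx
    have hxK : x ∈ K := K.sub_mem hu.1 (K.smul_mem _ hv.1)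
    have hxf : x f = 0 := by simp [hx, hvf]
    have hxe : x e ≠ 0 := by simpa [hx, hve] using he
    have hxg : x g ≠ 0 := by simp [hx, hug, hg, huf, hvf]
    have hxuv : ∀ a, u a = 0 → v a = 0 → x a = 0 := fun a h1 h2 => by simp [hx, h1, h2]
    obtain ⟨y, hy, hye, hyx⟩ := exists_circuit K _ x hxK le_rfl e hxe
    obtain ⟨z, hz, hzg, hzx⟩ := exists_circuit K _ x hxK le_rfl g hxg
    by_cases hyg : y g = 0
    swap
    · exact ⟨y, hy, hye, hyg⟩
    have hcard : ∀ (p q : ι → k) (b : ι), (∀ a, u a = 0 → v a = 0 → p a = 0 ∧ q a = 0) →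
        (u b ≠ 0 ∨ v b ≠ 0) → p b = 0 → q b = 0 → (supp p ∪ supp q).card ≤ n := by
      intro p q b h1 h2 h3 h4
      have : (supp p ∪ supp q).card < (supp u ∪ supp v).card := by
        apply Finset.card_lt_card
        refine Finset.ssubset_iff_of_subset ?_ |>.2 ⟨b, by simpa [supp] using h2, ?_⟩
        · intro i hi
          simp only [supp, Finset.mem_filter, Finset.mem_univ, true_and, Finset.mem_union] at hi ⊢
          by_contra! h
          have := h1 i h.1 h.2
          simp [this.1, this.2] at hi
        · simp [supp, h3, h4]
      omega
    have hmeet1 : ∃ b, y b ≠ 0 ∧ v b ≠ 0 := by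
      by_contra! h
      refine hy.2.1 (hu.of_smul hy.1 (fun a ha => ?_) (hyx f hxf) huf)
      by_contra h1
      exact h1 (hyx a (hxuv a ha (h a h1)))
    by_cases hb : ∃ b, u b ≠ 0 ∧ y b = 0 ∧ v b = 0
    · obtain ⟨b, h1, h2, h3⟩ := hb
      exact ih y v hy hv (hcard y v b (fun a h4 h5 => ⟨hyx a (hxuv a h4 h5), h5⟩)
        (Or.inl h1) h2 h3) hmeet1 e g hye hg
    · push Not at hb
      have hmeet2 : ∃ b, u b ≠ 0 ∧ v b = 0 ∧ z b ≠ 0 := by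
        by_contra! h
        refine hz.2.1 (hv.of_smul hz.1 (fun a ha => ?_) (hzx f hxf) hvf)
        by_cases h1 : u a = 0
        · exact hzx a (hxuv a h1 ha)
        · exact h a h1 ha
      obtain ⟨b, h1, h2, h3⟩ := hmeet2
      have h4 : y b ≠ 0 := fun h => hb b h1 h h2
      exact ih y z hy hz (hcard y z f
        (fun a h4 h5 => ⟨hyx a (hxuv a h4 h5), hzx a (hxuv a h4 h5)⟩) (Or.inl huf)
        (hyx f hxf) (hzx f hxf)) ⟨b, h4, h3⟩ e g hye hzg

/-- Restriction of a vector to a set of coordinates. -/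
def restr (S : Set ι) (x : ι → k) : ι → k := fun a => if a ∈ S then x a else 0

/-- If each circuit lies inside `S` or is disjoint from `S`, then `S` is a separator. -/
lemma restr_mem (S : Set ι)
    (hS : ∀ y, IsCircuit K y → ∀ a b, y a ≠ 0 → y b ≠ 0 → a ∈ S → b ∈ S) (n : ℕ) :
    ∀ x ∈ K, (supp x).card ≤ n → restr S x ∈ K := by
  have hcirc : ∀ y, IsCircuit K y → restr S y ∈ K := by
    intro y hy
    by_cases h : ∃ a, y a ≠ 0 ∧ a ∈ S
    · obtain ⟨a, h1, h2⟩ := h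
      convert hy.1 using 1
      funext b
      by_cases hb : y b = 0
      · simp [restr, hb]
      · simp [restr, hS y hy a b h1 hb h2]
    · push Not at h
      convert K.zero_mem using 1
      funext b
      by_cases hb : y b = 0
      · simp [restr, hb]
      · simp [restr, h b hb]
  induction n with
  | zero =>
    intro x hx hn
    have h0 : x = 0 := by
      funext a
      by_contra h
      have : a ∈ supp x := by simpa [supp] using h
      have := Finset.card_pos.2 ⟨a, this⟩
      omega
    subst h0
    convert K.zero_mem using 1
    funext b
    simp [restr]
  | succ n ih =>
    intro x hx hn
    by_cases h0 : x = 0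
    · subst h0
      convert K.zero_mem using 1
      funext b
      simp [restr]
    obtain ⟨e, he⟩ : ∃ e, x e ≠ 0 := by
      by_contra! h
      exact h0 (funext h)
    obtain ⟨y, hy, hye, hyx⟩ := exists_circuit K _ x hx le_rfl e he
    have h1 := ih (x - (x e / y e) • y) (K.sub_mem hx (K.smul_mem _ hy.1)) (by
      have : (supp (x - (x e / y e) • y)).card < (supp x).card := by
        apply Finset.card_lt_card
        refine Finset.ssubset_iff_of_subset ?_ |>.2 ⟨e, by simp [supp, he], ?_⟩
        · intro i hi
          simp only [supp, Finset.mem_filter, Finset.mem_univ, true_and] at hi ⊢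
          exact fun h => hi (by simp [h, hyx i h])
        · simp [supp, hye]
      omega)
    convert K.add_mem h1 (K.smul_mem (x e / y e) (hcirc y hy)) using 1
    funext b
    by_cases hb : b ∈ S <;> simp [restr, hb]

/-- The separation lemma. -/
lemma exists_separation [DecidableEq ι] (hs : ∀ i, Pi.single i 1 ∉ K) (hK : K ≠ ⊥) (i j : ι) (hij : i ≠ j)
    (hsep : ∀ r, IsCircuit K r → r i ≠ 0 → r j = 0) :
    ∃ r c₁ c₂ : ι → k, IsCircuit K r ∧ c₁ ≠ 0 ∧ c₂ ≠ 0 ∧ (∀ x ∈ K, ∑ a, x a * c₁ a = 0) ∧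
      (∀ x ∈ K, ∑ a, x a * c₂ a = 0) ∧ (∀ a, c₁ a = 0 ∨ c₂ a = 0) ∧
      ∀ a, r a ≠ 0 → c₂ a = 0 := by
  set S : Set ι := {a | a = i ∨ ∃ r, IsCircuit K r ∧ r i ≠ 0 ∧ r a ≠ 0} with hS
  have hiS : i ∈ S := Or.inl rfl
  have hjS : j ∉ S := by
    rintro (h | ⟨r, h1, h2, h3⟩)
    · exact hij h.symm
    · exact h3 (hsep r h1 h2)
  have hcl : ∀ y, IsCircuit K y → ∀ a b, y a ≠ 0 → y b ≠ 0 → a ∈ S → b ∈ S := by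
    rintro y hy a b ha hb (rfl | ⟨r, h1, h2, h3⟩)
    · exact Or.inr ⟨y, hy, ha, hb⟩
    · exact Or.inr (exists_circuit_of_meet K _ r y h1 hy le_rfl ⟨a, h3, ha⟩ i b h2 hb)
  have hcl' : ∀ y, IsCircuit K y → ∀ a b, y a ≠ 0 → y b ≠ 0 → a ∈ Sᶜ → b ∈ Sᶜ :=
    fun y hy a b ha hb h h' => h (hcl y hy b a hb ha h')
  have hdual : ∀ i, ∃ c : ι → k, c i ≠ 0 ∧ ∀ x ∈ K, ∑ a, x a * c a = 0 := by
    intro i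
    obtain ⟨f, hf, hfK⟩ := Submodule.exists_le_ker_of_notMem (hs i)
    refine ⟨fun a => f (Pi.single a 1), hf, fun x hx => ?_⟩
    have := hfK hx
    rw [LinearMap.mem_ker, LinearMap.pi_apply_eq_sum_univ] at this
    rw [← this]
    refine Finset.sum_congr rfl fun a _ => ?_
    rw [smul_eq_mul]
    congr 1
    change f _ = f _
    congr 1
    funext b
    simp [Pi.single_apply, eq_comm]
  have hrestr : ∀ (R : Set ι), (∀ x ∈ K, restr R x ∈ K) → ∀ c : ι → k,
      (∀ x ∈ K, ∑ a, x a * c a = 0) → ∀ x ∈ K, ∑ a, x a * restr R c a = 0 := by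
    intro R hR c hc x hx
    rw [← hc _ (hR x hx)]
    refine Finset.sum_congr rfl fun a _ => ?_
    by_cases h : a ∈ R <;> simp [restr, h]
  have main : ∀ (R : Set ι) (i j : ι), i ∈ R → j ∉ R → (∀ x ∈ K, restr R x ∈ K) →
      (∀ x ∈ K, restr Rᶜ x ∈ K) → (∃ x ∈ K, restr R x ≠ 0) →
      ∃ r c₁ c₂ : ι → k, IsCircuit K r ∧ c₁ ≠ 0 ∧ c₂ ≠ 0 ∧ (∀ x ∈ K, ∑ a, x a * c₁ a = 0) ∧
      (∀ x ∈ K, ∑ a, x a * c₂ a = 0) ∧ (∀ a, c₁ a = 0 ∨ c₂ a = 0) ∧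
      ∀ a, r a ≠ 0 → c₂ a = 0 := by
    rintro R i j hi hj hR hR' ⟨x, hx, hx0⟩
    obtain ⟨e, he⟩ : ∃ e, restr R x e ≠ 0 := by
      by_contra! h
      exact hx0 (funext h)
    obtain ⟨r, hr, -, hrx⟩ := exists_circuit K _ _ (hR x hx) le_rfl e he
    obtain ⟨c, hc1, hc2⟩ := hdual i
    obtain ⟨d, hd1, hd2⟩ := hdual j
    refine ⟨r, restr R c, restr Rᶜ d, hr, fun h => hc1 ?_, fun h => hd1 ?_,
      hrestr R hR c hc2, hrestr Rᶜ hR' d hd2, fun a => ?_, fun a ha => ?_⟩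
    · have := congrFun h i
      simpa [restr, hi] using this
    · have := congrFun h j
      simpa [restr, hj] using this
    · by_cases h : a ∈ R <;> simp [restr, h]
    · by_cases h : a ∈ R
      · simp [restr, h]
      · exact (ha (hrx a (by simp [restr, h]))).elim
  have hR := fun x hx => restr_mem K S hcl _ x hx le_rfl
  have hR' := fun x hx => restr_mem K Sᶜ hcl' _ x hx le_rfl
  obtain ⟨x, hx, hx0⟩ := Submodule.exists_mem_ne_zero_of_ne_bot hK
  by_cases h : restr S x = 0
  · refine main Sᶜ j i hjS (fun h => h hiS) hR' (by rwa [compl_compl]) ⟨x, hx, fun h' => hx0 ?_⟩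
    funext a
    have h1 := congrFun h a
    have h2 := congrFun h' a
    by_cases ha : a ∈ S
    · simpa [restr, ha] using h1
    · simpa [restr, ha] using h2
  · exact main S i j hiS hjS hR hR' ⟨x, hx, h⟩

end Circuits

section

variable {k : Type u} [Field k] (T : ToupieAlg k)

lemma minRel_of_isCircuit (hnb : ∀ i, ¬ branchInI T i) {r : Fin T.t → k}
    (hr : IsCircuit (relSp T) r) : MinRel T (supp r) r := by
  have hsum : ∀ J : Finset (Fin T.t),
      ∑ i ∈ J, r i • (wE i : PathAlg k T.t T.ℓ) = ∑ i, restr (J : Set (Fin T.t)) r i • wE i := by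
    intro J
    simp [restr, ite_smul, Finset.sum_ite_mem]
  have hself : restr (supp r : Set (Fin T.t)) r = r := by
    funext a
    by_cases h : r a = 0 <;> simp [restr, supp, h]
  refine ⟨?_, fun i hi => by simpa [supp] using hi, ?_, fun J hJ hne hmem => ?_⟩
  · by_contra h
    have h0 : supp r ≠ ∅ := by
      intro h0
      refine hr.2.1 (funext fun a => ?_)
      by_contra ha
      have : a ∈ supp r := by simpa [supp] using ha
      simp [h0] at this
    have h1 : (supp r).card = 1 := by
      have := Finset.card_pos.2 (Finset.nonempty_iff_ne_empty.2 h0)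
      omega
    obtain ⟨i, hi⟩ := Finset.card_eq_one.1 h1
    have hri : r i ≠ 0 := by
      have : i ∈ supp r := by simp [hi]
      simpa [supp] using this
    apply single_notMem_relSp T hnb i
    convert (relSp T).smul_mem (r i)⁻¹ hr.1 using 1
    funext a
    by_cases ha : a = i
    · subst ha
      simp [hri]
    · have : a ∉ supp r := by simp [hi, ha]
      have : r a = 0 := by simpa [supp] using this
      simp [ha, this]
  · rw [hsum, hself]
    exact (mem_relSp' T).1 hr.1
  · rw [hsum] at hmem
    obtain ⟨c, hc⟩ := hr.2.2 _ ((mem_relSp' T).2 hmem) fun i hi => by simp [restr, hi]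
    obtain ⟨a, ha⟩ := hne
    obtain ⟨b, hb, hbJ⟩ := Finset.exists_of_ssubset hJ
    have hra : r a ≠ 0 := by simpa [supp] using hJ.1 ha
    have hrb : r b ≠ 0 := by simpa [supp] using hb
    have h1 := congrFun hc a
    have h2 := congrFun hc b
    simp only [restr, Finset.mem_coe, ha, if_true, hbJ, if_false, Pi.smul_apply,
      smul_eq_mul] at h1 h2
    have hc0 : c = 0 := (mul_eq_zero.1 h2.symm).resolve_right hrb
    rw [hc0, zero_mul] at h1
    exact hra h1

lemma exists_functionals (hI : T.I ≠ ⊥) (hnsc : ¬ SimplyConnected T)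
    (hnb : ∀ i, ¬ branchInI T i) :
    ∃ r c₁ c₂ : Fin T.t → k, IsCircuit (relSp T) r ∧ c₁ ≠ 0 ∧ c₂ ≠ 0 ∧
      (∀ x ∈ relSp T, ∑ a, x a * c₁ a = 0) ∧ (∀ x ∈ relSp T, ∑ a, x a * c₂ a = 0) ∧
      (∀ a, c₁ a = 0 ∨ c₂ a = 0) ∧ ∀ a, r a ≠ 0 → c₂ a = 0 := by
  unfold SimplyConnected at hnsc
  push Not at hnsc
  obtain ⟨i, j, hij, h⟩ := hnsc
  refine exists_separation (relSp T) (single_notMem_relSp T hnb) (relSp_ne_bot T hnb hI) i j hij ?_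
  intro r hr hi
  by_contra hj
  exact h _ r (minRel_of_isCircuit T hnb hr) (by simpa [supp] using hi) (by simpa [supp] using hj)

end

end Toupie

namespace Toupie

section Modules

variable {k : Type u} [Field k] (T : ToupieAlg k)

lemma exists_algHom_alg {B : Type*} [Ring B] [Algebra k B] (φ : PathAlg k T.t T.ℓ →ₐ[k] B)
    (h : ∀ z ∈ T.I, φ z = 0) : ∃ ψ : Alg T →ₐ[k] B, ∀ z, ψ (mkA T z) = φ z := by
  have hc : T.I.ringCon ≤ RingCon.ker φ.toRingHom := by
    intro x y hxy
    rw [RingCon.ker_apply]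
    have : x - y ∈ T.I := by rwa [← TwoSidedIdeal.rel_iff]
    exact sub_eq_zero.1 ((map_sub φ.toRingHom x y).symm.trans (h _ this))
  let ψ : Alg T →+* B := T.I.ringCon.lift φ.toRingHom hc
  have hψ : ∀ z, ψ (mkA T z) = φ z := fun z => rfl
  exact ⟨{ ψ with commutes' := fun c => (hψ _).trans (φ.commutes c) }, hψ⟩

/-- Induction over the algebra along its generators. -/
lemma alg_induction {p : Alg T → Prop} (he : ∀ v, p (mkA T (eV v)))
    (ha : ∀ i j, j < T.ℓ i → p (mkA T (arE i j))) (hs : ∀ c : k, p (c • 1))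
    (hadd : ∀ x y, p x → p y → p (x + y)) (hmul : ∀ x y, p x → p y → p (x * y))
    (a : Alg T) : p a := by
  obtain ⟨⟨x, hx⟩, rfl⟩ := mkA_surjective T a
  have h0 : p 0 := by simpa using hs 0
  induction hx using Algebra.adjoin_induction with
  | mem x hx =>
    rcases hx with ⟨v, rfl⟩ | ⟨i, j, rfl⟩
    · exact he v
    · rcases lt_or_ge j (T.ℓ i) with h | h
      · exact ha i j h
      · have h1 : (arE i j : PathAlg k T.t T.ℓ) = 0 := (pathRel_gens k T.t T.ℓ).out i j h
        change p (mkA T (arE i j))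
        rwa [h1, map_zero]
  | algebraMap c =>
    have := hs c
    rw [← map_one (mkA T), ← mkA_smul, Algebra.smul_def, mul_one] at this
    exact this
  | add x y hx hy h1 h2 =>
    have h3 := hadd _ _ h1 h2
    rw [← map_add] at h3
    exact h3
  | mul x y hx hy h1 h2 =>
    have h3 := hmul _ _ h1 h2
    rw [← map_mul] at h3
    exact h3

/-- Commuting with the action of the generators suffices for linearity. -/
lemma map_smul_of_gens {M N : Type*} [AddCommGroup M] [AddCommGroup N] [Module k M] [Module k N]
    [Module (Alg T)ᵐᵒᵖ M] [Module (Alg T)ᵐᵒᵖ N] [IsScalarTower k (Alg T)ᵐᵒᵖ M]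
    [IsScalarTower k (Alg T)ᵐᵒᵖ N] (f : M →ₗ[k] N)
    (he : ∀ v m, f (op (mkA T (eV v)) • m) = op (mkA T (eV v)) • f m)
    (ha : ∀ i j, j < T.ℓ i → ∀ m, f (op (mkA T (arE i j)) • m) = op (mkA T (arE i j)) • f m)
    (r : (Alg T)ᵐᵒᵖ) (m : M) : f (r • m) = r • f m := by
  have H : ∀ a : Alg T, ∀ m, f (op a • m) = op a • f m := by
    refine alg_induction T (p := fun a => ∀ m, f (op a • m) = op a • f m) he ha ?_ ?_ ?_
    · intro c m
      rw [op_smul, op_one, smul_assoc, smul_assoc, one_smul, one_smul, map_smul]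
    · intro x y hx hy m
      rw [op_add, add_smul, add_smul, map_add, hx, hy]
    · intro x y hx hy m
      rw [op_mul, mul_smul, mul_smul, hy, hx]
  exact H r.unop m

/-- The linear map associated with a map commuting with the action of the generators. -/
def homOfGens {M N : Type*} [AddCommGroup M] [AddCommGroup N] [Module k M] [Module k N]
    [Module (Alg T)ᵐᵒᵖ M] [Module (Alg T)ᵐᵒᵖ N] [IsScalarTower k (Alg T)ᵐᵒᵖ M]
    [IsScalarTower k (Alg T)ᵐᵒᵖ N] (f : M →ₗ[k] N)
    (he : ∀ v m, f (op (mkA T (eV v)) • m) = op (mkA T (eV v)) • f m)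
    (ha : ∀ i j, j < T.ℓ i → ∀ m, f (op (mkA T (arE i j)) • m) = op (mkA T (arE i j)) • f m) :
    M →ₗ[(Alg T)ᵐᵒᵖ] N :=
  { f with map_smul' := map_smul_of_gens T f he ha }

/-- A vector space stable under the generators is a submodule. -/
def subOfGens {M : Type*} [AddCommGroup M] [Module k M]
    [Module (Alg T)ᵐᵒᵖ M] [IsScalarTower k (Alg T)ᵐᵒᵖ M] (S : Submodule k M)
    (he : ∀ v, ∀ m ∈ S, op (mkA T (eV v)) • m ∈ S)
    (ha : ∀ i j, j < T.ℓ i → ∀ m ∈ S, op (mkA T (arE i j)) • m ∈ S) :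
    Submodule (Alg T)ᵐᵒᵖ M :=
  { S with
    smul_mem' := by
      have H : ∀ a : Alg T, ∀ m ∈ S, op a • m ∈ S := by
        refine alg_induction T (p := fun a => ∀ m ∈ S, op a • m ∈ S) he ha ?_ ?_ ?_
        · intro c m hm
          rw [op_smul, op_one, smul_assoc, one_smul]
          exact S.smul_mem c hm
        · intro x y hx hy m hm
          rw [op_add, add_smul]
          exact S.add_mem (hx m hm) (hy m hm)
        · intro x y hx hy m hm
          rw [op_mul, mul_smul]
          exact hy _ (hx m hm)
      exact fun r m hm => H r.unop m hm }

variable {T} in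
/-- The right module given by a homomorphism from `A` to the opposite of an endomorphism ring. -/
def RepMod {V : Type*} [AddCommGroup V] [Module k V]
    (_ : Alg T →ₐ[k] (Module.End k V)ᵐᵒᵖ) : Type _ := V

variable {T} {V : Type*} [AddCommGroup V] [Module k V] (ψ : Alg T →ₐ[k] (Module.End k V)ᵐᵒᵖ)

instance : AddCommGroup (RepMod ψ) := inferInstanceAs (AddCommGroup V)

instance : Module k (RepMod ψ) := inferInstanceAs (Module k V)

instance : Module (Alg T)ᵐᵒᵖ (RepMod ψ) where
  smul r v := (ψ r.unop).unop (v : V)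
  one_smul v := by
    change (ψ (unop 1)).unop (v : V) = v
    rw [unop_one, map_one]
    rfl
  mul_smul r s v := by
    change (ψ (unop (r * s))).unop (v : V) = (ψ r.unop).unop ((ψ s.unop).unop (v : V))
    rw [unop_mul, map_mul]
    rfl
  smul_zero r := (ψ r.unop).unop.map_zero
  smul_add r v w := (ψ r.unop).unop.map_add v w
  add_smul r s v := by
    change (ψ (unop (r + s))).unop (v : V) = (ψ r.unop).unop (v : V) + (ψ s.unop).unop (v : V)
    rw [unop_add, map_add]
    rfl
  zero_smul v := by
    change (ψ (unop 0)).unop (v : V) = (0 : V)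
    rw [unop_zero, map_zero]
    rfl

lemma RepMod.smul_def (r : (Alg T)ᵐᵒᵖ) (v : RepMod ψ) : r • v = (ψ r.unop).unop (v : V) := rfl

instance : IsScalarTower k (Alg T)ᵐᵒᵖ (RepMod ψ) where
  smul_assoc c r v := by
    change (ψ (unop (c • r))).unop (v : V) = c • (ψ r.unop).unop (v : V)
    rw [unop_smul, map_smul]
    rfl

end Modules

end Toupie

namespace Toupie

section Representations

variable {k : Type u} [Field k] {T : ToupieAlg k}

/-- Data from which the representations below are constructed: a circuit of the space of
relations and two disjointly supported functionals vanishing on relations, the second of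
which is also disjoint from the circuit. -/
structure Dat (T : ToupieAlg k) where
  hnb : ∀ i, ¬ branchInI T i
  r : Fin T.t → k
  c₁ : Fin T.t → k
  c₂ : Fin T.t → k
  hr : IsCircuit (relSp T) r
  hc₁ : c₁ ≠ 0
  hc₂ : c₂ ≠ 0
  rel₁ : ∀ x ∈ relSp T, ∑ a, x a * c₁ a = 0
  rel₂ : ∀ x ∈ relSp T, ∑ a, x a * c₂ a = 0
  disj : ∀ a, c₁ a = 0 ∨ c₂ a = 0
  r_c₂ : ∀ a, r a ≠ 0 → c₂ a = 0

variable (D : Dat T) {W : Type u} [AddCommGroup W] [Module k W] (B : Module.End k W)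

namespace Dat

lemma two_le {i : Fin T.t} (hi : D.r i ≠ 0) : 2 ≤ T.ℓ i := two_le_of_mem_relSp T D.hr.1 hi

/-- The action of the first arrow of a branch. -/
def p (i : Fin T.t) : Module.End k W := D.c₂ i • 1 + D.c₁ i • B

lemma p_apply (i : Fin T.t) (w : W) : D.p B i w = D.c₂ i • w + D.c₁ i • B w := rfl

lemma sum_p {c : Fin T.t → k} (hc : c ∈ relSp T) (w : W) : ∑ i, c i • D.p B i w = 0 := by
  simp only [p_apply, smul_add, smul_smul, Finset.sum_add_distrib, ← Finset.sum_smul]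
  rw [D.rel₁ c hc, D.rel₂ c hc, zero_smul, zero_smul, add_zero]

/-- The action of the arrows of a branch. -/
def a (i : Fin T.t) (j : ℕ) : Module.End k W := if j = 0 then D.p B i else 1

/-- The idempotents on the representation space. -/
def eOp (W : Type u) [AddCommGroup W] [Module k W] (v : Vtx T.t T.ℓ) :
    Module.End k (Vtx T.t T.ℓ → W) :=
  (LinearMap.single k (fun _ => W) v).comp (LinearMap.proj v)

lemma eOp_apply (v : Vtx T.t T.ℓ) (f : Vtx T.t T.ℓ → W) :
    eOp (k := k) W v f = Pi.single v (f v) := rfl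

/-- The arrows on the representation space. -/
def aOp (i : Fin T.t) (j : ℕ) : Module.End k (Vtx T.t T.ℓ → W) :=
  if j < T.ℓ i then (LinearMap.single k (fun _ => W) (vtx T.t T.ℓ i (j + 1))).comp
    ((D.a B i j).comp (LinearMap.proj (vtx T.t T.ℓ i j))) else 0

lemma aOp_apply {i : Fin T.t} {j : ℕ} (h : j < T.ℓ i) (f : Vtx T.t T.ℓ → W) :
    D.aOp B i j f = Pi.single (vtx T.t T.ℓ i (j + 1)) (D.a B i j (f (vtx T.t T.ℓ i j))) := by
  rw [aOp, if_pos h]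
  rfl

lemma pathRel : PathRel (k := k) (fun v => op (eOp (T := T) W v))
    (fun i j => op (D.aOp B i j)) where
  orth v w := by
    rw [← op_mul]
    split_ifs with h
    · subst h
      congr 1
      refine LinearMap.ext fun f => ?_
      rw [Module.End.mul_apply, eOp_apply, eOp_apply, Pi.single_eq_same]
    · rw [op_eq_zero_iff]
      refine LinearMap.ext fun f => ?_
      rw [Module.End.mul_apply, eOp_apply, eOp_apply, Pi.single_eq_of_ne (Ne.symm h)]
      simp
  sum := by
    rw [← op_one, ← Finset.op_sum]
    congr 1
    refine LinearMap.ext fun f => ?_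
    rw [LinearMap.sum_apply]
    exact LinearMap.sum_single_apply (fun _ => W) f
  left i j := by
    rw [← op_mul]
    congr 1
    refine LinearMap.ext fun f => ?_
    by_cases h : j < T.ℓ i
    · rw [Module.End.mul_apply, aOp_apply _ _ h, eOp_apply, aOp_apply _ _ h, Pi.single_eq_same]
    · rw [aOp, if_neg h, zero_mul]
  right i j := by
    rw [← op_mul]
    congr 1
    refine LinearMap.ext fun f => ?_
    by_cases h : j < T.ℓ i
    · rw [Module.End.mul_apply, aOp_apply _ _ h, eOp_apply, Pi.single_eq_same]
    · rw [aOp, if_neg h, mul_zero]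
  out i j h := by
    rw [aOp, if_neg (by omega), op_zero]

lemma exists_rep : ∃ ψ : Alg T →ₐ[k] (Module.End k (Vtx T.t T.ℓ → W))ᵐᵒᵖ,
    (∀ v, ψ (mkA T (eV v)) = op (eOp W v)) ∧ ∀ i j, ψ (mkA T (arE i j)) = op (D.aOp B i j) := by
  obtain ⟨φ, h1, h2⟩ := (D.pathRel B).exists_algHom
  have h3 : ∀ i b (_ : 1 ≤ b) (_ : b ≤ T.ℓ i) f, (φ (subE i 0 b)).unop f =
      Pi.single (vtx T.t T.ℓ i b) (D.p B i (f .src)) := by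
    intro i b hb
    induction b, hb using Nat.le_induction with
    | base =>
      intro hb f
      rw [subE_snoc _ _ _ le_rfl, subE_self, one_mul, h2, unop_op, aOp_apply _ _ hb, vtx_zero, a,
        if_pos rfl]
    | succ b hb ih =>
      intro hb' f
      rw [subE_snoc _ _ _ (Nat.zero_le _), map_mul, unop_mul, Module.End.mul_apply,
        ih (by omega), h2, unop_op, aOp_apply _ _ hb', Pi.single_eq_same, a, if_neg (by omega)]
      rfl
  obtain ⟨ψ, hψ⟩ := exists_algHom_alg T φ (by
    intro z hz
    rw [eq_sum_of_mem T D.hnb hz, map_sum]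
    apply unop_injective
    refine LinearMap.ext fun f => ?_
    rw [Finset.unop_sum, LinearMap.sum_apply, unop_zero, LinearMap.zero_apply]
    have : ∀ i ∈ Finset.univ, (φ (coefs z (full T i) • wE i)).unop f =
        LinearMap.single k (fun _ => W) Vtx.snk (coefs z (full T i) • D.p B i (f .src)) := by
      intro i _
      rw [map_smul, unop_smul, LinearMap.smul_apply, map_smul, wE, h3 _ _ (T.hℓ i) le_rfl,
        vtx_top _ _ (T.hℓ i) le_rfl]
      rfl
    rw [Finset.sum_congr rfl this, ← map_sum, D.sum_p B (coefs_mem_relSp T D.hnb hz), map_zero])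
  exact ⟨ψ, fun v => by rw [hψ, h1], fun i j => by rw [hψ, h2]⟩

/-- The homomorphism defining the representation. -/
def rep : Alg T →ₐ[k] (Module.End k (Vtx T.t T.ℓ → W))ᵐᵒᵖ := (D.exists_rep B).choose

/-- The elements of the representation as families of vectors. -/
def val (f : RepMod (D.rep B)) : Vtx T.t T.ℓ → W := f

lemma e_smul (v : Vtx T.t T.ℓ) (f : RepMod (D.rep B)) :
    D.val B (op (mkA T (eV v)) • f) = Pi.single v (D.val B f v) := by
  rw [RepMod.smul_def, unop_op, rep, (D.exists_rep B).choose_spec.1]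
  rfl

lemma ar_smul {i : Fin T.t} {j : ℕ} (h : j < T.ℓ i) (f : RepMod (D.rep B)) :
    D.val B (op (mkA T (arE i j)) • f) =
      Pi.single (vtx T.t T.ℓ i (j + 1)) (D.a B i j (D.val B f (vtx T.t T.ℓ i j))) := by
  rw [RepMod.smul_def, unop_op, rep, (D.exists_rep B).choose_spec.2, unop_op]
  exact D.aOp_apply B h _

/-- A family of subspaces stable under the arrows. -/
def Stable (S : Vtx T.t T.ℓ → Submodule k W) : Prop :=
  ∀ i j, j < T.ℓ i → ∀ w ∈ S (vtx T.t T.ℓ i j), D.a B i j w ∈ S (vtx T.t T.ℓ i (j + 1))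

variable {B} {S : Vtx T.t T.ℓ → Submodule k W}

/-- The subrepresentation given by a stable family of subspaces. -/
def subRep (hS : D.Stable B S) : Submodule (Alg T)ᵐᵒᵖ (RepMod (D.rep B)) :=
  subOfGens T (M := RepMod (D.rep B)) (Submodule.pi Set.univ S : Submodule k (Vtx T.t T.ℓ → W))
    (by
      intro v f hf w _
      have := congrFun (D.e_smul B v f) w
      refine (congrArg (· ∈ S w) this).mpr ?_
      by_cases h : w = v
      · subst h
        rw [Pi.single_eq_same]
        exact hf w trivial
      · rw [Pi.single_eq_of_ne h]
        exact (S w).zero_mem)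
    (by
      intro i j hj f hf w _
      have := congrFun (D.ar_smul B hj f) w
      refine (congrArg (· ∈ S w) this).mpr ?_
      by_cases h : w = vtx T.t T.ℓ i (j + 1)
      · subst h
        rw [Pi.single_eq_same]
        exact hS i j hj _ (hf _ trivial)
      · rw [Pi.single_eq_of_ne h]
        exact (S w).zero_mem)

/-- The components of an element. -/
def comp {hS : D.Stable B S} (m : D.subRep hS) (v : Vtx T.t T.ℓ) : W := D.val B m.1 v

variable {hS : D.Stable B S}

lemma comp_mem (m : D.subRep hS) (v : Vtx T.t T.ℓ) : D.comp m v ∈ S v := m.2 v trivial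

variable {D}

lemma comp_ext {m n : D.subRep hS} (h : ∀ v, D.comp m v = D.comp n v) : m = n :=
  Subtype.ext (funext h)

lemma comp_add (m n : D.subRep hS) (v : Vtx T.t T.ℓ) :
    D.comp (m + n) v = D.comp m v + D.comp n v := rfl

lemma comp_smul (c : k) (m : D.subRep hS) (v : Vtx T.t T.ℓ) :
    D.comp (c • m) v = c • D.comp m v := rfl

lemma comp_zero (v : Vtx T.t T.ℓ) : D.comp (0 : D.subRep hS) v = 0 := rfl

lemma comp_e_smul (v w : Vtx T.t T.ℓ) (m : D.subRep hS) :
    D.comp (op (mkA T (eV v)) • m) w = if w = v then D.comp m v else 0 := by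
  have := congrFun (D.e_smul B v m.1) w
  rw [Pi.single_apply] at this
  exact this

lemma comp_ar_smul {i : Fin T.t} {j : ℕ} (h : j < T.ℓ i) (w : Vtx T.t T.ℓ) (m : D.subRep hS) :
    D.comp (op (mkA T (arE i j)) • m) w =
      if w = vtx T.t T.ℓ i (j + 1) then D.a B i j (D.comp m (vtx T.t T.ℓ i j)) else 0 := by
  have := congrFun (D.ar_smul B h m.1) w
  rw [Pi.single_apply] at this
  exact this

variable (hS) in
/-- The element concentrated at a vertex. -/
def ι (v : Vtx T.t T.ℓ) (w : W) (hw : w ∈ S v) : D.subRep hS :=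
  ⟨(Pi.single v w : Vtx T.t T.ℓ → W), by
    intro v' _
    by_cases h : v' = v
    · subst h
      rw [Pi.single_eq_same]
      exact hw
    · rw [Pi.single_eq_of_ne h]
      exact (S v').zero_mem⟩

lemma comp_ι (v v' : Vtx T.t T.ℓ) (w : W) (hw : w ∈ S v) :
    D.comp (ι hS v w hw) v' = if v' = v then w else 0 :=
  Pi.single_apply (M := W) v w v'

lemma e_smul_ι (v : Vtx T.t T.ℓ) (w : W) (hw : w ∈ S v) :
    op (mkA T (eV v)) • ι hS v w hw = ι hS v w hw := by
  refine comp_ext fun v' => ?_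
  rw [comp_e_smul, comp_ι, comp_ι, if_pos rfl]

lemma e_smul_eq_ι (v : Vtx T.t T.ℓ) (m : D.subRep hS) :
    op (mkA T (eV v)) • m = ι hS v (D.comp m v) (comp_mem D m v) := by
  refine comp_ext fun v' => ?_
  rw [comp_e_smul, comp_ι]

lemma ι_congr (v : Vtx T.t T.ℓ) {w w' : W} (h : w = w') (hw : w ∈ S v) :
    ι hS v w hw = ι hS v w' (h ▸ hw) := by
  subst h
  rfl

lemma ar_smul_ι {i : Fin T.t} {j : ℕ} (h : j < T.ℓ i) (w : W) (hw : w ∈ S (vtx T.t T.ℓ i j)) :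
    op (mkA T (arE i j)) • ι hS (vtx T.t T.ℓ i j) w hw =
      ι hS (vtx T.t T.ℓ i (j + 1)) (D.a B i j w) (hS i j h w hw) := by
  refine comp_ext fun v' => ?_
  rw [comp_ar_smul h, comp_ι, comp_ι, if_pos rfl]

/-- Paths not starting at the source act as the identity. -/
lemma sub_smul_ι {i : Fin T.t} {a b : ℕ} (ha : 1 ≤ a) (hab : a ≤ b) (hb : b ≤ T.ℓ i) (w : W)
    (hw : w ∈ S (vtx T.t T.ℓ i a)) :
    ∃ hw' : w ∈ S (vtx T.t T.ℓ i b), op (mkA T (subE i a b)) • ι hS (vtx T.t T.ℓ i a) w hw =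
      ι hS (vtx T.t T.ℓ i b) w hw' := by
  induction b, hab using Nat.le_induction with
  | base => exact ⟨hw, by rw [subE_self, map_one, op_one, one_smul]⟩
  | succ b hab ih =>
    obtain ⟨h1, h2⟩ := ih (by omega)
    have h3 : D.a B i b w = w := by rw [Dat.a, if_neg (by omega)]; rfl
    refine ⟨h3 ▸ hS i b (by omega) w h1, ?_⟩
    rw [subE_snoc _ _ _ hab, map_mul, op_mul, mul_smul, h2, ar_smul_ι (by omega)]
    exact ι_congr _ h3 _

/-- Paths starting at the source. -/
lemma sub_zero_smul_ι {i : Fin T.t} {b : ℕ} (hb0 : 1 ≤ b) (hb : b ≤ T.ℓ i) (w : W)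
    (hw : w ∈ S .src) :
    ∃ hw' : D.p B i w ∈ S (vtx T.t T.ℓ i b), op (mkA T (subE i 0 b)) • ι hS .src w hw =
      ι hS (vtx T.t T.ℓ i b) (D.p B i w) hw' := by
  have h0 : vtx T.t T.ℓ i 0 = .src := vtx_zero i
  have hw0 : w ∈ S (vtx T.t T.ℓ i 0) := by rwa [h0]
  have h1 : ι hS .src w hw = ι hS (vtx T.t T.ℓ i 0) w hw0 := by
    refine comp_ext fun v' => ?_
    rw [comp_ι, comp_ι, h0]
  have h3 : D.a B i 0 w = D.p B i w := by rw [Dat.a, if_pos rfl]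
  obtain ⟨h4, h5⟩ := sub_smul_ι (hS := hS) (a := 1) le_rfl hb0 hb (D.p B i w)
    (h3 ▸ hS i 0 (by omega) w hw0)
  refine ⟨h4, ?_⟩
  rw [subE_cons _ _ _ hb0, map_mul, op_mul, mul_smul, h1, ar_smul_ι (by omega), ← h5]
  exact congrArg _ (ι_congr _ h3 _)

end Dat

end Representations

end Toupie

namespace Toupie

section Representations

variable {k : Type u} [Field k] {T : ToupieAlg k}

namespace Dat

section Hom

variable {D : Dat T} {W W' : Type u} [AddCommGroup W] [Module k W] [AddCommGroup W'] [Module k W']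
  {B : Module.End k W} {B' : Module.End k W'} {S : Vtx T.t T.ℓ → Submodule k W}
  {S' : Vtx T.t T.ℓ → Submodule k W'} {hS : D.Stable B S} {hS' : D.Stable B' S'}
  (htop : ∀ w, w ∈ S .snk)

/-- The component at the sink of a homomorphism of representations. -/
def homSnk (f : D.subRep hS →ₗ[(Alg T)ᵐᵒᵖ] D.subRep hS') : W →ₗ[k] W' where
  toFun w := D.comp (f (ι hS .snk w (htop w))) .snk
  map_add' w w' := by
    rw [← comp_add, ← map_add]
    congr 2
    refine comp_ext fun v => ?_
    simp only [comp_ι, comp_add]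
    split_ifs <;> simp
  map_smul' c w := by
    rw [RingHom.id_apply, ← comp_smul, ← f.map_smul_of_tower]
    congr 2
    refine comp_ext fun v => ?_
    simp only [comp_ι, comp_smul]
    split_ifs <;> simp

variable (f : D.subRep hS →ₗ[(Alg T)ᵐᵒᵖ] D.subRep hS')

lemma hom_ι (v : Vtx T.t T.ℓ) (w : W) (hw : w ∈ S v) :
    f (ι hS v w hw) = ι hS' v (D.comp (f (ι hS v w hw)) v) (comp_mem D _ v) := by
  rw [← e_smul_eq_ι, ← f.map_smul, e_smul_ι]

lemma hom_ι_vtx (i : Fin T.t) (a : ℕ) (ha : 1 ≤ a) (hb : a ≤ T.ℓ i) (w : W)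
    (hw : w ∈ S (vtx T.t T.ℓ i a)) :
    D.comp (f (ι hS (vtx T.t T.ℓ i a) w hw)) (vtx T.t T.ℓ i a) = homSnk htop f w := by
  have h1 := hom_ι f (vtx T.t T.ℓ i a) w hw
  set w' := D.comp (f (ι hS (vtx T.t T.ℓ i a) w hw)) (vtx T.t T.ℓ i a)
  have h2 := congrArg (op (mkA T (subE i a (T.ℓ i))) • ·) h1
  obtain ⟨h3, h4⟩ := sub_smul_ι (hS := hS) ha hb le_rfl w hw
  obtain ⟨h5, h6⟩ := sub_smul_ι (hS := hS') ha hb le_rfl w' (comp_mem D _ _)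
  rw [← f.map_smul, h4, h6] at h2
  have h7 := congrArg (fun m => D.comp m (vtx T.t T.ℓ i (T.ℓ i))) h2
  simp only [comp_ι, if_true] at h7
  rw [← h7]
  have h8 : vtx T.t T.ℓ i (T.ℓ i) = .snk := vtx_top _ _ (T.hℓ i) le_rfl
  simp only [h8]
  rfl

lemma hom_ι_src (w : W) (hw : w ∈ S .src) (i : Fin T.t) :
    homSnk htop f (D.p B i w) = D.p B' i (D.comp (f (ι hS .src w hw)) .src) := by
  have h1 := hom_ι f .src w hw
  set w' := D.comp (f (ι hS .src w hw)) .src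
  have h2 := congrArg (op (mkA T (subE i 0 (T.ℓ i))) • ·) h1
  obtain ⟨h3, h4⟩ := sub_zero_smul_ι (hS := hS) (T.hℓ i) le_rfl w hw
  obtain ⟨h5, h6⟩ := sub_zero_smul_ι (hS := hS') (T.hℓ i) le_rfl w' (comp_mem D _ _)
  rw [← f.map_smul, h4, h6] at h2
  have h7 := congrArg (fun m => D.comp m (vtx T.t T.ℓ i (T.ℓ i))) h2
  simp only [comp_ι, if_true] at h7
  rw [← h7, ← hom_ι_vtx htop f i _ (T.hℓ i) le_rfl _ h3]

lemma hom_ι_src' (w : W) (hw : w ∈ S .src) :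
    D.comp (f (ι hS .src w hw)) .src = homSnk htop f w := by
  obtain ⟨j, hj⟩ := Function.ne_iff.1 D.hc₂
  have h1 := hom_ι_src htop f w hw j
  have h2 : D.c₁ j = 0 := (D.disj j).resolve_right hj
  simp only [p_apply, h2, zero_smul, add_zero, map_smul] at h1
  exact (smul_right_injective _ hj h1).symm

/-- A homomorphism of representations is determined by its component at the sink. -/
lemma comp_hom (m : D.subRep hS) (v : Vtx T.t T.ℓ) :
    D.comp (f m) v = homSnk htop f (D.comp m v) := by
  have h : D.comp (f m) v = D.comp (f (ι hS v (D.comp m v) (comp_mem D m v))) v := by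
    rw [← e_smul_eq_ι, f.map_smul, comp_e_smul, if_pos rfl]
  rw [h]
  obtain ⟨i, a, ha, rfl⟩ := exists_eq_vtx (by have := T.ht; omega) T.hℓ v
  rcases Nat.eq_zero_or_pos a with rfl | h0
  · have h1 : vtx T.t T.ℓ i 0 = .src := vtx_zero i
    simp only [h1]
    exact hom_ι_src' htop f _ _
  · exact hom_ι_vtx htop f i a h0 ha _ _

lemma homSnk_p (w : W) (hw : w ∈ S .src) (i : Fin T.t) :
    homSnk htop f (D.p B i w) = D.p B' i (homSnk htop f w) := by
  rw [hom_ι_src htop f w hw, hom_ι_src' htop f w hw]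

lemma homSnk_mem (v : Vtx T.t T.ℓ) (w : W) (hw : w ∈ S v) : homSnk htop f w ∈ S' v := by
  have := comp_hom htop f (ι hS v w hw) v
  rw [comp_ι, if_pos rfl] at this
  rw [← this]
  exact comp_mem D _ v

lemma homSnk_injective (hf : Function.Injective f) : Function.Injective (homSnk htop f) := by
  rw [← LinearMap.ker_eq_bot, LinearMap.ker_eq_bot']
  intro w hw
  have h : f (ι hS .snk w (htop w)) = 0 := by
    refine comp_ext fun v => ?_
    rw [comp_hom htop, comp_ι, comp_zero]
    split_ifs
    · exact hw
    · exact map_zero _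
  have h2 := congrArg (fun m => D.comp m .snk) (hf (h.trans (map_zero f).symm))
  simpa [comp_ι, comp_zero] using h2

end Hom

section Indec

variable {D : Dat T} {W : Type u} [AddCommGroup W] [Module k W]
  {B : Module.End k W} {S : Vtx T.t T.ℓ → Submodule k W} {hS : D.Stable B S}

/-- A criterion for indecomposability. -/
lemma indec_of [Nontrivial W] (htop : ∀ w, w ∈ S .snk)
    (h : ∀ g : W →ₗ[k] W, g.comp g = g → (∀ i, ∀ w ∈ S .src, g (D.p B i w) = D.p B i (g w)) →
      (∀ v, ∀ w ∈ S v, g w ∈ S v) → g = 0 ∨ g = LinearMap.id) :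
    Indec (Alg T)ᵐᵒᵖ (ModuleCat.of (Alg T)ᵐᵒᵖ (D.subRep hS)) := by
  constructor
  · obtain ⟨w, hw⟩ := exists_ne (0 : W)
    refine ⟨ι hS .snk w (htop w), 0, fun h => hw ?_⟩
    have h2 := congrArg (fun m => D.comp m .snk) h
    simpa [comp_ι, comp_zero] using h2
  · intro f hf
    change D.subRep hS →ₗ[(Alg T)ᵐᵒᵖ] D.subRep hS at f
    have hff : ∀ m, f (f m) = f m := fun m => LinearMap.congr_fun hf m
    rcases h (homSnk htop f) (by
      ext w
      have h1 := comp_hom htop f (f (ι hS .snk w (htop w))) .snk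
      rw [hff] at h1
      exact h1.symm) (fun i w hw => homSnk_p htop f w hw i)
      (fun v w hw => homSnk_mem htop f v w hw) with h1 | h1
    · left
      refine LinearMap.ext fun m => comp_ext fun v => ?_
      rw [comp_hom htop, h1]
      rfl
    · right
      refine LinearMap.ext fun m => comp_ext fun v => ?_
      rw [comp_hom htop, h1]
      rfl

instance [Module.Finite k W] : Module.Finite (Alg T)ᵐᵒᵖ (D.subRep hS) := by
  have : Module.Finite k (D.subRep hS) := by
    let F : D.subRep hS →ₗ[k] (Vtx T.t T.ℓ → W) :=
      { toFun := fun m => D.comp m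
        map_add' := fun m n => rfl
        map_smul' := fun c m => rfl }
    exact Module.Finite.of_injective F fun m n h => comp_ext fun v => congrFun h v
  exact Module.Finite.of_restrictScalars_finite k _ _

end Indec

section Fam

variable (D : Dat T) {W : Type u} [AddCommGroup W] [Module k W]
  (B : Module.End k W) (S₀ : Submodule k W) (Sm : Fin T.t → Submodule k W)

/-- Families of subspaces constant along the interior of each branch. -/
def fam : Vtx T.t T.ℓ → Submodule k W
  | .src => S₀
  | .snk => ⊤
  | .mid i _ => Sm i

variable {S₀ Sm}

lemma mem_fam {i : Fin T.t} {a : ℕ} (ha : 1 ≤ a) {w : W} (hw : w ∈ Sm i) :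
    w ∈ fam S₀ Sm (vtx T.t T.ℓ i a) := by
  obtain ⟨a, rfl⟩ := Nat.exists_eq_add_of_le' ha
  rcases lt_or_ge a (T.ℓ i - 1) with h | h
  · rw [vtx_mid i a h]
    exact hw
  · rw [vtx_top i (a + 1) ha (by omega)]
    exact Submodule.mem_top

lemma mem_of_mem_fam {i : Fin T.t} {a : ℕ} (ha : 1 ≤ a) (hb : a < T.ℓ i) {w : W}
    (hw : w ∈ fam S₀ Sm (vtx T.t T.ℓ i a)) : w ∈ Sm i := by
  obtain ⟨a, rfl⟩ := Nat.exists_eq_add_of_le' ha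
  rw [vtx_mid i a (by omega)] at hw
  exact hw

lemma stable_fam (h : ∀ i, ∀ w ∈ S₀, D.p B i w ∈ Sm i) : D.Stable B (fam S₀ Sm) := by
  intro i j hj w hw
  rcases Nat.eq_zero_or_pos j with rfl | h0
  · rw [vtx_zero] at hw
    rw [a, if_pos rfl]
    exact mem_fam le_rfl (h i w hw)
  · rw [a, if_neg (by omega)]
    exact mem_fam (by omega) (mem_of_mem_fam h0 hj hw)

end Fam

end Dat

end Representations

end Toupie

namespace Toupie

/-- The nilpotent Jordan block. -/
def shift (k : Type u) [Field k] (n : ℕ) : Module.End k (Fin (n + 1) → k) where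
  toFun x i := if h : 0 < i.1 then x ⟨i.1 - 1, by omega⟩ else 0
  map_add' x y := by
    funext i
    simp only [Pi.add_apply]
    split_ifs <;> simp
  map_smul' c x := by
    funext i
    simp only [Pi.smul_apply]
    split_ifs <;> simp

section Shift

variable (k : Type u) [Field k] (n : ℕ)

lemma shift_apply (x : Fin (n + 1) → k) (i : Fin (n + 1)) :
    shift k n x i = if h : 0 < i.1 then x ⟨i.1 - 1, by omega⟩ else 0 := rfl

lemma shift_pow_apply (m : ℕ) (x : Fin (n + 1) → k) (i : Fin (n + 1)) (h : i.1 < m) :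
    (shift k n ^ m) x i = 0 := by
  induction m generalizing i with
  | zero => omega
  | succ m ih =>
    rw [pow_succ', Module.End.mul_apply, shift_apply]
    split_ifs with h0
    · exact ih _ (by simp; omega)
    · rfl

lemma shift_pow : shift k n ^ (n + 1) = 0 := by
  refine LinearMap.ext fun x => funext fun i => ?_
  rw [shift_pow_apply k n _ x i i.2]
  rfl

variable {k n}

lemma eq_of_shift_eq_zero {x : Fin (n + 1) → k} (h : shift k n x = 0) :
    x = x (Fin.last n) • Pi.single (Fin.last n) 1 := by
  funext i
  rw [Pi.smul_apply, Pi.single_apply]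
  split_ifs with hi
  · rw [hi, smul_eq_mul, mul_one]
  · have hi' : i.1 < n := by
      have := Fin.val_ne_of_ne hi
      simp at this
      omega
    have := congrFun h ⟨i.1 + 1, by omega⟩
    rw [shift_apply, dif_pos (Nat.succ_pos _)] at this
    rw [smul_zero]
    exact this

lemma shift_single_last (c : k) : shift k n (Pi.single (Fin.last n) c) = 0 := by
  funext i
  rw [shift_apply]
  split_ifs with h
  · rw [Pi.single_apply, if_neg]
    · rfl
    · intro h2
      have := congrArg Fin.val h2
      simp at this
      omega
  · rfl

/-- A nonzero subspace stable under the Jordan block contains a nonzero vector of the kernel. -/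
lemma exists_shift_eq_zero (g : (Fin (n + 1) → k) →ₗ[k] (Fin (n + 1) → k))
    (hg : g.comp g = g) (hc : ∀ x, g (shift k n x) = shift k n (g x)) (h0 : g ≠ 0) :
    g (Pi.single (Fin.last n) 1) = Pi.single (Fin.last n) 1 := by
  obtain ⟨x, hx⟩ : ∃ x, g x ≠ 0 := by
    by_contra! h
    exact h0 (LinearMap.ext h)
  have hex : ∃ m, (shift k n ^ m) (g x) = 0 := ⟨n + 1, by rw [shift_pow]; rfl⟩
  have hm := Nat.find_spec hex
  have hm' : ∀ m' < Nat.find hex, (shift k n ^ m') (g x) ≠ 0 := fun m' h => Nat.find_min hex h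
  generalize Nat.find hex = m at hm hm'
  obtain _ | m := m
  · exact absurd hm hx
  have h1 := hm' m (Nat.lt_succ_self m)
  rw [pow_succ', Module.End.mul_apply] at hm
  have h2 : ∀ m y, g ((shift k n ^ m) y) = (shift k n ^ m) (g y) := by
    intro m
    induction m with
    | zero => intro y; rfl
    | succ m ih =>
      intro y
      rw [pow_succ', Module.End.mul_apply, hc, ih, Module.End.mul_apply]
  have h3 := h2 m (g x)
  have h4 : g (g x) = g x := LinearMap.congr_fun hg x
  rw [h4] at h3
  have h5 := eq_of_shift_eq_zero hm
  rw [h5, map_smul] at h3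
  refine smul_right_injective _ ?_ h3
  intro h6
  rw [h6, zero_smul] at h5
  exact h1 h5

lemma eq_zero_or_eq_id_of_shift (g : (Fin (n + 1) → k) →ₗ[k] (Fin (n + 1) → k))
    (hg : g.comp g = g) (hc : ∀ x, g (shift k n x) = shift k n (g x)) :
    g = 0 ∨ g = LinearMap.id := by
  by_contra! h
  have h1 := exists_shift_eq_zero g hg hc h.1
  have h2 := exists_shift_eq_zero (LinearMap.id - g) (by
    rw [LinearMap.comp_sub, LinearMap.sub_comp, LinearMap.sub_comp, hg]
    simp) (fun x => by simp [hc]) (by rw [sub_ne_zero]; exact h.2.symm)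
  rw [LinearMap.sub_apply, h1, LinearMap.id_apply, sub_self] at h2
  have := congrFun h2 (Fin.last n)
  simp at this

end Shift

section Representations

variable {k : Type u} [Field k] {T : ToupieAlg k}

namespace Dat

variable (D : Dat T) (n : ℕ)

lemma stable_mod : D.Stable (shift k n)
    (fam ⊤ fun i => LinearMap.range (D.p (shift k n) i)) :=
  D.stable_fam _ fun _ w _ => ⟨w, rfl⟩

/-- A family of indecomposable modules of growing dimension. -/
abbrev mod : ModuleCat.{u} (Alg T)ᵐᵒᵖ := ModuleCat.of _ (D.subRep (D.stable_mod n))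

lemma indec_mod : Indec _ (D.mod n) := by
  refine indec_of (fun w => Submodule.mem_top) fun g hg hp _ => ?_
  obtain ⟨j, hj⟩ := Function.ne_iff.1 D.hc₁
  have h2 : D.c₂ j = 0 := (D.disj j).resolve_left hj
  refine eq_zero_or_eq_id_of_shift g hg fun x => ?_
  have h1 := hp j x Submodule.mem_top
  simp only [p_apply, h2, zero_smul, zero_add, map_smul] at h1
  exact smul_right_injective _ hj h1

lemma fd_mod : FdMod _ (D.mod n) :=
  inferInstanceAs (Module.Finite (Alg T)ᵐᵒᵖ (D.subRep (D.stable_mod n)))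

variable {D n} in
/-- The homomorphism induced by an intertwiner. -/
def modMap {m : ℕ} (h : (Fin (n + 1) → k) →ₗ[k] (Fin (m + 1) → k))
    (hh : ∀ x, h (shift k n x) = shift k m (h x)) : D.mod n →ₗ[(Alg T)ᵐᵒᵖ] D.mod m :=
  homOfGens T (M := D.subRep (D.stable_mod n)) (N := D.subRep (D.stable_mod m))
    { toFun := fun f => ⟨fun v => h (D.comp f v), by
        intro v _
        have hf := comp_mem D f v
        obtain _ | _ | ⟨i, a⟩ := v
        · exact Submodule.mem_top
        · exact Submodule.mem_top
        · obtain ⟨w, hw⟩ := hf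
          refine ⟨h w, ?_⟩
          change _ = h _
          rw [← hw, p_apply, p_apply, ← hh, map_add, map_smul, map_smul]⟩
      map_add' := fun f g => comp_ext fun v => map_add h _ _
      map_smul' := fun c f => comp_ext fun v => map_smul h c _ }
    (by
      intro v f
      refine comp_ext fun w => ?_
      rw [comp_e_smul]
      change h (D.comp (op (mkA T (eV v)) • f) w) = if w = v then h (D.comp f v) else 0
      rw [comp_e_smul]
      split_ifs
      · rfl
      · exact map_zero h)
    (by
      intro i j hj f
      refine comp_ext fun w => ?_
      rw [comp_ar_smul hj]
      change h (D.comp (op (mkA T (arE i j)) • f) w) =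
        if w = _ then D.a (shift k m) i j (h (D.comp f _)) else 0
      rw [comp_ar_smul hj]
      split_ifs
      · rw [a, a]
        split_ifs
        · rw [p_apply, p_apply, ← hh, map_add, map_smul, map_smul]
        · rfl
      · exact map_zero h)

lemma modMap_ne_zero {m : ℕ} (h : (Fin (n + 1) → k) →ₗ[k] (Fin (m + 1) → k))
    (hh : ∀ x, h (shift k n x) = shift k m (h x)) (h0 : h ≠ 0) : modMap (D := D) h hh ≠ 0 := by
  intro h1
  refine h0 (LinearMap.ext fun w => ?_)
  have h2 := congrArg (fun m' => D.comp (hS := D.stable_mod m) m' .snk)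
    (LinearMap.congr_fun h1 (ι (D.stable_mod n) .snk w Submodule.mem_top))
  have h3 := (comp_ι (hS := D.stable_mod n) .snk .snk w Submodule.mem_top).trans (if_pos rfl)
  exact (congrArg h h3).symm.trans h2

lemma eq_of_equiv {m : ℕ} (f : D.mod n ≃ₗ[(Alg T)ᵐᵒᵖ] D.mod m) : n ≤ m := by
  have h1 := homSnk_injective (hS := D.stable_mod n) (hS' := D.stable_mod m)
    (fun w => Submodule.mem_top) f.toLinearMap f.injective
  have h2 := LinearMap.finrank_le_finrank_of_injective h1
  simpa using h2

lemma step_to (hn : 1 ≤ n) : Step _ (D.mod 0) (D.mod n) := by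
  refine ⟨D.indec_mod 0, D.fd_mod 0, D.indec_mod n, D.fd_mod n,
    modMap ((LinearMap.single k (fun _ => k) (Fin.last n)).comp (LinearMap.proj 0)) ?_, ?_, ?_⟩
  · intro x
    simp only [LinearMap.comp_apply, LinearMap.proj_apply, LinearMap.single_apply,
      shift_single_last]
    simp [shift_apply]
  · refine modMap_ne_zero _ _ _ _ fun h => ?_
    have := congrFun (LinearMap.congr_fun h (fun _ => 1)) (Fin.last n)
    simp at this
  · intro h
    have := D.eq_of_equiv _ (LinearEquiv.ofBijective _ h).symm
    omega

lemma step_from (hn : 1 ≤ n) : Step _ (D.mod n) (D.mod 0) := by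
  refine ⟨D.indec_mod n, D.fd_mod n, D.indec_mod 0, D.fd_mod 0,
    modMap (LinearMap.pi fun _ => LinearMap.proj 0) ?_, ?_, ?_⟩
  · intro x
    funext i
    simp [shift_apply]
  · refine modMap_ne_zero _ _ _ _ fun h => ?_
    have := congrFun (LinearMap.congr_fun h (fun _ => 1)) 0
    simp at this
  · intro h
    have := D.eq_of_equiv _ (LinearEquiv.ofBijective _ h)
    omega

/-- The element witnessing that the projective dimension is at least two. -/
lemma exists_mod_src : ∃ m : D.mod n, m ≠ 0 ∧ op (e0 T) • m = m ∧
    ∀ i, D.r i ≠ 0 → op (mkA T (subE i 0 (T.ℓ i - 1))) • m = 0 := by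
  refine ⟨ι (D.stable_mod n) .src (Pi.single (Fin.last n) 1) Submodule.mem_top, ?_,
    e_smul_ι _ _ _, ?_⟩
  · intro h
    have h3 := (comp_ι (hS := D.stable_mod n) .src .src (Pi.single (Fin.last n) 1)
      Submodule.mem_top).trans (if_pos rfl)
    have h2 := h3.symm.trans (congrArg (fun m => D.comp (hS := D.stable_mod n) m .src) h)
    have := (Pi.single_eq_same (M := fun _ => k) (Fin.last n) 1).symm.trans
      (congrFun h2 (Fin.last n))
    exact one_ne_zero this
  · intro i hi
    obtain ⟨h1, h2⟩ := sub_zero_smul_ι (hS := D.stable_mod n) (i := i) (b := T.ℓ i - 1)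
      (by have := D.two_le hi; omega) (by omega) (Pi.single (Fin.last n) 1) Submodule.mem_top
    refine h2.trans (comp_ext fun v => ?_)
    rw [comp_ι, p_apply, D.r_c₂ i hi, shift_single_last, comp_zero]
    simp

/-- The element witnessing that the injective dimension is at least two. -/
lemma exists_mod_snk : ∃ x : D.mod 0, x ≠ 0 ∧ op (einf T) • x = x ∧
    ∀ i, D.r i ≠ 0 → ∀ y : D.mod 0, op (mkA T (eV (vtx T.t T.ℓ i 1))) • y = 0 := by
  refine ⟨ι (D.stable_mod 0) .snk (Pi.single (Fin.last 0) 1) Submodule.mem_top, ?_,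
    e_smul_ι _ _ _, ?_⟩
  · intro h
    have h3 := (comp_ι (hS := D.stable_mod 0) .snk .snk (Pi.single (Fin.last 0) 1)
      Submodule.mem_top).trans (if_pos rfl)
    have h2 := h3.symm.trans (congrArg (fun m => D.comp (hS := D.stable_mod 0) m .snk) h)
    have := (Pi.single_eq_same (M := fun _ => k) (Fin.last 0) 1).symm.trans
      (congrFun h2 (Fin.last 0))
    exact one_ne_zero this
  · intro i hi y
    refine comp_ext fun v => ?_
    change D.comp (hS := D.stable_mod 0) (_ • _) v = 0
    rw [comp_e_smul]
    have h1 := comp_mem D (hS := D.stable_mod 0) y (vtx T.t T.ℓ i 1)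
    obtain ⟨w, hw⟩ := mem_of_mem_fam le_rfl (by have := D.two_le hi; omega) h1
    split_ifs
    · rw [← hw, p_apply, D.r_c₂ i hi]
      funext j
      simp [shift_apply]
    · rfl

end Dat

end Representations

end Toupie

namespace Toupie

section Representations

variable {k : Type u} [Field k] {T : ToupieAlg k}

namespace Dat

section HomTo

variable {D : Dat T} {W : Type u} [AddCommGroup W] [Module k W]
  {B : Module.End k W} {S : Vtx T.t T.ℓ → Submodule k W} (hS : D.Stable B S)
  {N : Type*} [AddCommGroup N] [Module k N] [Module (Alg T)ᵐᵒᵖ N]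
  (Θ : Vtx T.t T.ℓ → W →ₗ[k] N)

lemma e_smul_sum (he : ∀ v w, op (mkA T (eV v)) • Θ v w = Θ v w) (v : Vtx T.t T.ℓ)
    (g : Vtx T.t T.ℓ → W) : op (mkA T (eV v)) • ∑ w, Θ w (g w) = Θ v (g v) := by
  rw [Finset.smul_sum, Finset.sum_eq_single v]
  · exact he _ _
  · intro w _ hw
    rw [← he w, smul_smul, ← op_mul, ← map_mul, (pathRel_gens k T.t T.ℓ).orth, if_neg hw,
      map_zero, op_zero, zero_smul]
  · simp

variable [IsScalarTower k (Alg T)ᵐᵒᵖ N]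

/-- The homomorphism out of a representation given by its components. -/
def homTo (he : ∀ v w, op (mkA T (eV v)) • Θ v w = Θ v w)
    (ha : ∀ i j, j < T.ℓ i → ∀ w ∈ S (vtx T.t T.ℓ i j),
      Θ (vtx T.t T.ℓ i (j + 1)) (D.a B i j w) = op (mkA T (arE i j)) • Θ (vtx T.t T.ℓ i j) w) :
    D.subRep hS →ₗ[(Alg T)ᵐᵒᵖ] N :=
  homOfGens T (M := D.subRep hS)
    { toFun := fun f => ∑ v, Θ v (D.comp f v)
      map_add' := fun f g => by simp only [comp_add, map_add, Finset.sum_add_distrib]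
      map_smul' := fun c f => by simp only [comp_smul, map_smul, Finset.smul_sum]; rfl }
    (by
      intro v f
      change ∑ w, Θ w (D.comp (op (mkA T (eV v)) • f) w) =
        op (mkA T (eV v)) • ∑ w, Θ w (D.comp f w)
      rw [e_smul_sum Θ he]
      simp only [comp_e_smul]
      rw [Finset.sum_eq_single v]
      · rw [if_pos rfl]
      · intro w _ hw
        rw [if_neg hw, map_zero]
      · simp)
    (by
      intro i j hj f
      change ∑ w, Θ w (D.comp (op (mkA T (arE i j)) • f) w) =
        op (mkA T (arE i j)) • ∑ w, Θ w (D.comp f w)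
      have h1 : op (mkA T (arE i j)) =
          op (mkA T (arE i j)) * op (mkA T (eV (vtx T.t T.ℓ i j))) := by
        rw [← op_mul, ← map_mul, (pathRel_gens k T.t T.ℓ).left]
      conv_rhs => rw [h1, mul_smul, e_smul_sum Θ he, ← ha i j hj _ (comp_mem D f _)]
      simp only [comp_ar_smul hj]
      rw [Finset.sum_eq_single (vtx T.t T.ℓ i (j + 1))]
      · rw [if_pos rfl]
      · intro w _ hw
        rw [if_neg hw, map_zero]
      · simp)

lemma homTo_apply (he : ∀ v w, op (mkA T (eV v)) • Θ v w = Θ v w)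
    (ha : ∀ i j, j < T.ℓ i → ∀ w ∈ S (vtx T.t T.ℓ i j),
      Θ (vtx T.t T.ℓ i (j + 1)) (D.a B i j w) = op (mkA T (arE i j)) • Θ (vtx T.t T.ℓ i j) w)
    (f : D.subRep hS) : homTo hS Θ he ha f = ∑ v, Θ v (D.comp f v) := rfl

lemma homTo_ι (he : ∀ v w, op (mkA T (eV v)) • Θ v w = Θ v w)
    (ha : ∀ i j, j < T.ℓ i → ∀ w ∈ S (vtx T.t T.ℓ i j),
      Θ (vtx T.t T.ℓ i (j + 1)) (D.a B i j w) = op (mkA T (arE i j)) • Θ (vtx T.t T.ℓ i j) w)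
    (v : Vtx T.t T.ℓ) (w : W) (hw : w ∈ S v) : homTo hS Θ he ha (ι hS v w hw) = Θ v w := by
  rw [homTo_apply, Finset.sum_eq_single v]
  · rw [comp_ι, if_pos rfl]
  · intro w _ hw
    rw [comp_ι, if_neg hw, map_zero]
  · simp

end HomTo

variable (D : Dat T)

/-- The circuit as a vector indexed by its support. -/
def ρ : {i // D.r i ≠ 0} → k := fun i => D.r i

/-- The subspaces defining the module embedding the circuit. -/
def zSub : Fin T.t → Submodule k ({i // D.r i ≠ 0} → k) := fun i =>
  if h : D.r i ≠ 0 then Submodule.span k {Pi.single ⟨i, h⟩ 1} else Submodule.span k {D.ρ}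

lemma stable_z : D.Stable (0 : Module.End k ({i // D.r i ≠ 0} → k))
    (fam (Submodule.span k {D.ρ}) D.zSub) := by
  refine D.stable_fam _ fun i w hw => ?_
  rw [p_apply, LinearMap.zero_apply, smul_zero, add_zero, zSub]
  split_ifs with h
  · rw [D.r_c₂ i h, zero_smul]
    exact Submodule.zero_mem _
  · exact Submodule.smul_mem _ _ hw

/-- An indecomposable module of projective dimension at least two mapping to `A`. -/
abbrev Z : ModuleCat.{u} (Alg T)ᵐᵒᵖ := ModuleCat.of _ (D.subRep D.stable_z)

lemma fd_Z : FdMod _ D.Z :=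
  inferInstanceAs (Module.Finite (Alg T)ᵐᵒᵖ (D.subRep D.stable_z))

lemma exists_r_ne : ∃ i, D.r i ≠ 0 := Function.ne_iff.1 D.hr.2.1

lemma ρ_ne_zero : D.ρ ≠ 0 := by
  obtain ⟨i, hi⟩ := D.exists_r_ne
  exact fun h => hi (congrFun h ⟨i, hi⟩)

lemma indec_Z : Indec _ D.Z := by
  have : Nontrivial ({i // D.r i ≠ 0} → k) := ⟨_, _, D.ρ_ne_zero⟩
  refine indec_of (fun w => Submodule.mem_top) fun g hg _ hm => ?_
  obtain ⟨a, ha⟩ := Submodule.mem_span_singleton.1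
    (hm .src D.ρ (Submodule.mem_span_singleton_self _))
  have hb : ∀ i : {i // D.r i ≠ 0}, ∃ b : k, b • Pi.single i 1 = g (Pi.single i 1) := by
    intro i
    have h2 := D.two_le i.2
    have h1 := mem_of_mem_fam le_rfl (by omega) (hm (vtx T.t T.ℓ i 1) (Pi.single i 1)
      (mem_fam le_rfl (by rw [zSub, dif_pos i.2]; exact Submodule.mem_span_singleton_self _)))
    rw [zSub, dif_pos i.2] at h1
    exact Submodule.mem_span_singleton.1 h1
  choose b hb using hb
  have hgw : ∀ w i, g w i = b i * w i := by
    intro w i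
    have h1 : w = ∑ j, w j • Pi.single j (1 : k) := by
      funext j
      simp [Finset.sum_apply, Pi.single_apply]
    rw [h1]
    simp only [map_sum, map_smul, ← hb]
    simp [Finset.sum_apply, Pi.single_apply, mul_comm]
  have hba : ∀ i, b i = a := by
    intro i
    have h1 := hgw D.ρ i
    rw [← ha] at h1
    exact (mul_right_cancel₀ i.2 h1).symm
  have hga : g = a • LinearMap.id := by
    refine LinearMap.ext fun w => funext fun i => ?_
    rw [hgw, hba]
    rfl
  obtain ⟨i, hi⟩ := D.exists_r_ne
  have h3 : a * a = a := by
    have h1 := congrFun (LinearMap.congr_fun hg (Pi.single ⟨i, hi⟩ 1)) ⟨i, hi⟩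
    rw [LinearMap.comp_apply, hgw, hgw, hba, Pi.single_eq_same, mul_one] at h1
    exact h1
  rcases IsIdempotentElem.iff_eq_zero_or_one.1 h3 with h | h
  · left
    rw [hga, h, zero_smul]
  · right
    rw [hga, h, one_smul]

/-- The components of the homomorphism to `A`. -/
def zΘ : Vtx T.t T.ℓ → ({i // D.r i ≠ 0} → k) →ₗ[k] Alg T
  | .src => 0
  | .snk => ∑ i, (LinearMap.proj i).smulRight (mkA T (wE i.1))
  | .mid i a => if h : D.r i ≠ 0 then
      (LinearMap.proj ⟨i, h⟩).smulRight (mkA T (subE i 0 (a.1 + 1))) else 0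

lemma zΘ_snk (w : {i // D.r i ≠ 0} → k) : D.zΘ .snk w = ∑ i, w i • mkA T (wE i.1) := by
  simp [zΘ, LinearMap.sum_apply]

lemma zΘ_snk_single (i : {i // D.r i ≠ 0}) :
    D.zΘ .snk (Pi.single i 1) = mkA T (wE i.1) := by
  simp [zΘ_snk, Pi.single_apply, ite_smul]

lemma zΘ_snk_span {w : {i // D.r i ≠ 0} → k} (hw : w ∈ Submodule.span k {D.ρ}) :
    D.zΘ .snk w = 0 := by
  obtain ⟨c, rfl⟩ := Submodule.mem_span_singleton.1 hw
  have h1 := (mem_relSp T).1 D.hr.1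
  have h2 : ∑ i : {i // D.r i ≠ 0}, D.r i • mkA T (wE i.1) = ∑ i, D.r i • mkA T (wE i) := by
    rw [← Finset.sum_subtype (Finset.univ.filter fun i => D.r i ≠ 0) (by simp)
      (fun i => D.r i • mkA T (wE i))]
    refine Finset.sum_filter_of_ne fun i _ h hi => h ?_
    rw [hi, zero_smul]
  rw [map_smul, zΘ_snk]
  exact (congrArg _ (h2.trans h1)).trans (smul_zero c)

lemma zΘ_vtx {i : Fin T.t} {a : ℕ} (ha : 1 ≤ a) (hb : a < T.ℓ i) (w : {i // D.r i ≠ 0} → k) :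
    D.zΘ (vtx T.t T.ℓ i a) w =
      if h : D.r i ≠ 0 then w ⟨i, h⟩ • mkA T (subE i 0 a) else 0 := by
  obtain ⟨a, rfl⟩ := Nat.exists_eq_add_of_le' ha
  rw [vtx_mid i a (by omega), zΘ]
  split_ifs <;> rfl

lemma zΘ_e (v : Vtx T.t T.ℓ) (w : {i // D.r i ≠ 0} → k) :
    op (mkA T (eV v)) • D.zΘ v w = D.zΘ v w := by
  have h : ∀ i b, 1 ≤ b → b ≤ T.ℓ i → mkA T (subE i 0 b) * mkA T (eV (vtx T.t T.ℓ i b)) =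
      mkA T (subE i 0 b) := fun i b h1 h2 => by
    rw [← map_mul, sub_mul_e _ _ _ (by omega) h2]
  obtain _ | _ | ⟨i, a⟩ := v
  · exact smul_zero _
  · rw [zΘ_snk, Finset.smul_sum]
    refine Finset.sum_congr rfl fun i _ => ?_
    rw [op_smul_eq_mul, smul_mul_assoc, wE, ← vtx_top i.1 _ (T.hℓ i) le_rfl, h _ _ (T.hℓ i) le_rfl]
  · rw [← vtx_mid i a.1 a.2, zΘ_vtx _ (by omega) (by omega)]
    split_ifs
    · rw [op_smul_eq_mul, smul_mul_assoc, h _ _ (by omega) (by omega)]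
    · exact smul_zero _

lemma e0_mul_zΘ (v : Vtx T.t T.ℓ) (w : {i // D.r i ≠ 0} → k) :
    e0 T * D.zΘ v w = D.zΘ v w := by
  have h : ∀ i b, 1 ≤ b → b ≤ T.ℓ i → e0 T * mkA T (subE i 0 b) = mkA T (subE i 0 b) :=
    fun i b h1 h2 => by
      rw [e0, ← vtx_zero i, ← map_mul, e_mul_sub _ _ _ (by omega) h2]
  obtain _ | _ | ⟨i, a⟩ := v
  · exact mul_zero _
  · rw [zΘ_snk, Finset.mul_sum]
    refine Finset.sum_congr rfl fun i _ => ?_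
    rw [mul_smul_comm, wE, h _ _ (T.hℓ i) le_rfl]
  · rw [← vtx_mid i a.1 a.2, zΘ_vtx _ (by omega) (by omega)]
    split_ifs
    · rw [mul_smul_comm, h _ _ (by omega) (by omega)]
    · exact mul_zero _

lemma zΘ_a (i : Fin T.t) (j : ℕ) (hj : j < T.ℓ i) (w : {i // D.r i ≠ 0} → k)
    (hw : w ∈ fam (Submodule.span k {D.ρ}) D.zSub (vtx T.t T.ℓ i j)) :
    D.zΘ (vtx T.t T.ℓ i (j + 1)) (D.a 0 i j w) =
      op (mkA T (arE i j)) • D.zΘ (vtx T.t T.ℓ i j) w := by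
  rcases Nat.eq_zero_or_pos j with rfl | h0
  · have hw' : w ∈ Submodule.span k {D.ρ} := by rwa [vtx_zero] at hw
    rw [a, if_pos rfl, p_apply, LinearMap.zero_apply, smul_zero, add_zero, vtx_zero]
    have h1 : op (mkA T (arE i 0)) • D.zΘ .src w = 0 := smul_zero _
    rw [h1]
    by_cases hr : D.r i = 0
    · rcases lt_or_ge 1 (T.ℓ i) with h2 | h2
      · rw [zΘ_vtx _ (by omega) (by omega), dif_neg (by simpa using hr)]
      · rw [vtx_top _ _ (by omega) (by omega)]
        exact D.zΘ_snk_span (Submodule.smul_mem _ _ hw')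
    · rw [D.r_c₂ i hr, zero_smul, map_zero]
  · have hw' := mem_of_mem_fam h0 hj hw
    have h1 : D.a 0 i j w = w := by rw [a, if_neg (by omega)]; rfl
    rw [h1, zΘ_vtx _ h0 hj]
    rcases lt_or_ge (j + 1) (T.ℓ i) with h2 | h2
    · rw [zΘ_vtx _ (by omega) h2]
      split_ifs
      · rw [op_smul_eq_mul, smul_mul_assoc, ← map_mul, subE_snoc _ _ _ (Nat.zero_le _)]
      · exact (smul_zero _).symm
    · rw [vtx_top _ _ (by omega) h2]
      rw [zSub] at hw'
      split_ifs at hw' ⊢ with hr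
      · obtain ⟨c, rfl⟩ := Submodule.mem_span_singleton.1 hw'
        have h3 : T.ℓ i = j + 1 := by omega
        rw [map_smul, zΘ_snk_single, op_smul_eq_mul, smul_mul_assoc, ← map_mul,
          ← subE_snoc _ _ _ (Nat.zero_le _), wE, h3]
        simp
      · rw [D.zΘ_snk_span hw', smul_zero]

/-- The homomorphism to `A`. -/
def zHom : D.Z →ₗ[(Alg T)ᵐᵒᵖ] Alg T := homTo D.stable_z D.zΘ D.zΘ_e D.zΘ_a

lemma e0_mul_zHom (m : D.Z) : e0 T * D.zHom m = D.zHom m := by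
  have h := homTo_apply D.stable_z D.zΘ D.zΘ_e D.zΘ_a m
  have h' : D.zHom m = _ := h
  rw [h', Finset.mul_sum]
  exact Finset.sum_congr rfl fun v _ => D.e0_mul_zΘ _ _

lemma zHom_ne_zero : D.zHom ≠ 0 := by
  obtain ⟨i, hi⟩ := D.exists_r_ne
  intro h
  have h1 : D.zΘ .snk (Pi.single ⟨i, hi⟩ 1) = 0 :=
    (homTo_ι D.stable_z D.zΘ D.zΘ_e D.zΘ_a .snk (Pi.single ⟨i, hi⟩ 1) Submodule.mem_top).symm.trans
      (LinearMap.congr_fun h _)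
  rw [zΘ_snk_single, mkA_eq_zero] at h1
  exact D.hnb i h1

lemma exists_Z_src : ∃ m : D.Z, m ≠ 0 ∧ D.zHom m = 0 ∧ op (e0 T) • m = m ∧
    ∀ i, D.r i ≠ 0 → op (mkA T (subE i 0 (T.ℓ i - 1))) • m = 0 := by
  have hm : D.ρ ∈ fam (Submodule.span k {D.ρ}) D.zSub .src :=
    Submodule.mem_span_singleton_self _
  refine ⟨ι D.stable_z .src D.ρ hm, ?_, homTo_ι D.stable_z D.zΘ D.zΘ_e D.zΘ_a .src D.ρ hm,
    e_smul_ι _ _ _, ?_⟩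
  · intro h
    have h3 := (comp_ι (hS := D.stable_z) .src .src D.ρ hm).trans (if_pos rfl)
    exact D.ρ_ne_zero (h3.symm.trans (congrArg (fun m => D.comp (hS := D.stable_z) m .src) h))
  · intro i hi
    obtain ⟨h1, h2⟩ := sub_zero_smul_ι (hS := D.stable_z) (i := i) (b := T.ℓ i - 1)
      (by have := D.two_le hi; omega) (by omega) D.ρ hm
    refine h2.trans (comp_ext fun v => ?_)
    rw [comp_ι, p_apply, D.r_c₂ i hi, comp_zero]
    simp

end Dat

end Representations

end Toupie

namespace Toupie

section Dimension

variable {k : Type u} [Field k] {T : ToupieAlg k}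

namespace Dat

variable (D : Dat T)

lemma e0_mul_sub {i : Fin T.t} {b : ℕ} (h1 : 1 ≤ b) (h2 : b ≤ T.ℓ i) :
    e0 T * mkA T (subE i 0 b) = mkA T (subE i 0 b) := by
  rw [e0, ← vtx_zero i, ← map_mul, e_mul_sub _ _ _ (by omega) h2]

lemma e0_mul_e0 : e0 T * e0 T = e0 T := by
  rw [e0, ← map_mul, (pathRel_gens k T.t T.ℓ).orth, if_pos rfl]

/-- A free-coordinate form of the vanishing of relations. -/
lemma exists_lift {Ω : Type u} [AddCommGroup Ω] [Module (Alg T)ᵐᵒᵖ Ω]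
    [Module.Projective (Alg T)ᵐᵒᵖ Ω] (q : Fin T.t → Ω)
    (hq : ∀ i, D.r i ≠ 0 → op (mkA T (eV (vtx T.t T.ℓ i (T.ℓ i - 1)))) • q i = q i)
    (hs : ∑ i, (D.r i • op (mkA T (arE i (T.ℓ i - 1)))) • q i = 0) :
    ∃ ω : Ω, op (e0 T) • ω = ω ∧
      ∀ i, D.r i ≠ 0 → q i = op (mkA T (subE i 0 (T.ℓ i - 1))) • ω := by
  obtain ⟨s, hs'⟩ := Module.projective_def'.1 (show Module.Projective (Alg T)ᵐᵒᵖ Ω from inferInstance)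
  have hμ : ∀ y, ∃ c : k, ∀ i, D.r i ≠ 0 →
      (s (q i) y).unop = c • mkA T (subE i 0 (T.ℓ i - 1)) := by
    intro y
    obtain ⟨c, hc⟩ := exists_smul_of_sum_mul_arr T D.hnb D.hr
      (fun i => if D.r i = 0 then 0 else (s (q i) y).unop) (by
        intro i
        split_ifs with h
        · rw [zero_mul]
        · have h1 := congrArg (fun z => (s z y).unop) (hq i h)
          simp only [map_smul, Finsupp.smul_apply, smul_eq_mul, unop_mul, unop_op] at h1
          exact h1) (by
        have h1 := congrArg (fun z => (s z y).unop) hs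
        simp only [map_sum, map_smul, Finsupp.smul_apply, Finsupp.finsetSum_apply, smul_eq_mul,
          Finset.unop_sum, unop_mul, unop_op, unop_smul, map_zero, Finsupp.zero_apply,
          unop_zero, mul_smul_comm] at h1
        rw [← h1]
        refine Finset.sum_congr rfl fun i _ => ?_
        split_ifs with h
        · rw [h, zero_smul, zero_smul]
        · rfl)
    refine ⟨c, fun i hi => ?_⟩
    have := hc i hi
    rwa [if_neg hi] at this
  choose μ hμ using hμ
  obtain ⟨i₀, hi₀⟩ := D.exists_r_ne
  let g : Ω →₀ (Alg T)ᵐᵒᵖ := Finsupp.onFinset (s (q i₀)).support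
    (fun y => op (μ y • e0 T)) (by
      intro y hy
      rw [Finsupp.mem_support_iff]
      intro h0
      have h1 := hμ y i₀ hi₀
      rw [h0, unop_zero] at h1
      have h2 := D.two_le hi₀
      refine hy ?_
      have h3 : μ y = 0 := by
        by_contra h
        have := (smul_eq_zero.1 h1.symm).resolve_left h
        exact mkA_path_ne_zero T D.hnb (.sub i₀ 0 (T.ℓ i₀ - 1) (by omega) (by omega)) this
      rw [h3, zero_smul, op_zero])
  have hgy : ∀ y, g y = op (μ y • e0 T) := fun y => rfl
  refine ⟨Finsupp.linearCombination _ id g, ?_, fun i hi => ?_⟩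
  · rw [← map_smul]
    congr 1
    ext1 y
    rw [Finsupp.smul_apply, hgy, smul_eq_mul, ← op_mul, smul_mul_assoc, e0_mul_e0]
  · rw [← map_smul]
    have h1 : op (mkA T (subE i 0 (T.ℓ i - 1))) • g = s (q i) := by
      ext1 y
      rw [Finsupp.smul_apply, hgy, smul_eq_mul, ← op_mul, smul_mul_assoc,
        e0_mul_sub (by have := D.two_le hi; omega) (by omega), ← hμ y i hi, op_unop]
    rw [h1]
    exact (LinearMap.congr_fun hs' (q i)).symm

lemma eq_zero_of_projective {P : Type u} [AddCommGroup P] [Module (Alg T)ᵐᵒᵖ P]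
    [Module.Projective (Alg T)ᵐᵒᵖ P] {i : Fin T.t} (hi : D.r i ≠ 0) {d : P}
    (hd : op (e0 T) • d = d) (h : op (mkA T (subE i 0 (T.ℓ i - 1))) • d = 0) : d = 0 := by
  obtain ⟨s, hs⟩ := Module.projective_def'.1 (show Module.Projective (Alg T)ᵐᵒᵖ P from inferInstance)
  have h1 : s d = 0 := by
    ext1 y
    apply unop_injective
    refine eq_zero_of_mul_sub_left T D.hnb i (D.two_le hi) _ ?_ ?_
    · have h1 := congrArg (fun z => (s z y).unop) hd
      simpa only [map_smul, Finsupp.smul_apply, smul_eq_mul, unop_mul, unop_op] using h1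
    · have h1 := congrArg (fun z => (s z y).unop) h
      simpa only [map_smul, Finsupp.smul_apply, smul_eq_mul, unop_mul, unop_op, map_zero,
        Finsupp.zero_apply, unop_zero] using h1
  have h2 := LinearMap.congr_fun hs d
  rw [LinearMap.comp_apply, h1, map_zero] at h2
  exact h2.symm

/-- A criterion for projective dimension at least two. -/
lemma not_pdLeOne {N : ModuleCat.{u} (Alg T)ᵐᵒᵖ} {m : N} (hm : m ≠ 0)
    (h0 : op (e0 T) • m = m)
    (h : ∀ i, D.r i ≠ 0 → op (mkA T (subE i 0 (T.ℓ i - 1))) • m = 0) : ¬ PdLeOne _ N := by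
  rintro ⟨P, f, hf, hP, hΩ⟩
  obtain ⟨p', hp'⟩ := hf m
  set p := op (e0 T) • p' with hp
  have hfp : f p = m := by rw [hp, map_smul, hp', h0]
  have hep : op (e0 T) • p = p := by rw [hp, smul_smul, ← op_mul, e0_mul_e0]
  let q : Fin T.t → LinearMap.ker f := fun i => if hi : D.r i ≠ 0 then
    ⟨op (mkA T (subE i 0 (T.ℓ i - 1))) • p, by rw [LinearMap.mem_ker, map_smul, hfp, h i hi]⟩
    else 0
  have hq : ∀ i, D.r i ≠ 0 → (q i : P) = op (mkA T (subE i 0 (T.ℓ i - 1))) • p := by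
    intro i hi
    simp only [q]
    rw [dif_pos hi]
  obtain ⟨ω, hω, hqω⟩ := D.exists_lift q (by
    intro i hi
    apply Subtype.ext
    have := D.two_le hi
    rw [Submodule.coe_smul, hq i hi, smul_smul, ← op_mul, ← map_mul,
      sub_mul_e _ _ _ (by omega) (by omega)]) (by
    apply Subtype.ext
    rw [Submodule.coe_sum, Submodule.coe_zero]
    have h1 : ∀ i ∈ Finset.univ, (((D.r i • op (mkA T (arE i (T.ℓ i - 1)))) • q i :
        LinearMap.ker f) : P) = op (D.r i • mkA T (wE i)) • p := by
      intro i _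
      by_cases hi : D.r i = 0
      · rw [hi, zero_smul, zero_smul, zero_smul, op_zero, zero_smul]
        rfl
      · have := D.two_le hi
        rw [Submodule.coe_smul, hq i hi, smul_smul, ← op_smul, ← op_mul, mul_smul_comm, ← map_mul,
          ← subE_snoc _ _ _ (Nat.zero_le _), wE, Nat.sub_add_cancel (T.hℓ i)]
    rw [Finset.sum_congr rfl h1, ← Finset.sum_smul, ← Finset.op_sum, (mem_relSp T).1 D.hr.1,
      op_zero, zero_smul])
  obtain ⟨i, hi⟩ := D.exists_r_ne
  have h1 : p - (ω : P) = 0 := by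
    refine D.eq_zero_of_projective hi ?_ ?_
    · rw [smul_sub, hep, ← Submodule.coe_smul, hω]
    · rw [smul_sub, ← hq i hi, hqω i hi, Submodule.coe_smul, sub_self]
  apply hm
  rw [← hfp, sub_eq_zero.1 h1]
  exact ω.2

/-- Extension of homomorphisms into an injective module along a possibly non-injective map. -/
lemma exists_extension {R : Type u} [Ring R] {M N Q : Type u} [AddCommGroup M] [AddCommGroup N]
    [AddCommGroup Q] [Module R M] [Module R N] [Module R Q] (hQ : Module.Injective R Q)
    (h : M →ₗ[R] N) (g : M →ₗ[R] Q) (hk : ∀ m, h m = 0 → g m = 0) :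
    ∃ e : N →ₗ[R] Q, ∀ m, e (h m) = g m := by
  obtain ⟨e, he⟩ := hQ.out ((LinearMap.ker h).liftQ h le_rfl)
    (LinearMap.ker_eq_bot.1 (Submodule.ker_liftQ_eq_bot _ _ _ le_rfl))
    ((LinearMap.ker h).liftQ g fun m hm => hk m hm)
  exact ⟨e, fun m => he (Submodule.Quotient.mk m)⟩

lemma smul_op_eq (c : k) (a : Alg T) : op (c • a) = op (c • 1) * op a := by
  rw [← op_mul, mul_smul_comm, mul_one]

/-- A criterion for injective dimension at least two. -/
lemma not_idLeOne {X : ModuleCat.{u} (Alg T)ᵐᵒᵖ} {x : X} (hx : x ≠ 0)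
    (h0 : op (einf T) • x = x)
    (h : ∀ i, D.r i ≠ 0 → ∀ y : X, op (mkA T (eV (vtx T.t T.ℓ i 1))) • y = 0) :
    ¬ IdLeOne _ X := by
  rintro ⟨E, f, hf, hE, hE'⟩
  obtain ⟨i₀, hi₀⟩ := D.exists_r_ne
  have h2 := D.two_le hi₀
  set w := mkA T (subE i₀ 1 (T.ℓ i₀)) with hw
  obtain ⟨φ, hφ⟩ := exists_extension hE (LinearMap.toSpanSingleton (Alg T)ᵐᵒᵖ (Alg T)ᵐᵒᵖ (op w))
    (f.comp (LinearMap.toSpanSingleton (Alg T)ᵐᵒᵖ X x)) (by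
      intro b hb
      rw [LinearMap.toSpanSingleton_apply, smul_eq_mul] at hb
      have h3 : w * b.unop = 0 := by
        have := congrArg unop hb
        simpa using this
      have h4 := einf_mul_eq_zero T D.hnb i₀ h2 _ h3
      rw [LinearMap.comp_apply, LinearMap.toSpanSingleton_apply, ← h0, smul_smul]
      have h5 : b * op (einf T) = 0 := by rw [← op_unop b, ← op_mul, h4, op_zero]
      rw [h5, zero_smul, map_zero])
  set ev := mkA T (eV (vtx T.t T.ℓ i₀ 1)) with hev
  have hew : ev * w = w := by rw [hev, hw, ← map_mul, e_mul_sub _ _ _ (by omega) le_rfl]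
  have hee : ev * ev = ev := by
    rw [hev, ← map_mul, (pathRel_gens k T.t T.ℓ).orth, if_pos rfl]
  have hφ1 : op w • φ 1 = f x := by
    have := hφ 1
    rw [LinearMap.toSpanSingleton_apply, LinearMap.comp_apply, LinearMap.toSpanSingleton_apply,
      one_smul, one_smul] at this
    rw [← map_smul, smul_eq_mul, mul_one, this]
  set e := op ev • φ 1 with he
  have hwe : op w • e = f x := by rw [he, smul_smul, ← op_mul, hew, hφ1]
  have hevE : op ev • e = e := by rw [he, smul_smul, ← op_mul, hee]
  set π := (LinearMap.range f).mkQ with hπ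
  have hπf : ∀ y, π (f y) = 0 := fun y =>
    (Submodule.Quotient.mk_eq_zero _).2 (LinearMap.mem_range_self f y)
  let H : (Fin T.t → (Alg T)ᵐᵒᵖ) →ₗ[(Alg T)ᵐᵒᵖ] (Alg T)ᵐᵒᵖ :=
    ∑ i, (LinearMap.proj i).smulRight (op (mkA T (arE i 0)))
  have hH : ∀ a, H a = ∑ i, a i * op (mkA T (arE i 0)) := fun a => by
    simp [H, LinearMap.sum_apply]
  obtain ⟨φ₂, hφ₂⟩ := exists_extension hE' H ((LinearMap.proj i₀).smulRight (π e)) (by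
    intro a ha
    rw [hH] at ha
    have h3 := congrArg unop ha
    simp only [Finset.unop_sum, unop_mul, unop_op, unop_zero] at h3
    obtain ⟨c, hc⟩ := exists_smul_of_sum_arr_mul T D.hnb i₀ h2 (fun i => (a i).unop) h3
    rw [LinearMap.smulRight_apply, LinearMap.proj_apply, ← hevE, map_smul, smul_smul,
      ← op_unop (a i₀), ← op_mul, hc, smul_op_eq, mul_smul, ← map_smul, ← hw, hwe, hπf, smul_zero])
  have hHs : ∀ i, H (Pi.single i 1) = op (mkA T (arE i 0)) := by
    intro i
    rw [hH, Finset.sum_eq_single i]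
    · rw [Pi.single_eq_same, one_mul]
    · intro j _ hj
      rw [Pi.single_eq_of_ne hj, zero_mul]
    · simp
  obtain ⟨z, hz⟩ := Submodule.mkQ_surjective _ (φ₂ 1)
  have hπz : ∀ i, π (op (mkA T (arE i 0)) • z) = if i = i₀ then π e else 0 := by
    intro i
    have h3 := hφ₂ (Pi.single i 1)
    rw [hHs, LinearMap.smulRight_apply, LinearMap.proj_apply, Pi.single_apply] at h3
    rw [map_smul, hπ, hz, ← map_smul, smul_eq_mul, mul_one, h3]
    by_cases hi : i = i₀
    · rw [if_pos hi.symm, if_pos hi, one_smul]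
    · rw [if_neg (Ne.symm hi), if_neg hi, zero_smul]
  have hrange : ∀ i, D.r i ≠ 0 → ∀ y : E, op (mkA T (eV (vtx T.t T.ℓ i 1))) • y = y →
      π y = 0 → y = 0 := by
    intro i hi y hy hy'
    obtain ⟨y', rfl⟩ := (Submodule.Quotient.mk_eq_zero _).1 hy'
    rw [← hy, ← map_smul, h i hi, map_zero]
  have har : ∀ i, op (mkA T (eV (vtx T.t T.ℓ i 1))) • op (mkA T (arE i 0)) • z =
      op (mkA T (arE i 0)) • z := fun i => by
    rw [smul_smul, ← op_mul, ← map_mul, (pathRel_gens k T.t T.ℓ).right]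
  have hz₀ : op (mkA T (arE i₀ 0)) • z = e := by
    rw [← sub_eq_zero]
    refine hrange i₀ hi₀ _ ?_ ?_
    · rw [smul_sub, har, ← hev, hevE]
    · rw [map_sub, hπz, if_pos rfl, sub_self]
  have hzi : ∀ i, D.r i ≠ 0 → i ≠ i₀ → op (mkA T (arE i 0)) • z = 0 := fun i hi hne =>
    hrange i hi _ (har i) (by rw [hπz, if_neg hne])
  have hrel := (mem_relSp T).1 D.hr.1
  have h5 : op (∑ i, D.r i • mkA T (wE i)) • z = op (D.r i₀ • 1 : Alg T) • f x := by
    rw [Finset.op_sum, Finset.sum_smul, Finset.sum_eq_single i₀]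
    · rw [smul_op_eq, mul_smul, wE, subE_cons _ _ _ (T.hℓ i₀), map_mul, op_mul, mul_smul, hz₀]
      exact congrArg _ hwe
    · intro i _ hi
      by_cases hr : D.r i = 0
      · rw [hr, zero_smul, op_zero, zero_smul]
      · rw [smul_op_eq, mul_smul, wE, subE_cons _ _ _ (T.hℓ i), map_mul, op_mul, mul_smul,
          hzi i hr hi, smul_zero, smul_zero]
    · simp
  rw [hrel, op_zero, zero_smul] at h5
  have h6 : op ((D.r i₀)⁻¹ • 1 : Alg T) • op (D.r i₀ • 1 : Alg T) • f x = f x := by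
    rw [smul_smul, ← smul_op_eq, smul_smul, inv_mul_cancel₀ hi₀, one_smul, op_one, one_smul]
  rw [← h5, smul_zero] at h6
  exact hx (hf (h6.symm.trans (map_zero f).symm))

lemma not_pdLeOne_mod (n : ℕ) : ¬ PdLeOne _ (D.mod n) := by
  obtain ⟨m, h1, h2, h3⟩ := D.exists_mod_src n
  exact D.not_pdLeOne h1 h2 h3

lemma not_idLeOne_mod : ¬ IdLeOne _ (D.mod 0) := by
  obtain ⟨m, h1, h2, h3⟩ := D.exists_mod_snk
  exact D.not_idLeOne h1 h2 h3

lemma not_pdLeOne_Z : ¬ PdLeOne _ D.Z := by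
  obtain ⟨m, h1, _, h2, h3⟩ := D.exists_Z_src
  exact D.not_pdLeOne h1 h2 h3

lemma not_inLeftPart_mod (n : ℕ) : ¬ InLeftPart _ (D.mod n) := fun h =>
  D.not_pdLeOne_mod n (h.2.2 _ (D.indec_mod n) (D.fd_mod n) .refl)

lemma not_inRightPart_mod (n : ℕ) : ¬ InRightPart _ (D.mod n) := by
  intro h
  refine D.not_idLeOne_mod (h.2.2 _ (D.indec_mod 0) (D.fd_mod 0) ?_)
  rcases Nat.eq_zero_or_pos n with rfl | hn
  · exact .refl
  · exact .single (D.step_from n hn)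

lemma not_laura (D : Dat T) : ¬ Laura (Alg T)ᵐᵒᵖ := by
  rintro ⟨S, hS, h⟩
  choose F hF hF' using fun n => h (D.mod n) (D.indec_mod n) (D.fd_mod n)
    (D.not_inLeftPart_mod n) (D.not_inRightPart_mod n)
  have : Finite S := hS
  obtain ⟨n, m, hnm, heq⟩ := Finite.exists_ne_map_eq_of_infinite (fun n => (⟨F n, hF n⟩ : S))
  have heq' : F n = F m := congrArg Subtype.val heq
  obtain ⟨e₁⟩ := hF' n
  obtain ⟨e₂⟩ := hF' m
  rw [heq'] at e₁
  exact hnm (le_antisymm (D.eq_of_equiv n (e₁.trans e₂.symm)) (D.eq_of_equiv m (e₂.trans e₁.symm)))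

lemma not_weaklyShod (D : Dat T) : ¬ WeaklyShod (Alg T)ᵐᵒᵖ := fun h =>
  h (D.mod 0) (D.indec_mod 0) (D.fd_mod 0) (D.not_inLeftPart_mod 0) (D.not_inRightPart_mod 0)
    (.tail (.single (D.step_to 1 le_rfl)) (D.step_from 1 le_rfl))

end Dat

end Dimension

end Toupie

namespace Toupie

section NoRelations

variable {k : Type u} [Field k] (T : ToupieAlg k)

section

variable {N : Type*} [AddCommGroup N] [Module (Alg T)ᵐᵒᵖ N]

lemma eV_smul_eV_smul (v w : Vtx T.t T.ℓ) (m : N) :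
    op (mkA T (eV v)) • op (mkA T (eV w)) • m = if w = v then op (mkA T (eV v)) • m else 0 := by
  rw [smul_smul, ← op_mul, ← map_mul, (pathRel_gens k T.t T.ℓ).orth]
  split_ifs with h
  · rw [h]
  · rw [map_zero, op_zero, zero_smul]

lemma sum_eV_smul (m : N) : ∑ v, op (mkA T (eV v)) • m = m := by
  rw [← Finset.sum_smul, ← Finset.op_sum, ← map_sum, (pathRel_gens k T.t T.ℓ).sum, map_one,
    op_one, one_smul]

lemma arE_smul_eV_smul (i : Fin T.t) (j : ℕ) (m : N) :
    op (mkA T (arE i j)) • op (mkA T (eV (vtx T.t T.ℓ i j))) • m = op (mkA T (arE i j)) • m := by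
  rw [smul_smul, ← op_mul, ← map_mul, (pathRel_gens k T.t T.ℓ).left]

lemma eV_smul_arE_smul (i : Fin T.t) (j : ℕ) (m : N) :
    op (mkA T (eV (vtx T.t T.ℓ i (j + 1)))) • op (mkA T (arE i j)) • m =
      op (mkA T (arE i j)) • m := by
  rw [smul_smul, ← op_mul, ← map_mul, (pathRel_gens k T.t T.ℓ).right]

lemma arE_smul_of_le (i : Fin T.t) (j : ℕ) (h : T.ℓ i ≤ j) (m : N) :
    op (mkA T (arE i j)) • m = 0 := by
  rw [(pathRel_gens k T.t T.ℓ).out i j h, map_zero, op_zero, zero_smul]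

end

section

variable {P N Y : Type*} [AddCommGroup P] [AddCommGroup N] [AddCommGroup Y]
  [Module k P] [Module k N] [Module k Y] [Module (Alg T)ᵐᵒᵖ P] [Module (Alg T)ᵐᵒᵖ N]
  [Module (Alg T)ᵐᵒᵖ Y] [IsScalarTower k (Alg T)ᵐᵒᵖ P] [IsScalarTower k (Alg T)ᵐᵒᵖ N]
  [IsScalarTower k (Alg T)ᵐᵒᵖ Y]

/-- A linear section of a surjective homomorphism may be chosen to preserve the decomposition
along the vertices. -/
lemma exists_graded_section (f : P →ₗ[(Alg T)ᵐᵒᵖ] N) (hf : Function.Surjective f) :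
    ∃ s : N →ₗ[k] P, (∀ n, f (s n) = n) ∧
      ∀ v n, s (op (mkA T (eV v)) • n) = op (mkA T (eV v)) • s n := by
  obtain ⟨s, hs⟩ := (f.restrictScalars k).exists_rightInverse_of_surjective
    (LinearMap.range_eq_top.2 hf)
  have hs' : ∀ n, f (s n) = n := fun n => LinearMap.congr_fun hs n
  let e (v : Vtx T.t T.ℓ) : (Alg T)ᵐᵒᵖ := op (mkA T (eV v))
  let s' : N →ₗ[k] P := ∑ v, (Algebra.lsmul k k P (e v)).comp (s.comp (Algebra.lsmul k k N (e v)))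
  have hs'a : ∀ n, s' n = ∑ v, op (mkA T (eV v)) • s (op (mkA T (eV v)) • n) := fun n => by
    simp only [s', LinearMap.sum_apply]
    rfl
  refine ⟨s', fun n => ?_, fun v n => ?_⟩
  · rw [hs'a, map_sum]
    simp only [map_smul, hs', eV_smul_eV_smul, if_true]
    exact sum_eV_smul T n
  · rw [hs'a, hs'a, Finset.smul_sum]
    refine Finset.sum_congr rfl fun w _ => ?_
    rw [eV_smul_eV_smul, eV_smul_eV_smul]
    by_cases h : w = v
    · rw [if_pos h, if_pos h.symm, h]
    · rw [if_neg h, if_neg (Ne.symm h), map_zero, smul_zero]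

/-- Without relations, kernels of projective covers satisfy the lifting property. -/
lemma exists_section_of_bot (hI : T.I = ⊥) [Module.Projective (Alg T)ᵐᵒᵖ P]
    (f : P →ₗ[(Alg T)ᵐᵒᵖ] N) (hf : Function.Surjective f)
    (g : Y →ₗ[(Alg T)ᵐᵒᵖ] LinearMap.ker f) (hg : Function.Surjective g) :
    ∃ h : LinearMap.ker f →ₗ[(Alg T)ᵐᵒᵖ] Y, g.comp h = LinearMap.id := by
  obtain ⟨s, hs, hse⟩ := exists_graded_section T f hf
  obtain ⟨σ, hσ⟩ := (g.restrictScalars k).exists_rightInverse_of_surjective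
    (LinearMap.range_eq_top.2 hg)
  have hσ' : ∀ n, g (σ n) = n := fun n => LinearMap.congr_fun hσ n
  let e (v : Vtx T.t T.ℓ) : (Alg T)ᵐᵒᵖ := op (mkA T (eV v))
  let α (i : Fin T.t) (j : ℕ) : (Alg T)ᵐᵒᵖ := op (mkA T (arE i j))
  let δ (i : Fin T.t) (j : ℕ) : N →ₗ[k] LinearMap.ker f :=
    ((Algebra.lsmul k k P (α i j)).comp s - s.comp (Algebra.lsmul k k N (α i j))).codRestrict
      ((LinearMap.ker f).restrictScalars k) (fun n => by
        change f (α i j • s n - s (α i j • n)) = 0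
        rw [map_sub, map_smul, hs, hs, sub_self])
  have hδ : ∀ i j n, ((δ i j n : LinearMap.ker f) : P) = α i j • s n - s (α i j • n) :=
    fun i j n => rfl
  let τ (i : Fin T.t) (j : ℕ) : N →ₗ[k] Y :=
    (Algebra.lsmul k k Y (e (vtx T.t T.ℓ i (j + 1)))).comp (σ.comp (δ i j))
  have hτ : ∀ i j n, τ i j n = e (vtx T.t T.ℓ i (j + 1)) • σ (δ i j n) := fun i j n => rfl
  have hgτ : ∀ i j n, ((g (τ i j n) : LinearMap.ker f) : P) = α i j • s n - s (α i j • n) := by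
    intro i j n
    rw [hτ, map_smul, hσ', Submodule.coe_smul, hδ, smul_sub, ← hse, eV_smul_arE_smul,
      eV_smul_arE_smul]
  have hτe : ∀ i j n, τ i j (e (vtx T.t T.ℓ i j) • n) = τ i j n := by
    intro i j n
    rw [hτ, hτ]
    congr 2
    apply Subtype.ext
    rw [hδ, hδ, hse, arE_smul_eV_smul, arE_smul_eV_smul]
  have heτ : ∀ i j n, e (vtx T.t T.ℓ i (j + 1)) • τ i j n = τ i j n := by
    intro i j n
    rw [hτ, eV_smul_eV_smul, if_pos rfl]
  let ε (v : Vtx T.t T.ℓ) : Module.End k (Y × N) :=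
    (Algebra.lsmul k k Y (e v)).prodMap (Algebra.lsmul k k N (e v))
  let β (i : Fin T.t) (j : ℕ) : Module.End k (Y × N) :=
    ((Algebra.lsmul k k Y (α i j)).coprod (τ i j)).prod
      ((Algebra.lsmul k k N (α i j)).comp (LinearMap.snd k Y N))
  have hε : ∀ v x, ε v x = (e v • x.1, e v • x.2) := fun v x => rfl
  have hβ : ∀ i j x, β i j x = (α i j • x.1 + τ i j x.2, α i j • x.2) := fun i j x => rfl
  have H : PathRel (k := k) (fun v => op (ε v)) (fun i j => op (β i j)) :=
    { orth := by
        intro v w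
        rw [← op_mul]
        by_cases h : v = w
        · rw [if_pos h]
          congr 1
          refine LinearMap.ext fun x => ?_
          rw [← h, Module.End.mul_apply, hε, hε, eV_smul_eV_smul, eV_smul_eV_smul, if_pos rfl,
            if_pos rfl]
        · rw [if_neg h, ← op_zero]
          congr 1
          refine LinearMap.ext fun x => ?_
          rw [Module.End.mul_apply, hε, hε, eV_smul_eV_smul, eV_smul_eV_smul, if_neg h,
            if_neg h]
          rfl
      sum := by
        rw [← Finset.op_sum, ← op_one]
        congr 1
        refine LinearMap.ext fun x => ?_
        rw [LinearMap.sum_apply, Finset.sum_congr rfl fun v _ => hε v x]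
        refine Prod.ext ?_ ?_
        · rw [Prod.fst_sum]
          exact sum_eV_smul T x.1
        · rw [Prod.snd_sum]
          exact sum_eV_smul T x.2
      left := by
        intro i j
        rw [← op_mul]
        congr 1
        refine LinearMap.ext fun x => ?_
        rw [Module.End.mul_apply, hβ, hβ, hε, arE_smul_eV_smul, arE_smul_eV_smul, hτe]
      right := by
        intro i j
        rw [← op_mul]
        congr 1
        refine LinearMap.ext fun x => ?_
        rw [Module.End.mul_apply, hβ, hε, smul_add, eV_smul_arE_smul, eV_smul_arE_smul, heτ]
      out := by
        intro i j h
        rw [← op_zero]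
        congr 1
        refine LinearMap.ext fun x => ?_
        have h1 : δ i j x.2 = 0 := by
          apply Subtype.ext
          rw [hδ, arE_smul_of_le T i j h, arE_smul_of_le T i j h, map_zero, sub_zero]
          rfl
        rw [hβ, arE_smul_of_le T i j h, arE_smul_of_le T i j h, hτ, h1, map_zero, smul_zero,
          add_zero]
        rfl }
  obtain ⟨φ, hφe, hφa⟩ := H.exists_algHom
  obtain ⟨ψ, hψ⟩ := exists_algHom_alg T φ (by
    intro z hz
    rw [hI] at hz
    rw [(TwoSidedIdeal.mem_bot _).1 hz, map_zero])
  have hse' : ∀ v (x : RepMod ψ), op (mkA T (eV v)) • x = ε v x := fun v x => by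
    rw [RepMod.smul_def, unop_op, hψ, hφe, unop_op]
  have hsa : ∀ i j (x : RepMod ψ), op (mkA T (arE i j)) • x = β i j x := fun i j x => by
    rw [RepMod.smul_def, unop_op, hψ, hφa, unop_op]
  let γ : RepMod ψ →ₗ[k] P :=
    LinearMap.coprod ((LinearMap.ker f).subtype.restrictScalars k ∘ₗ g.restrictScalars k) s
  have hγ : ∀ x : Y × N, γ x = (g x.1 : P) + s x.2 := fun x => rfl
  have hγε : ∀ v (x : Y × N), γ (ε v x) = e v • γ x := by
    intro v x
    rw [hγ, hγ, hε, hse, map_smul, smul_add]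
    rfl
  have hγβ : ∀ i j (x : Y × N), γ (β i j x) = α i j • γ x := by
    intro i j x
    rw [hγ, hγ, hβ, map_add, map_smul, smul_add, Submodule.coe_add, hgτ, Submodule.coe_smul]
    abel
  let G : RepMod ψ →ₗ[(Alg T)ᵐᵒᵖ] P := homOfGens T γ
    (fun v x => (congrArg γ (hse' v x)).trans (hγε v x))
    (fun i j _ x => (congrArg γ (hsa i j x)).trans (hγβ i j x))
  have hG : ∀ x : Y × N, G x = (g x.1 : P) + s x.2 := hγ
  have hGs : Function.Surjective G := by
    intro p
    have h1 : p - s (f p) ∈ LinearMap.ker f := by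
      rw [LinearMap.mem_ker, map_sub, hs, sub_self]
    obtain ⟨y, hy⟩ := hg ⟨_, h1⟩
    refine ⟨((y, f p) : Y × N), ?_⟩
    rw [hG, hy]
    exact sub_add_cancel _ _
  obtain ⟨θ, hθ⟩ := Module.projective_lifting_property G LinearMap.id hGs
  have hθ' : ∀ p, G (θ p) = p := fun p => LinearMap.congr_fun hθ p
  let ι₀ : Y →ₗ[k] RepMod ψ := LinearMap.inl k Y N
  have hι₀ : ∀ y, ι₀ y = ((y, 0) : Y × N) := fun y => rfl
  let ι : Y →ₗ[(Alg T)ᵐᵒᵖ] RepMod ψ := homOfGens T ι₀ (by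
    intro v y
    rw [hse', hι₀, hι₀, hε, smul_zero]) (by
    intro i j _ y
    rw [hsa, hι₀, hι₀, hβ, smul_zero, map_zero, add_zero])
  have hι : ∀ y, ι y = ((y, 0) : Y × N) := hι₀
  have hιi : Function.Injective ι := fun x y h => congrArg (fun z : Y × N => z.1) h
  have hmem : ∀ ω : LinearMap.ker f, θ ω ∈ LinearMap.range ι := by
    intro ω
    let z : Y × N := θ ω
    have h1 : f ((g z.1 : P) + s z.2) = f ω := congrArg f ((hG z).symm.trans (hθ' ω))
    rw [map_add, hs, ω.2, LinearMap.mem_ker.1 (g _).2, zero_add] at h1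
    exact ⟨z.1, (hι z.1).trans (Prod.ext rfl h1.symm)⟩
  let h : LinearMap.ker f →ₗ[(Alg T)ᵐᵒᵖ] Y := (LinearEquiv.ofInjective ι hιi).symm.toLinearMap.comp
    ((θ.comp (LinearMap.ker f).subtype).codRestrict (LinearMap.range ι) hmem)
  have hh : ∀ ω, ι (h ω) = θ ω := fun ω => congrArg Subtype.val
    ((LinearEquiv.ofInjective ι hιi).apply_symm_apply ⟨θ ω, hmem ω⟩)
  refine ⟨h, LinearMap.ext fun ω => Subtype.ext ?_⟩
  have h2 := congrArg G (hh ω)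
  rw [hθ', hι, hG, map_zero, add_zero] at h2
  exact h2

end

/-- A toupie algebra without relations is hereditary. -/
lemma hereditary_of_eq_bot (hI : T.I = ⊥) : Hereditary (Alg T)ᵐᵒᵖ := by
  intro N
  let : Module k N := Module.compHom N (algebraMap k (Alg T)ᵐᵒᵖ)
  have : IsScalarTower k (Alg T)ᵐᵒᵖ N := ⟨fun c r n => by
    rw [Algebra.smul_def, mul_smul]
    rfl⟩
  refine ⟨ModuleCat.of _ (N →₀ (Alg T)ᵐᵒᵖ), Finsupp.linearCombination _ id,
    Finsupp.linearCombination_id_surjective _ _, inferInstanceAs (Module.Projective _ (N →₀ _)), ?_⟩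
  exact Module.Projective.of_lifting_property'' fun g hg =>
    exists_section_of_bot T hI (P := N →₀ (Alg T)ᵐᵒᵖ) _
      (Finsupp.linearCombination_id_surjective _ _) g hg

end NoRelations

end Toupie

namespace Toupie

section Splitting

variable {S : Type u} [Ring S]

lemma exists_factor {M N K : Type*} [AddCommGroup M] [AddCommGroup N] [AddCommGroup K]
    [Module S M] [Module S N] [Module S K] {ι : M →ₗ[S] N} (hι : Function.Injective ι)
    (f : K →ₗ[S] N) (h : ∀ x, ∃ m, ι m = f x) : ∃ g : K →ₗ[S] M, ∀ x, ι (g x) = f x :=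
  ⟨(LinearEquiv.ofInjective ι hι).symm.toLinearMap.comp (f.codRestrict (LinearMap.range ι) h),
    fun x => congrArg Subtype.val ((LinearEquiv.ofInjective ι hι).apply_symm_apply ⟨f x, h x⟩)⟩

lemma exists_cofactor {M N K : Type*} [AddCommGroup M] [AddCommGroup N] [AddCommGroup K]
    [Module S M] [Module S N] [Module S K] {π : M →ₗ[S] N} (hπ : Function.Surjective π)
    (f : M →ₗ[S] K) (h : ∀ x, π x = 0 → f x = 0) : ∃ g : N →ₗ[S] K, ∀ x, g (π x) = f x := by
  refine ⟨((LinearMap.ker π).liftQ f h).comp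
    (π.quotKerEquivOfSurjective hπ).symm.toLinearMap, fun x => ?_⟩
  have : (π.quotKerEquivOfSurjective hπ).symm (π x) = Submodule.Quotient.mk x := by
    rw [LinearEquiv.symm_apply_eq]
    rfl
  rw [LinearMap.comp_apply, LinearEquiv.coe_coe, this]
  exact Submodule.liftQ_apply _ _ _

variable (S) in
/-- Every extension of `Z` by `X` splits. -/
def ExtVanish (Z X : Type u) [AddCommGroup Z] [AddCommGroup X] [Module S Z] [Module S X] : Prop :=
  ∀ (E : Type u) [AddCommGroup E] [Module S E] (ι : X →ₗ[S] E) (π : E →ₗ[S] Z),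
    Function.Injective ι → Function.Surjective π → (∀ x, π (ι x) = 0) →
      (∀ e, π e = 0 → ∃ x, ι x = e) → ∃ s : Z →ₗ[S] E, ∀ z, π (s z) = z

variable {X Z : Type u} [AddCommGroup Z] [AddCommGroup X] [Module S Z] [Module S X]

lemma SelfExtVanish.extVanish (h : SelfExtVanish S X) : ExtVanish S X X := by
  intro E _ _ ι π hι hπ h1 h2
  obtain ⟨s, hs⟩ := h E ι π hι hπ (by
    ext e
    exact ⟨fun ⟨x, hx⟩ => hx ▸ h1 x, fun he => h2 e he⟩)
  exact ⟨s, fun z => LinearMap.congr_fun hs z⟩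

lemma ExtVanish.exists_retraction (h : ExtVanish S Z X) {E : Type u} [AddCommGroup E] [Module S E]
    {ι : X →ₗ[S] E} {π : E →ₗ[S] Z} (hι : Function.Injective ι) (hπ : Function.Surjective π)
    (h1 : ∀ x, π (ι x) = 0) (h2 : ∀ e, π e = 0 → ∃ x, ι x = e) :
    ∃ r : E →ₗ[S] X, ∀ x, r (ι x) = x := by
  obtain ⟨s, hs⟩ := h E ι π hι hπ h1 h2
  obtain ⟨r, hr⟩ := exists_factor hι (LinearMap.id - s.comp π) (fun e => h2 _ (by
    rw [LinearMap.sub_apply, map_sub, LinearMap.comp_apply, hs, LinearMap.id_apply, sub_self]))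
  refine ⟨r, fun x => hι ?_⟩
  rw [hr, LinearMap.sub_apply, LinearMap.comp_apply, h1, map_zero, sub_zero, LinearMap.id_apply]

lemma ExtVanish.pi_right (h : ExtVanish S Z X) (m : ℕ) : ExtVanish S Z (Fin m → X) := by
  intro E _ _ ι π hι hπ h1 h2
  have key : ∀ j : Fin m, ∃ r : E →ₗ[S] X, ∀ x, r (ι x) = x j := by
    intro j
    let K : Submodule S E := (LinearMap.ker (LinearMap.proj j : (Fin m → X) →ₗ[S] X)).map ι
    have hK : ∀ x, ι x ∈ K ↔ x j = 0 := fun x => by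
      constructor
      · rintro ⟨y, hy, hxy⟩
        rw [← hι hxy]
        exact hy
      · exact fun hx => ⟨x, hx, rfl⟩
    have hle : K ≤ LinearMap.ker π := by
      rintro _ ⟨y, _, rfl⟩
      exact h1 y
    have hdiff : ∀ x, K.mkQ (ι (Pi.single j (x j))) = K.mkQ (ι x) := fun x => by
      rw [← sub_eq_zero, ← map_sub, ← map_sub]
      refine (Submodule.Quotient.mk_eq_zero _).2 ((hK _).2 ?_)
      rw [Pi.sub_apply, Pi.single_eq_same, sub_self]
    obtain ⟨r, hr⟩ := h.exists_retraction (E := E ⧸ K)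
      (ι := K.mkQ.comp (ι.comp (LinearMap.single S (fun _ => X) j))) (π := K.liftQ π hle) (by
        rw [← LinearMap.ker_eq_bot, LinearMap.ker_eq_bot']
        intro x hx
        have h3 := (hK _).1 ((Submodule.Quotient.mk_eq_zero K).1 hx)
        simpa using h3) (fun z => by
        obtain ⟨e, he⟩ := hπ z
        exact ⟨K.mkQ e, (Submodule.liftQ_apply _ _ _).trans he⟩)
      (fun x => (Submodule.liftQ_apply _ _ _).trans (h1 _)) (fun e he => by
        obtain ⟨e, rfl⟩ := K.mkQ_surjective e
        obtain ⟨x, rfl⟩ := h2 e ((Submodule.liftQ_apply _ _ _).symm.trans he)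
        exact ⟨x j, hdiff x⟩)
    refine ⟨r.comp K.mkQ, fun x => ?_⟩
    rw [LinearMap.comp_apply, ← hdiff]
    exact hr (x j)
  choose r hr using key
  obtain ⟨s, hs⟩ := exists_cofactor hπ (LinearMap.id - ι.comp (LinearMap.pi r)) (fun e he => by
    obtain ⟨x, rfl⟩ := h2 e he
    have : LinearMap.pi r (ι x) = x := funext fun j => hr j x
    rw [LinearMap.sub_apply, LinearMap.comp_apply, this, LinearMap.id_apply, sub_self])
  refine ⟨s, fun z => ?_⟩
  obtain ⟨e, rfl⟩ := hπ z
  rw [hs, LinearMap.sub_apply, map_sub, LinearMap.comp_apply, h1, sub_zero, LinearMap.id_apply]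

lemma ExtVanish.pi_left (h : ExtVanish S Z X) (n : ℕ) : ExtVanish S (Fin n → Z) X := by
  intro E _ _ ι π hι hπ h1 h2
  have key : ∀ j : Fin n, ∃ s : Z →ₗ[S] E, ∀ z, π (s z) = Pi.single j z := by
    intro j
    let F : Submodule S (E × Z) :=
      LinearMap.ker (π.coprod (-(LinearMap.single S (fun _ : Fin n => Z) j)))
    have hF : ∀ e, e ∈ F ↔ π e.1 = Pi.single j e.2 := fun e => by
      rw [LinearMap.mem_ker, LinearMap.coprod_apply, LinearMap.neg_apply, ← sub_eq_add_neg,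
        sub_eq_zero]
      rfl
    obtain ⟨s, hs⟩ := h F ((LinearMap.inl S E Z ∘ₗ ι).codRestrict F (fun x => (hF _).2 (by
        change π (ι x) = Pi.single j 0
        rw [h1, Pi.single_zero])))
      ((LinearMap.snd S E Z).comp F.subtype) (fun x y hxy => hι
        (congrArg (fun z : F => (z : E × Z).1) hxy)) (fun z => by
        obtain ⟨e, he⟩ := hπ (Pi.single j z)
        exact ⟨⟨(e, z), (hF _).2 he⟩, rfl⟩) (fun x => rfl) (fun e he => by
        have h3 := (hF _).1 e.2
        have h4 : (e : E × Z).2 = 0 := he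
        rw [h4, Pi.single_zero] at h3
        obtain ⟨x, hx⟩ := h2 _ h3
        exact ⟨x, Subtype.ext (Prod.ext hx h4.symm)⟩)
    refine ⟨(LinearMap.fst S E Z).comp (F.subtype.comp s), fun z => ?_⟩
    have h3 := (hF _).1 (s z).2
    rw [show ((s z : F) : E × Z).2 = z from hs z] at h3
    exact h3
  choose s hs using key
  refine ⟨∑ j, (s j).comp (LinearMap.proj j), fun z => ?_⟩
  rw [LinearMap.sum_apply, map_sum]
  simp only [LinearMap.comp_apply, hs, LinearMap.proj_apply]
  exact Finset.univ_sum_single z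

/-- Over a hereditary ring, a homomorphism `g : X → Z` factors through an injective homomorphism
`a : X → E` followed by a homomorphism `c : E → Z` which induces an isomorphism of cokernels. If
extensions of `Z` by `X` split, then so does the resulting one. -/
lemma exists_factorization (hS : Hereditary S) (h : ExtVanish S Z X) (g : X →ₗ[S] Z) :
    ∃ (E : Type u) (_ : AddCommGroup E) (_ : Module S E) (a : X →ₗ[S] E) (c : E →ₗ[S] Z)
      (σ : Z →ₗ[S] E) (τ : Z →ₗ[S] LinearMap.range g), Function.Injective a ∧
      (∀ x, c (a x) = g x) ∧ (∀ e, c e ∈ LinearMap.range g → ∃ x, a x = e) ∧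
      ∀ z, c (σ z) - τ z = z := by
  obtain ⟨P, p, hp, hP, hΩ⟩ := hS (ModuleCat.of S (Z ⧸ LinearMap.range g))
  obtain ⟨p', hp'⟩ := Module.projective_lifting_property (LinearMap.range g).mkQ p
    (Submodule.mkQ_surjective _)
  have hp'' : ∀ x, Submodule.Quotient.mk (p' x) = p x := fun x => LinearMap.congr_fun hp' x
  have hpΩ : ∀ x, p x = 0 ↔ p' x ∈ LinearMap.range g := fun x => by
    rw [← hp'']
    exact Submodule.Quotient.mk_eq_zero _
  obtain ⟨w, hw⟩ := Module.projective_lifting_property g.rangeRestrict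
    ((p'.comp (LinearMap.ker p).subtype).codRestrict (LinearMap.range g)
      fun x => (hpΩ _).1 x.2) g.surjective_rangeRestrict
  have hw' : ∀ x, g (w x) = p' x := fun x => congrArg Subtype.val (LinearMap.congr_fun hw x)
  let K : Submodule S (X × P) := LinearMap.range (w.prod (-(LinearMap.ker p).subtype))
  let c : ((X × P) ⧸ K) →ₗ[S] Z := K.liftQ (g.coprod p') (by
    rintro _ ⟨x, rfl⟩
    rw [LinearMap.mem_ker]
    simp [hw'])
  let a : X →ₗ[S] ((X × P) ⧸ K) := K.mkQ.comp (LinearMap.inl S X P)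
  have hc : ∀ x y, c (K.mkQ (x, y)) = g x + p' y := fun x y =>
    (Submodule.liftQ_apply _ _ _).trans rfl
  have hca : ∀ x, c (a x) = g x := fun x => by
    change c (K.mkQ (x, 0)) = _
    rw [hc, map_zero, add_zero]
  have ha : Function.Injective a := by
    rw [← LinearMap.ker_eq_bot, LinearMap.ker_eq_bot']
    intro x hx
    obtain ⟨y, hy⟩ := (Submodule.Quotient.mk_eq_zero K).1 hx
    have h1 : w y = x := congrArg Prod.fst hy
    have h2 : -(y : P) = 0 := congrArg Prod.snd hy
    have h3 : y = 0 := Subtype.ext (neg_eq_zero.1 h2)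
    rw [← h1, h3, map_zero]
  have hex : ∀ e, c e ∈ LinearMap.range g → ∃ x, a x = e := by
    intro e he
    obtain ⟨⟨x, y⟩, rfl⟩ := K.mkQ_surjective e
    rw [hc] at he
    have hy : y ∈ LinearMap.ker p := (hpΩ y).2
      ((Submodule.add_mem_iff_right _ (LinearMap.mem_range_self g x)).1 he)
    refine ⟨x + w ⟨y, hy⟩, ?_⟩
    rw [← sub_eq_zero]
    refine (Submodule.Quotient.mk_eq_zero K).2 ⟨⟨y, hy⟩, ?_⟩
    refine Prod.ext ?_ ?_
    · change w ⟨y, hy⟩ = x + w ⟨y, hy⟩ - x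
      rw [add_sub_cancel_left]
    · change -y = 0 - y
      rw [zero_sub]
  have hcs : Function.Surjective c := by
    intro z
    obtain ⟨y, hy⟩ := hp (Submodule.Quotient.mk z)
    rw [← hp'', Submodule.Quotient.eq'] at hy
    obtain ⟨x, hx⟩ := hy
    refine ⟨K.mkQ (x, y), ?_⟩
    rw [hc, hx]
    abel
  obtain ⟨s, hs⟩ := h (((X × P) ⧸ K) × LinearMap.range g) (a.prod g.rangeRestrict)
    (c.coprod (-(LinearMap.range g).subtype)) (fun x y hxy => ha (congrArg Prod.fst hxy))
    (fun z => by
      obtain ⟨e, rfl⟩ := hcs z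
      exact ⟨(e, 0), by simp⟩) (fun x => by simp [hca]) (fun e he => by
      rw [LinearMap.coprod_apply, LinearMap.neg_apply, ← sub_eq_add_neg, sub_eq_zero] at he
      obtain ⟨x, hx⟩ := hex e.1 (by rw [he]; exact e.2.2)
      refine ⟨x, Prod.ext hx (Subtype.ext ?_)⟩
      change g x = e.2
      rw [← hca, hx]
      exact he)
  refine ⟨_, inferInstance, inferInstance, a, c, (LinearMap.fst _ _ _).comp s,
    (LinearMap.snd _ _ _).comp s, ha, hca, hex, fun z => ?_⟩
  have h3 := hs z
  rwa [LinearMap.coprod_apply, LinearMap.neg_apply, ← sub_eq_add_neg] at h3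

end Splitting

end Toupie

namespace Toupie

section HomModules

lemma linearMap_sum_comp {R ι M N K : Type*} [Ring R] [AddCommGroup M] [AddCommGroup N]
    [AddCommGroup K] [Module R M] [Module R N] [Module R K] (s : Finset ι) (f : ι → N →ₗ[R] K)
    (g : M →ₗ[R] N) : (∑ i ∈ s, f i).comp g = ∑ i ∈ s, (f i).comp g :=
  LinearMap.ext fun x => by simp [LinearMap.sum_apply]

variable {A S T : Type u} [Ring A] [Ring S] [AddCommGroup T] [Module S T]

/-- The right module `Hom(T, M)` over a ring identified with the endomorphism ring of `T`. -/
def HomMod (_ : A ≃+* Module.End S T) (M : Type u) [AddCommGroup M] [Module S M] : Type u :=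
  T →ₗ[S] M

namespace HomMod

variable (φ : A ≃+* Module.End S T) {M M' : Type u} [AddCommGroup M] [Module S M]
  [AddCommGroup M'] [Module S M']

instance : AddCommGroup (HomMod φ M) := inferInstanceAs (AddCommGroup (T →ₗ[S] M))

instance : Module Aᵐᵒᵖ (HomMod φ M) where
  smul r f := LinearMap.comp (show T →ₗ[S] M from f) (φ r.unop)
  one_smul f := by
    change LinearMap.comp (show T →ₗ[S] M from f) (φ (unop 1)) = f
    rw [unop_one, map_one]
    rfl
  mul_smul r s f := by
    change LinearMap.comp (show T →ₗ[S] M from f) (φ (unop (r * s))) =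
      LinearMap.comp (LinearMap.comp (show T →ₗ[S] M from f) (φ s.unop)) (φ r.unop)
    rw [unop_mul, map_mul]
    rfl
  smul_zero r := LinearMap.zero_comp _
  smul_add r f g := LinearMap.add_comp _ _ _
  add_smul r s f := by
    change LinearMap.comp (show T →ₗ[S] M from f) (φ (unop (r + s))) = _
    rw [unop_add, map_add]
    exact LinearMap.comp_add _ _ _
  zero_smul f := by
    change LinearMap.comp (show T →ₗ[S] M from f) (φ (unop 0)) = _
    rw [unop_zero, map_zero]
    exact LinearMap.comp_zero _

lemma smul_def (r : Aᵐᵒᵖ) (f : T →ₗ[S] M) :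
    (r • (show HomMod φ M from f) : HomMod φ M) = f.comp (φ r.unop) := rfl

/-- Functoriality of `Hom(T, -)`. -/
def map (g : M →ₗ[S] M') : HomMod φ M →ₗ[Aᵐᵒᵖ] HomMod φ M' where
  toFun f := g.comp (show T →ₗ[S] M from f)
  map_add' _ _ := LinearMap.comp_add _ _ _
  map_smul' _ _ := rfl

/-- `Hom(T, Tⁿ)` is free. -/
def piEquiv (n : ℕ) : HomMod φ (Fin n → T) ≃ₗ[Aᵐᵒᵖ] (Fin n → Aᵐᵒᵖ) where
  toFun f j := op (φ.symm ((LinearMap.proj j).comp (show T →ₗ[S] (Fin n → T) from f)))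
  map_add' f g := by
    funext j
    change op (φ.symm ((LinearMap.proj j).comp ((show T →ₗ[S] (Fin n → T) from f) +
      (show T →ₗ[S] (Fin n → T) from g)))) = _
    rw [LinearMap.comp_add, map_add, op_add]
    rfl
  map_smul' r f := by
    funext j
    change op (φ.symm (((LinearMap.proj j).comp (show T →ₗ[S] (Fin n → T) from f)) * φ r.unop)) = _
    rw [map_mul, RingEquiv.symm_apply_apply, op_mul, op_unop]
    rfl
  invFun x := LinearMap.pi fun j => φ (x j).unop
  left_inv f := by
    refine LinearMap.ext fun t => funext fun j => ?_
    change φ (φ.symm _) t = _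
    rw [RingEquiv.apply_symm_apply]
    rfl
  right_inv x := by
    funext j
    change op (φ.symm (φ (x j).unop)) = x j
    rw [RingEquiv.symm_apply_apply, op_unop]

lemma projective_pi (n : ℕ) : Module.Projective Aᵐᵒᵖ (HomMod φ (Fin n → T)) :=
  Module.Projective.of_equiv (piEquiv φ n).symm

lemma sum_smul_eq {m : ℕ} (x : Fin m → HomMod φ M) (y : T →ₗ[S] (Fin m → T)) :
    (∑ j, op (φ.symm ((LinearMap.proj j).comp y)) • x j : HomMod φ M) =
      (∑ j, (show T →ₗ[S] M from x j).comp (LinearMap.proj j)).comp y := by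
  rw [linearMap_sum_comp]
  refine Finset.sum_congr rfl fun j _ => ?_
  change LinearMap.comp _ (φ (φ.symm _)) = _
  rw [RingEquiv.apply_symm_apply]
  rfl

/-- A submodule generated by finitely many elements is the image of some `Hom(T, Tᵐ)`. -/
lemma exists_range_map_eq {K : Submodule Aᵐᵒᵖ (HomMod φ M)} (hK : K.FG) :
    ∃ (m : ℕ) (g : (Fin m → T) →ₗ[S] M), LinearMap.range (map φ g) = K := by
  obtain ⟨m, x, rfl⟩ := Submodule.fg_iff_exists_fin_generating_family.1 hK
  refine ⟨m, ∑ j, (show T →ₗ[S] M from x j).comp (LinearMap.proj j), ?_⟩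
  ext z
  rw [Submodule.mem_span_range_iff_exists_fun]
  constructor
  · rintro ⟨y, rfl⟩
    exact ⟨_, sum_smul_eq φ x y⟩
  · rintro ⟨a, rfl⟩
    refine ⟨(piEquiv φ m).symm a, ?_⟩
    refine (sum_smul_eq φ x _).symm.trans (Finset.sum_congr rfl fun j _ => ?_)
    congr 1
    exact congrFun ((piEquiv φ m).apply_symm_apply a) j

/-- Homomorphisms `Hom(T, Tⁿ) → A` are induced by homomorphisms `Tⁿ → T`. -/
lemma exists_rep {n : ℕ} (F : HomMod φ (Fin n → T) →ₗ[Aᵐᵒᵖ] A) :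
    ∃ ρ : (Fin n → T) →ₗ[S] T, ∀ x : T →ₗ[S] (Fin n → T), φ (F x) = ρ.comp x := by
  let ι (j : Fin n) : HomMod φ (Fin n → T) := LinearMap.single S (fun _ => T) j
  refine ⟨∑ j, (φ (F (ι j))).comp (LinearMap.proj j), fun x => ?_⟩
  have h1 : (∑ j, op (φ.symm ((LinearMap.proj j).comp x)) • ι j : HomMod φ (Fin n → T)) = x := by
    rw [sum_smul_eq]
    refine LinearMap.ext fun t => ?_
    rw [LinearMap.comp_apply, LinearMap.sum_apply]
    exact Finset.univ_sum_single (x t)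
  have h2 := congrArg (fun z => φ (F z)) h1
  simp only [map_sum, map_smul] at h2
  rw [← h2, linearMap_sum_comp]
  refine Finset.sum_congr rfl fun j _ => ?_
  rw [op_smul_eq_mul, map_mul, RingEquiv.apply_symm_apply]
  rfl

end HomMod

lemma Indec.eq_bot_or_eq_bot {R : Type u} [Ring R] {M : ModuleCat.{u} R} (hM : Indec R M)
    {p q : Submodule R M} (h : IsCompl p q) : p = ⊥ ∨ q = ⊥ := by
  have h1 : ∀ x ∈ p, (p.projection q h) x = x := fun x hx => Submodule.projection_apply_left h ⟨x, hx⟩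
  rcases hM.2 (p.projection q h) (LinearMap.ext fun x => h1 _ (Submodule.projection_apply_mem h x)) with h2 | h2
  · left
    rw [eq_bot_iff]
    intro x hx
    rw [← h1 x hx, h2]
    exact Submodule.zero_mem _
  · right
    rw [eq_bot_iff]
    intro x hx
    have h3 : (p.projection q h) x = 0 := by
      rw [← LinearMap.mem_ker, Submodule.ker_projection h]
      exact hx
    rw [h2] at h3
    exact h3

open HomMod in
/-- Over an endomorphism ring of a module without self-extensions over a hereditary ring,
an indecomposable predecessor of the regular module has projective dimension at most one. -/
lemma pdLeOne_of_selfExtVanish [IsNoetherianRing Aᵐᵒᵖ] (hS : Hereditary S)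
    (hT : SelfExtVanish S T) (φ : A ≃+* Module.End S T) {N : ModuleCat.{u} Aᵐᵒᵖ}
    (hN : Indec _ N) (hfd : FdMod _ N) {q : N →ₗ[Aᵐᵒᵖ] A} (hq : q ≠ 0) : PdLeOne _ N := by
  have : Module.Finite Aᵐᵒᵖ N := hfd
  obtain ⟨n, π', hπ'⟩ := Module.Finite.exists_fin' Aᵐᵒᵖ N
  have hproj := projective_pi φ n
  let π := π'.comp (piEquiv φ n).toLinearMap
  have hπ : Function.Surjective π := hπ'.comp (piEquiv φ n).surjective
  have hnoeth : IsNoetherian Aᵐᵒᵖ (HomMod φ (Fin n → T)) :=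
    isNoetherian_of_linearEquiv (piEquiv φ n).symm
  obtain ⟨m, g, hg⟩ := exists_range_map_eq φ (IsNoetherian.noetherian (LinearMap.ker π))
  obtain ⟨E, _, _, a, c, σ, τ, ha, hca, hex, hστ⟩ :=
    exists_factorization hS ((hT.extVanish.pi_right m).pi_left n) g
  let d := (LinearMap.range g).subtype
  let U := LinearMap.range (map φ d)
  let W := LinearMap.range (map φ c)
  have hUW : U ⊓ W = LinearMap.ker π := by
    rw [← hg]
    refine le_antisymm ?_ ?_
    · rintro _ ⟨⟨u, rfl⟩, w, hw⟩
      obtain ⟨y, hy⟩ := exists_factor ha (show T →ₗ[S] E from w) (fun t => hex _ (by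
        rw [show c (_) = _ from LinearMap.congr_fun hw t]
        exact ((show T →ₗ[S] LinearMap.range g from u) t).2))
      refine ⟨y, ?_⟩
      rw [← hw]
      refine LinearMap.ext fun t => ?_
      refine (hca (y t)).symm.trans ?_
      rw [hy]
      rfl
    · rintro _ ⟨y, rfl⟩
      refine ⟨⟨map φ g.rangeRestrict y, rfl⟩, ⟨map φ a y, ?_⟩⟩
      exact LinearMap.ext fun t => hca _
  have hUWt : U ⊔ W = ⊤ := by
    rw [eq_top_iff]
    intro x _
    rw [Submodule.mem_sup]
    refine ⟨_, ⟨-map φ τ x, rfl⟩, _, ⟨map φ σ x, rfl⟩, ?_⟩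
    refine LinearMap.ext fun t => ?_
    refine Eq.trans ?_ (hστ ((show T →ₗ[S] (Fin n → T) from x) t))
    rw [sub_eq_add_neg, add_comm]
    rfl
  have hcompl : IsCompl (U.map π) (W.map π) := by
    constructor
    · rw [Submodule.disjoint_def]
      rintro _ ⟨u, hu, rfl⟩ ⟨w, hw, hwu⟩
      have h1 : w - u ∈ U ⊓ W := by
        rw [hUW, LinearMap.mem_ker, map_sub, hwu, sub_self]
      have h2 : u ∈ U ⊓ W := ⟨hu, (Submodule.sub_mem_iff_right _ hw).1 h1.2⟩
      rw [hUW] at h2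
      exact h2
    · rw [codisjoint_iff, ← Submodule.map_sup, hUWt, Submodule.map_top, LinearMap.range_eq_top]
      exact hπ
  rcases hN.eq_bot_or_eq_bot hcompl with h | h
  · have hU : LinearMap.ker π = U := by
      refine le_antisymm (hUW ▸ inf_le_left) fun u hu => ?_
      have h1 : π u ∈ U.map π := ⟨u, hu, rfl⟩
      rw [h] at h1
      exact h1
    have hd : Function.Injective (map φ d) := by
      intro f f' hff
      exact LinearMap.ext fun t => Subtype.ext (LinearMap.congr_fun hff t)
    obtain ⟨r, hr⟩ := exists_factor ha (σ.comp d) (fun l => hex _ (by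
      have h1 := hστ (d l)
      rw [sub_eq_iff_eq_add] at h1
      rw [LinearMap.comp_apply, h1]
      exact Submodule.add_mem _ l.2 (τ _).2))
    have hrd : ∀ l, g.rangeRestrict (r l) - τ (d l) = l := by
      intro l
      apply Subtype.ext
      have h1 := hστ (d l)
      rw [← LinearMap.comp_apply σ, ← hr, hca] at h1
      exact h1
    have hp1 := projective_pi φ m
    have hprojL : Module.Projective Aᵐᵒᵖ (HomMod φ (LinearMap.range g)) :=
      Module.Projective.of_split ((map φ r).prod (map φ d))
        ((map φ g.rangeRestrict).coprod (-(map φ τ))) (by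
          refine LinearMap.ext fun f => LinearMap.ext fun t => ?_
          refine Eq.trans ?_ (hrd ((show T →ₗ[S] LinearMap.range g from f) t))
          rw [sub_eq_add_neg]
          rfl)
    refine ⟨ModuleCat.of _ (HomMod φ (Fin n → T)), π, hπ, hproj, ?_⟩
    rw [hU]
    exact Module.Projective.of_equiv (LinearEquiv.ofInjective _ hd)
  · exfalso
    have hU : U = ⊤ := by
      rw [← hUWt, eq_comm, sup_eq_left]
      intro w hw
      have h1 : π w ∈ W.map π := ⟨w, hw, rfl⟩
      rw [h] at h1
      have h2 : w ∈ U ⊓ W := by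
        rw [hUW]
        exact h1
      exact h2.1
    obtain ⟨ρ, hρ⟩ := exists_rep φ (q.comp π)
    have hρg : ρ.comp g = 0 := by
      have h1 : ∀ y : T →ₗ[S] (Fin m → T), ρ.comp (g.comp y) = 0 := by
        intro y
        have h2 : map φ g y ∈ LinearMap.ker π := hg ▸ LinearMap.mem_range_self _ _
        refine (hρ (g.comp y)).symm.trans ?_
        change φ (q (π (map φ g y))) = 0
        rw [LinearMap.mem_ker.1 h2, map_zero, map_zero]
      refine LinearMap.pi_ext' fun j => ?_
      exact h1 (LinearMap.single S (fun _ => T) j)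
    have hρ0 : ρ = 0 := by
      refine LinearMap.pi_ext' fun j => LinearMap.ext fun t => ?_
      have h1 : (show HomMod φ (Fin n → T) from LinearMap.single S (fun _ => T) j) ∈ U := by
        rw [hU]
        exact Submodule.mem_top
      obtain ⟨u, hu⟩ := h1
      obtain ⟨y, hy⟩ := ((show T →ₗ[S] LinearMap.range g from u) t).2
      have hu' : LinearMap.single S (fun _ => T) j t =
          ((show T →ₗ[S] LinearMap.range g from u) t : LinearMap.range g) :=
        (LinearMap.congr_fun hu t).symm
      rw [LinearMap.comp_apply, hu']
      change ρ (((show T →ₗ[S] LinearMap.range g from u) t : LinearMap.range g) : Fin n → T) = 0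
      rw [← hy]
      exact LinearMap.congr_fun hρg y
    apply hq
    refine LinearMap.ext fun x => ?_
    obtain ⟨x, rfl⟩ := hπ x
    apply φ.injective
    rw [LinearMap.zero_apply, map_zero]
    refine (hρ x).trans ?_
    exact hρ0 ▸ LinearMap.zero_comp _

end HomModules

end Toupie

namespace Toupie

section Assembly

variable {k : Type u} [Field k] {T : ToupieAlg k}

instance isNoetherianRing_op_alg : IsNoetherianRing (Alg T)ᵐᵒᵖ :=
  haveI : Module.Finite k (Alg T)ᵐᵒᵖ := Module.Finite.equiv (opLinearEquiv k)
  IsNoetherianRing.of_finite k _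

variable (T) in
/-- Left multiplication by `e₀`, as an endomorphism of the right regular module. -/
def mulE0 : Alg T →ₗ[(Alg T)ᵐᵒᵖ] Alg T where
  toFun a := e0 T * a
  map_add' := mul_add _
  map_smul' r a := (mul_assoc (e0 T) a r.unop).symm

variable (T) in
/-- The indecomposable projective right module `e₀A` at the source. -/
def projSrc : ModuleCat.{u} (Alg T)ᵐᵒᵖ := ModuleCat.of _ (LinearMap.range (mulE0 T))

/-- The right regular module as a module over the opposite ring. -/
def regularEquiv (A : Type u) [Ring A] : A ≃ₗ[Aᵐᵒᵖ] Aᵐᵒᵖ where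
  toFun := op
  map_add' _ _ := rfl
  map_smul' _ _ := rfl
  invFun := unop
  left_inv _ := rfl
  right_inv _ := rfl

lemma finite_regular (A : Type u) [Ring A] : Module.Finite Aᵐᵒᵖ A :=
  Module.Finite.equiv (regularEquiv A).symm

lemma projective_regular (A : Type u) [Ring A] : Module.Projective Aᵐᵒᵖ A :=
  Module.Projective.of_equiv (regularEquiv A).symm

namespace Dat

lemma projSrc_fix (x : LinearMap.range (mulE0 T)) : e0 T * x.1 = x.1 := by
  obtain ⟨_, a, rfl⟩ := x
  change e0 T * (e0 T * a) = e0 T * a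
  rw [← mul_assoc, e0_mul_e0]

lemma fd_projSrc : FdMod _ (projSrc T) :=
  haveI := finite_regular (Alg T)
  Module.Finite.of_surjective (mulE0 T).rangeRestrict (mulE0 T).surjective_rangeRestrict

lemma projective_projSrc : Module.Projective (Alg T)ᵐᵒᵖ (projSrc T) :=
  haveI := projective_regular (Alg T)
  Module.Projective.of_split (LinearMap.range (mulE0 T)).subtype (mulE0 T).rangeRestrict
    (LinearMap.ext fun x => Subtype.ext (projSrc_fix x))

variable (D : Dat T)

/-- The map `Z → e₀A` obtained by restricting the codomain of `zHom`. -/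
def zHomSrc : D.Z →ₗ[(Alg T)ᵐᵒᵖ] projSrc T :=
  D.zHom.codRestrict (LinearMap.range (mulE0 T)) fun m => ⟨D.zHom m, D.e0_mul_zHom m⟩

lemma zHomSrc_ne_zero : D.zHomSrc ≠ 0 := fun h =>
  D.zHom_ne_zero (LinearMap.ext fun m => congrArg Subtype.val (LinearMap.congr_fun h m))

lemma indec_projSrc (D : Dat T) : Indec _ (projSrc T) := by
  constructor
  · obtain ⟨m, hm⟩ := not_forall.1 fun h => D.zHomSrc_ne_zero (LinearMap.ext h)
    exact ⟨_, _, hm⟩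
  · intro f hf
    let p : LinearMap.range (mulE0 T) := ⟨e0 T, e0 T, e0_mul_e0⟩
    let g : LinearMap.range (mulE0 T) →ₗ[(Alg T)ᵐᵒᵖ] LinearMap.range (mulE0 T) := f
    have hp (x : LinearMap.range (mulE0 T)) : op x.1 • p = x := Subtype.ext (projSrc_fix x)
    have hg (x : LinearMap.range (mulE0 T)) : g x = op x.1 • g p := by
      rw [← map_smul, hp]
    have hpe : (g p).1 * e0 T = (g p).1 := by
      have := congrArg Subtype.val (hg p)
      exact this.symm
    obtain ⟨c, hc⟩ := exists_smul_e0 T (g p).1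
    rw [hpe] at hc
    have hgx (x : LinearMap.range (mulE0 T)) : (g x).1 = c • x.1 := by
      have := congrArg Subtype.val (hg x)
      refine this.trans ?_
      change (g p).1 * x.1 = _
      rw [hc, smul_mul_assoc, projSrc_fix]
    have hgg : c • c • e0 T = c • e0 T := by
      have h1 := congrArg Subtype.val (LinearMap.congr_fun hf p)
      change (g (g p)).1 = (g p).1 at h1
      rwa [hgx, hc] at h1
    by_cases h0 : c • e0 T = 0
    · left
      refine LinearMap.ext fun x => Subtype.ext ?_
      refine (hgx x).trans ?_
      rw [← projSrc_fix x, ← smul_mul_assoc, h0, zero_mul]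
      rfl
    · right
      have hc0 : c ≠ 0 := fun h => h0 (by rw [h, zero_smul])
      have h2 := smul_right_injective (Alg T) hc0 hgg
      refine LinearMap.ext fun x => Subtype.ext ?_
      refine (hgx x).trans ?_
      rw [← projSrc_fix x, ← smul_mul_assoc]
      rw [show c • e0 T = e0 T from h2]
      exact projSrc_fix x

lemma step_projSrc : Step _ D.Z (projSrc T) := by
  refine ⟨D.indec_Z, D.fd_Z, D.indec_projSrc, fd_projSrc, D.zHomSrc, D.zHomSrc_ne_zero, ?_⟩
  intro hb
  obtain ⟨m, hm, h0, -⟩ := D.exists_Z_src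
  exact hm (hb.1 ((Subtype.ext h0 : D.zHomSrc m = 0).trans (map_zero _).symm))

lemma not_quasitilted (D : Dat T) : ¬ Quasitilted (Alg T)ᵐᵒᵖ := fun h =>
  D.not_pdLeOne_Z ((h _ D.indec_projSrc fd_projSrc projective_projSrc).2.2 _ D.indec_Z D.fd_Z
    (.single D.step_projSrc))

lemma not_isTilted (D : Dat T) : ¬ IsTilted k (Alg T) := by
  rintro ⟨H, _, _, _, hH, X, _, _, ⟨_, hext, _⟩, _, _, _, φ, _⟩
  exact D.not_pdLeOne_Z (pdLeOne_of_selfExtVanish hH hext φ D.indec_Z D.fd_Z D.zHom_ne_zero)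

end Dat

end Assembly

end Toupie

namespace Toupie

/-- A toupie algebra that is not hereditary and not simply connected,
and none of whose branches lies in the ideal `I`, is not a laura algebra (hence is
neither tilted, nor quasitilted, nor weakly shod). -/
theorem not_laura_of_no_branch_in_ideal {k : Type u} [Field k] (T : ToupieAlg k)
    (hnh : ¬ Hereditary (Alg T)ᵐᵒᵖ) (hnsc : ¬ SimplyConnected T)
    (hnb : ∀ i : Fin T.t, ¬ branchInI T i) :
    ¬ Laura (Alg T)ᵐᵒᵖ ∧ ¬ IsTilted k (Alg T) ∧ ¬ Quasitilted (Alg T)ᵐᵒᵖ ∧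
      ¬ WeaklyShod (Alg T)ᵐᵒᵖ := by
  obtain ⟨r, c₁, c₂, hr, hc₁, hc₂, rel₁, rel₂, disj, r_c₂⟩ :=
    exists_functionals T (fun h => hnh (hereditary_of_eq_bot T h)) hnsc hnb
  let D : Dat T := ⟨hnb, r, c₁, c₂, hr, hc₁, hc₂, rel₁, rel₂, disj, r_c₂⟩
  exact ⟨D.not_laura, D.not_isTilted, D.not_quasitilted, D.not_weaklyShod⟩

end Toupie
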